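/- arXiv:1010.5699 — 5 statements merged into one kernel-verified Lean document; each statement's English description precedes it below -/
import Mathlib

section
/- Let d≥3 be an integer, W=ℝ^{d+1}, D=binom(d+1,2). Let G=(V,E) be a finite multigraph. Then the following are equivalent: (1) there exist an assignment to each v∈V of a nonzero decomposable element r_v∈⋀^{d−1}W, pairwise non-proportional, and vectors a_e,b_e∈W for each e∈E with q_e := a_e∧b_e ≠ 0 and q_e∧r_u = q_e∧r_v = 0 for the endpoints u,v of e, such that the rod-bar framework is minimally infinitesimally rigid, meaning: the space of maps m:V→⋀^{d−1}W satisfying q_e∧(m(u)−m(v)) = 0 in ⋀^{d+1}W for every edge e with endpoints u,v has dimension exactly D+|V|, while for each e₀∈E the space of maps satisfying these constraints for all edges except e₀ has dimension at least D+|V|+1; (2) |E| = (D−1)|V| − D and |F| ≤ (D−1)|V(F)| − D for every nonempty F⊆E. (Tay's characterization of generic rigidity of rod-bar frameworks.) -/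
/- STATEMENT 4 (Tay): existence of a minimally infinitesimally rigid rod-bar realization is
equivalent to the count condition `|E| = (D-1)|V| - D` together with
`|F| ≤ (D-1)|V(F)| - D` for all nonempty `F ⊆ E`. -/

set_option synthInstance.maxHeartbeats 1000000
set_option maxHeartbeats 1000000

open ExteriorAlgebra

/-- `W = ℝ^{d+1}`. -/
abbrev Wd (d : ℕ) : Type := Fin (d + 1) → ℝ

/-- The exterior algebra of `W = ℝ^{d+1}`; the exterior powers `⋀^k W` are realized as
the degree-`k` homogeneous submodules of this algebra, and the exterior product is the
algebra multiplication. -/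
abbrev ExtAlg (d : ℕ) : Type := ExteriorAlgebra ℝ (Wd d)

/-- The degree-`k` homogeneous part `⋀^k W` of the exterior algebra. -/
noncomputable def extGrade (d k : ℕ) : Submodule ℝ (ExtAlg d) :=
  (LinearMap.range (ι ℝ : Wd d →ₗ[ℝ] ExtAlg d)) ^ k

/-- `x` is a decomposable element of `⋀^k W`, i.e. `x = w₁ ∧ ⋯ ∧ w_k`. -/
def IsDecomp (d k : ℕ) (x : ExtAlg d) : Prop :=
  ∃ w : Fin k → Wd d, x = (List.ofFn fun i => ι ℝ (w i)).prod

/-- The set `V(F)` of vertices spanned by an edge set `F`. -/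
def VF {V E : Type} [DecidableEq V] (ends : E → V × V) (F : Finset E) : Finset V :=
  F.image (fun e => (ends e).1) ∪ F.image (fun e => (ends e).2)

/-- The space of infinitesimal motions `m : V → ⋀^{d-1}W` satisfying the bar constraints
`q_e ∧ (m(u) - m(v)) = 0` for all edges `e` in a subset `E₀` of the edges. -/
noncomputable def motionSpace {V E : Type} [DecidableEq V] (d : ℕ) (ends : E → V × V)
    (q : E → ExtAlg d) (E₀ : Set E) : Submodule ℝ (V → ExtAlg d) :=
  (⨅ v : V, (extGrade d (d - 1)).comap (LinearMap.proj v : (V → ExtAlg d) →ₗ[ℝ] ExtAlg d)) ⊓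
  (⨅ e ∈ E₀, LinearMap.ker ((LinearMap.mulLeft ℝ (q e)).comp
      ((LinearMap.proj (ends e).1 : (V → ExtAlg d) →ₗ[ℝ] ExtAlg d)
        - LinearMap.proj (ends e).2)))

set_option synthInstance.maxHeartbeats 1000000
set_option maxHeartbeats 1000000
set_option linter.unusedSectionVars false
set_option linter.unusedSimpArgs false
set_option linter.unusedVariables false
namespace RB
section core
variable {V E X : Type} [Fintype V] [Fintype E] [DecidableEq V] [DecidableEq E]
  [AddCommGroup X] [Module ℝ X]

/-- Body motions compatible with the incidences. -/
def NN (ω : V → X) (I : V → Finset E) : Submodule ℝ (E → X) where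
  carrier := {t | ∀ u, ∀ i ∈ I u, ∀ j ∈ I u, t i - t j ∈ Submodule.span ℝ {ω u}}
  add_mem' := by
    intro a b ha hb u i hi j hj
    have := Submodule.add_mem _ (ha u i hi j hj) (hb u i hi j hj)
    simpa [add_sub_add_comm] using this
  zero_mem' := by intro u i _ j _; simp
  smul_mem' := by
    intro c a ha u i hi j hj
    have := Submodule.smul_mem _ c (ha u i hi j hj)
    simpa [smul_sub] using this

theorem mem_NN {ω : V → X} {I : V → Finset E} {t : E → X} :
    t ∈ NN ω I ↔ ∀ u, ∀ i ∈ I u, ∀ j ∈ I u, t i - t j ∈ Submodule.span ℝ {ω u} := Iff.rfl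

theorem NN_mono (ω : V → X) {I J : V → Finset E} (h : ∀ u, I u ⊆ J u) : NN ω J ≤ NN ω I :=
  fun _ ht u i hi j hj => ht u i (h u hi) j (h u hj)

/-- genericity -/
def Gen (E : Type) (S : Set X) (ω : V → X) : Prop :=
  (∀ v, ω v ∈ S ∧ ω v ≠ 0) ∧ ∀ (I : V → Finset E) (ω' : V → X), (∀ v, ω' v ∈ S ∧ ω' v ≠ 0) →
    Module.finrank ℝ (NN ω I) ≤ Module.finrank ℝ (NN ω' I)

def Unlocked (ω : V → X) (I : V → Finset E) : Prop :=
  ∀ i j : E, i ≠ j → ∃ t ∈ NN ω I, t i ≠ t j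

theorem Unlocked.mono {ω : V → X} {I J : V → Finset E} (h : ∀ u, I u ⊆ J u)
    (hJ : Unlocked ω J) : Unlocked ω I := by
  intro i j hij
  obtain ⟨t, ht, h2⟩ := hJ i j hij
  exact ⟨t, NN_mono ω h ht, h2⟩

/-- the diff map -/
def dif (i j : E) : (E → X) →ₗ[ℝ] X := (LinearMap.proj i : (E → X) →ₗ[ℝ] X) - LinearMap.proj j

@[simp] theorem dif_apply (i j : E) (t : E → X) : dif i j t = t i - t j := rfl

theorem NN_erase (ω : V → X) (I : V → Finset E) (u : V) {i j : E} (hi : i ∈ I u) (hj : j ∈ I u)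
    (hij : i ≠ j) :
    NN ω I = NN ω (Function.update I u ((I u).erase i)) ⊓
      (Submodule.span ℝ {ω u}).comap (dif i j) := by
  ext t
  simp only [Submodule.mem_inf, Submodule.mem_comap, dif_apply]
  constructor
  · intro h
    refine ⟨NN_mono ω ?_ h, h u i hi j hj⟩
    intro v
    by_cases hv : v = u
    · subst hv; simp [Finset.erase_subset]
    · simp [Function.update_of_ne hv]
  · rintro ⟨h, h2⟩ v k hk l hl
    by_cases hv : v = u
    · subst hv
      have key : ∀ k ∈ I v, t k - t j ∈ Submodule.span ℝ {ω v} := by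
        intro k hk
        by_cases hki : k = i
        · rw [hki]; exact h2
        · exact h v k (by simp [hki, hk]) j (by simp [hij.symm, hj])
      have := Submodule.sub_mem _ (key k hk) (key l hl)
      simpa using this
    · exact h v k (by simpa [Function.update_of_ne hv] using hk) l
        (by simpa [Function.update_of_ne hv] using hl)

variable [FiniteDimensional ℝ X]

theorem finrank_comap_line {M : Type} [AddCommGroup M] [Module ℝ M] [FiniteDimensional ℝ M]
    (N : Submodule ℝ M) (f : M →ₗ[ℝ] X) (hf : N.map f = ⊤) {y : X} (hy : y ≠ 0) :
    Module.finrank ℝ ↥(N ⊓ (Submodule.span ℝ {y}).comap f) + Module.finrank ℝ X =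
      Module.finrank ℝ N + 1 := by
  have h1 := LinearMap.finrank_range_add_finrank_ker (f.domRestrict N)
  have hr : LinearMap.range (f.domRestrict N) = ⊤ := by
    rw [LinearMap.range_domRestrict, hf]
  rw [hr, finrank_top] at h1
  set N' := N ⊓ (Submodule.span ℝ {y}).comap f with hN'
  have h2 := LinearMap.finrank_range_add_finrank_ker (f.domRestrict N')
  have hr2 : LinearMap.range (f.domRestrict N') = Submodule.span ℝ {y} := by
    rw [LinearMap.range_domRestrict]
    apply le_antisymm
    · rintro _ ⟨t, ht, rfl⟩; exact ht.2
    · intro x hx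
      have : x ∈ N.map f := by rw [hf]; trivial
      obtain ⟨t, ht, rfl⟩ := this
      exact ⟨t, ⟨ht, hx⟩, rfl⟩
  rw [hr2, finrank_span_singleton hy] at h2
  have e1 : (LinearMap.ker (f.domRestrict N)).map N.subtype = N ⊓ LinearMap.ker f := by
    ext t; simp [Submodule.mem_map, LinearMap.mem_ker]; tauto
  have e2 : (LinearMap.ker (f.domRestrict N')).map N'.subtype = N ⊓ LinearMap.ker f := by
    ext t; simp only [Submodule.mem_map, LinearMap.mem_ker, hN', Submodule.mem_inf]
    constructor
    · rintro ⟨⟨x, hx⟩, hx2, rfl⟩; exact ⟨hx.1, hx2⟩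
    · rintro ⟨h1, h2⟩
      exact ⟨⟨t, h1, by simp [h2]⟩, by simpa using h2, rfl⟩
  have e3 : Module.finrank ℝ (LinearMap.ker (f.domRestrict N)) =
      Module.finrank ℝ (LinearMap.ker (f.domRestrict N')) := by
    rw [← Submodule.finrank_map_subtype_eq N, ← Submodule.finrank_map_subtype_eq N', e1, e2]
  omega

theorem sum_upd (g : Finset E → ℕ) (I : V → Finset E) (u : V) (A : Finset E) :
    ∑ v, g (Function.update I u A v) + g (I u) = ∑ v, g (I v) + g A := by
  rw [← Finset.add_sum_erase _ _ (Finset.mem_univ u),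
    ← Finset.add_sum_erase Finset.univ (fun v => g (I v)) (Finset.mem_univ u)]
  have : ∑ x ∈ Finset.univ.erase u, g (Function.update I u A x) =
      ∑ x ∈ Finset.univ.erase u, g (I x) := by
    apply Finset.sum_congr rfl
    intro x hx
    rw [Function.update_of_ne (Finset.ne_of_mem_erase hx)]
  rw [this]; simp; ring

theorem upd_sub (I : V → Finset E) (u : V) (i : E) (v : V) :
    Function.update I u ((I u).erase i) v ⊆ I v := by
  by_cases hv : v = u
  · subst hv; simp [Finset.erase_subset]
  · simp [Function.update_of_ne hv]

theorem stepB (ω : V → X) (hω : ∀ v, ω v ≠ 0) (I : V → Finset E) (u : V) {i j : E}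
    (hi : i ∈ I u) (hj : j ∈ I u) (hij : i ≠ j)
    (hsurj : (NN ω (Function.update I u ((I u).erase i))).map (dif i j) = ⊤)
    (IH : Module.finrank ℝ (NN ω (Function.update I u ((I u).erase i))) +
      (Module.finrank ℝ X - 1) * ∑ v, ((Function.update I u ((I u).erase i) v).card - 1) ≤
      Module.finrank ℝ X * Fintype.card E) :
    Module.finrank ℝ (NN ω I) + (Module.finrank ℝ X - 1) * ∑ v, ((I v).card - 1) ≤
      Module.finrank ℝ X * Fintype.card E := by
  have h1 := finrank_comap_line (NN ω (Function.update I u ((I u).erase i))) (dif i j) hsurj (hω u)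
  rw [← NN_erase ω I u hi hj hij] at h1
  have h2 := sum_upd (fun A => A.card - 1) I u ((I u).erase i)
  have hc : 1 < (I u).card := Finset.one_lt_card.2 ⟨i, hi, j, hj, hij⟩
  simp only [Finset.card_erase_of_mem hi] at h2
  have h3 : ∑ v, ((I v).card - 1) =
    ∑ v, ((Function.update I u ((I u).erase i) v).card - 1) + 1 := by omega
  rw [h3, mul_add, mul_one]
  have : 0 < Module.finrank ℝ X := Module.finrank_pos_iff_exists_ne_zero.2 ⟨_, hω u⟩
  omega

theorem card_sum_swap (I : V → Finset E) :
    ∑ u, (I u).card = ∑ i : E, (Finset.univ.filter (fun u => i ∈ I u)).card := by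
  simp only [Finset.card_eq_sum_ones, Finset.sum_filter]
  rw [Finset.sum_comm]
  simp

/-- lower bound when not locked -/
theorem lower (ω : V → X) (I : V → Finset E) (T : Finset E) (hT : ∀ u, I u ⊆ T) (i j : E)
    (hi : i ∈ T) (hj : j ∈ T) (t : E → X) (ht : t ∈ NN ω I) (hij : t i ≠ t j) :
    Module.finrank ℝ X * (Fintype.card E - T.card) + Module.finrank ℝ X + 1 ≤
      Module.finrank ℝ (NN ω I) := by
  classical
  let f : (X × ({e // e ∉ T} → X)) →ₗ[ℝ] (E → X) :=
    { toFun := fun p e => if h : e ∈ T then p.1 else p.2 ⟨e, h⟩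
      map_add' := by
        intro p q; ext e; by_cases h : e ∈ T <;> simp [h]
      map_smul' := by
        intro c p; ext e; by_cases h : e ∈ T <;> simp [h] }
  have hf : Function.Injective f := by
    intro p q hpq
    have h1 : p.1 = q.1 := by
      have := congrFun hpq i
      simpa [f, hi] using this
    have h2 : p.2 = q.2 := by
      ext ⟨e, he⟩
      have := congrFun hpq e
      simpa [f, he] using this
    exact Prod.ext h1 h2
  have hle : LinearMap.range f ≤ NN ω I := by
    rintro _ ⟨p, rfl⟩ u k hk l hl
    simp [f, hT u hk, hT u hl]
  have hlt : LinearMap.range f < NN ω I := by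
    refine lt_of_le_of_ne hle ?_
    intro h
    rw [← h] at ht
    obtain ⟨p, rfl⟩ := ht
    simp [f, hi, hj] at hij
  have h1 := Submodule.finrank_lt_finrank_of_lt hlt
  rw [LinearMap.finrank_range_of_inj hf] at h1
  have h2 : Fintype.card {e // e ∉ T} = Fintype.card E - T.card := by
    rw [Fintype.card_subtype_compl]; simp
  rw [Module.finrank_prod, Module.finrank_pi_fintype] at h1
  simp only [Finset.sum_const, Finset.card_univ, h2, smul_eq_mul] at h1
  rw [mul_comm]
  omega

theorem claimB (hD : 6 ≤ Module.finrank ℝ X) (S : Set X) (hS : Submodule.span ℝ S = ⊤)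
    (ω : V → X) (hG : Gen E S ω) : ∀ (n : ℕ) (I : V → Finset E), ∑ u, (I u).card = n →
    Unlocked ω I →
    Module.finrank ℝ (NN ω I) + (Module.finrank ℝ X - 1) * ∑ v, ((I v).card - 1) ≤
      Module.finrank ℝ X * Fintype.card E := by
  intro n
  induction n with
  | zero =>
    intro I hI _
    have h0 : ∀ v, (I v).card = 0 := by
      intro v
      have := Finset.sum_eq_zero_iff.1 hI v (Finset.mem_univ v)
      exact this
    simp only [h0]
    have := Submodule.finrank_le (NN ω I)
    rw [Module.finrank_pi_fintype] at this
    simp at this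
    simp
    linarith
  | succ n ih =>
    intro I hI hU
    have hω : ∀ v, ω v ≠ 0 := fun v => (hG.1 v).2
    have IH : ∀ u i, i ∈ I u → Module.finrank ℝ (NN ω (Function.update I u ((I u).erase i))) +
      (Module.finrank ℝ X - 1) * ∑ v, ((Function.update I u ((I u).erase i) v).card - 1) ≤
      Module.finrank ℝ X * Fintype.card E := by
      intro u i hi
      apply ih
      · have := sum_upd (fun A => A.card) I u ((I u).erase i)
        simp only [Finset.card_erase_of_mem hi] at this
        have : 0 < (I u).card := Finset.card_pos.2 ⟨i, hi⟩
        omega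
      · exact hU.mono (upd_sub I u i)
    -- case 2
    by_cases c2 : ∃ u, (I u).card = 1
    · obtain ⟨u, hu⟩ := c2
      obtain ⟨i, hi⟩ := Finset.card_eq_one.1 hu
      have := IH u i (by simp [hi])
      have hN : NN ω (Function.update I u ((I u).erase i)) = NN ω I := by
        apply le_antisymm
        · intro t ht v k hk l hl
          by_cases hv : v = u
          · subst hv
            rw [hi, Finset.mem_singleton] at hk hl
            simp [hk, hl]
          · exact ht v k (by simpa [Function.update_of_ne hv] using hk) l
              (by simpa [Function.update_of_ne hv] using hl)
        · exact NN_mono ω (upd_sub I u i)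
      have h2 := sum_upd (fun A => A.card - 1) I u ((I u).erase i)
      simp only [hi] at h2
      simp at h2
      rw [hN, hi] at this
      simp at this
      rw [h2] at this
      exact this
    -- case 1
    by_cases c1 : ∃ u, (I u).card = 2
    · obtain ⟨u, hu⟩ := c1
      obtain ⟨i, j, hij, hIu⟩ := Finset.card_eq_two.1 hu
      have hi : i ∈ I u := by simp [hIu]
      have hj : j ∈ I u := by simp [hIu]
      refine stepB ω hω I u hi hj hij ?_ (IH u i hi)
      by_contra hne
      set N'' := NN ω (Function.update I u ((I u).erase i)) with hN''
      obtain ⟨y, hyS, hy⟩ : ∃ y ∈ S, y ∉ N''.map (dif i j) := by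
        by_contra hcon
        push Not at hcon
        apply hne
        rw [eq_top_iff, ← hS, Submodule.span_le]
        exact hcon
      have hy0 : y ≠ 0 := by
        rintro rfl; exact hy (Submodule.zero_mem _)
      set ω' := Function.update ω u y with hω'
      have hg := hG.2 I ω' (by
        intro v
        by_cases hv : v = u
        · subst hv; simp [hω', hyS, hy0]
        · simp only [hω', Function.update_of_ne hv]; exact hG.1 v)
      have hsame : NN ω' (Function.update I u ((I u).erase i)) = N'' := by
        have he : (I u).erase i = {j} := by
          rw [hIu]; ext x; simp
          rintro rfl; exact hij.symm
        ext t
        rw [hN'', mem_NN, mem_NN]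
        apply forall_congr'
        intro v
        by_cases hv : v = u
        · subst hv; simp [he]
        · simp [hω', Function.update_of_ne hv]
      have hzero : ∀ t ∈ NN ω' I, t i = t j := by
        intro t ht
        rw [NN_erase ω' I u hi hj hij, hsame] at ht
        obtain ⟨h1, h2⟩ := ht
        rw [SetLike.mem_coe, Submodule.mem_comap, Submodule.mem_span_singleton] at h2
        obtain ⟨c, hc⟩ := h2
        by_cases hc0 : c = 0
        · rw [hc0, zero_smul, dif_apply] at hc
          exact (sub_eq_zero.1 hc.symm)
        · exfalso; apply hy
          refine ⟨c⁻¹ • t, Submodule.smul_mem _ _ h1, ?_⟩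
          rw [map_smul, ← hc]; simp [hω', hc0]
      have hle : NN ω' I ≤ NN ω I := by
        intro t ht
        have hz := hzero t ht
        rw [NN_erase ω I u hi hj hij]
        refine ⟨?_, by simp [hz]⟩
        rw [NN_erase ω' I u hi hj hij, hsame] at ht
        exact ht.1
      have heq := Submodule.eq_of_le_of_finrank_le hle hg
      obtain ⟨t, ht, htne⟩ := hU i j hij
      rw [← heq] at ht
      exact htne (hzero t ht)
    -- case 0
    by_cases c0 : ∃ i, (Finset.univ.filter (fun u => i ∈ I u)).card = 1
    · obtain ⟨i, hi⟩ := c0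
      obtain ⟨u, hu⟩ := Finset.card_eq_one.1 hi
      have hiu : ∀ v, i ∈ I v ↔ v = u := by
        intro v
        have : v ∈ Finset.univ.filter (fun u => i ∈ I u) ↔ v ∈ ({u} : Finset V) := by rw [hu]
        simpa using this
      have hi' : i ∈ I u := (hiu u).2 rfl
      have hc : 1 < (I u).card := by
        have h0 : 0 < (I u).card := Finset.card_pos.2 ⟨i, hi'⟩
        have h1 : (I u).card ≠ 1 := fun h => c2 ⟨u, h⟩
        omega
      obtain ⟨j, hj, hji⟩ := Finset.exists_mem_ne hc i
      refine stepB ω hω I u hi' hj hji.symm ?_ (IH u i hi')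
      rw [eq_top_iff]
      intro x _
      refine ⟨Pi.single i x, ?_, ?_⟩
      · intro v k hk l hl
        have hnot : ∀ k ∈ Function.update I u ((I u).erase i) v, k ≠ i := by
          rintro k hk rfl
          by_cases hv : v = u
          · subst hv; simp at hk
          · rw [Function.update_of_ne hv] at hk
            exact hv ((hiu v).1 hk)
        simp [Pi.single_eq_of_ne (hnot k hk), Pi.single_eq_of_ne (hnot l hl)]
      · simp [Pi.single_eq_of_ne hji]
    -- case 3
    exfalso
    have hex : ∃ u, (I u).card ≠ 0 := by
      by_contra hcon
      push Not at hcon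
      simp [hcon] at hI
    obtain ⟨u, hu⟩ := hex
    have hu1 : 1 < (I u).card := by
      have h1 : (I u).card ≠ 1 := fun h => c2 ⟨u, h⟩
      omega
    obtain ⟨i, hi, j, hj, hij⟩ := Finset.one_lt_card.1 hu1
    obtain ⟨t, ht, htne⟩ := hU i j hij
    set T : Finset E := Finset.univ.filter (fun i => ∃ u, i ∈ I u) with hT
    have hlow := lower ω I T (by intro v k hk; simp [hT]; exact ⟨v, hk⟩) i j
      (by simp [hT]; exact ⟨u, hi⟩) (by simp [hT]; exact ⟨u, hj⟩) t ht htne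
    have hmono := Submodule.finrank_mono (NN_mono ω (upd_sub I u i))
    have hIH := IH u i hi
    have h2 := sum_upd (fun A => A.card - 1) I u ((I u).erase i)
    simp only [Finset.card_erase_of_mem hi] at h2
    set s := ∑ v, (I v).card with hs
    set q := ∑ v, ((I v).card - 1) with hq
    set q'' := ∑ v, ((Function.update I u ((I u).erase i) v).card - 1) with hq''
    have hqq : q'' + 1 = q := by omega
    have h23 : 2 * s ≤ 3 * q := by
      rw [hs, hq, Finset.mul_sum, Finset.mul_sum]
      apply Finset.sum_le_sum
      intro v _
      have h1 : (I v).card ≠ 1 := fun h => c2 ⟨v, h⟩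
      have h2 : (I v).card ≠ 2 := fun h => c1 ⟨v, h⟩
      omega
    have hp : 2 * T.card ≤ s := by
      rw [hs, card_sum_swap, hT, Finset.card_filter, Finset.mul_sum]
      apply Finset.sum_le_sum
      intro k _
      have h1 : (Finset.univ.filter (fun u => k ∈ I u)).card ≠ 1 := fun h => c0 ⟨k, h⟩
      split_ifs with hk
      · obtain ⟨v, hv⟩ := hk
        have : 0 < (Finset.univ.filter (fun u => k ∈ I u)).card :=
          Finset.card_pos.2 ⟨v, by simp [hv]⟩
        omega
      · simp
    have hpE : T.card ≤ Fintype.card E := Finset.card_le_univ T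
    obtain ⟨D', hD'⟩ : ∃ D', Module.finrank ℝ X = D' + 6 := ⟨_, (Nat.sub_add_cancel hD).symm⟩
    obtain ⟨E', hE'⟩ : ∃ E', Fintype.card E = E' + T.card := ⟨_, (Nat.sub_add_cancel hpE).symm⟩
    rw [hD'] at hIH hlow
    rw [hE'] at hIH hlow
    simp only [Nat.add_sub_cancel] at hlow
    have e1 : D' + 6 - 1 = D' + 5 := rfl
    rw [e1] at hIH
    have e2 := hlow.trans hmono
    have e3 : (D' + 6) * E' + (D' + 6) + 1 + (D' + 5) * q'' ≤ (D' + 6) * (E' + T.card) := by omega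
    have e4 : (D' + 6) + 1 + (D' + 5) * q'' ≤ (D' + 6) * T.card := by nlinarith
    have e5 : 4 * T.card ≤ 3 * q'' + 3 := by omega
    have e6 : 4 * ((D' + 6) + 1 + (D' + 5) * q'') ≤ (D' + 6) * (3 * q'' + 3) := by
      calc _ ≤ 4 * ((D' + 6) * T.card) := by omega
        _ = (D' + 6) * (4 * T.card) := by ring
        _ ≤ _ := Nat.mul_le_mul_left _ e5
    nlinarith [Nat.zero_le (D' * q'')]
end core
end RB

set_option synthInstance.maxHeartbeats 1000000
set_option maxHeartbeats 1000000
set_option linter.unusedSectionVars false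
set_option linter.unusedSimpArgs false
set_option linter.unusedVariables false
namespace RB
section core2
variable {V E X : Type} [Fintype V] [Fintype E] [DecidableEq V] [DecidableEq E]
  [AddCommGroup X] [Module ℝ X] [FiniteDimensional ℝ X]

theorem claimA (hD : 6 ≤ Module.finrank ℝ X) (S : Set X) (hS : Submodule.span ℝ S = ⊤)
    (ω : V → X) (hG : Gen E S ω) (I : V → Finset E) : ∃ κ : E → E,
    Module.finrank ℝ (NN ω I) + (Module.finrank ℝ X - 1) * ∑ v, (((I v).image κ).card - 1) ≤
      Module.finrank ℝ X * (Finset.univ.image κ).card := by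
  classical
  let r : Setoid E := ⟨fun i j => ∀ t ∈ NN ω I, t i = t j, fun i t _ => rfl,
    fun h t ht => (h t ht).symm, fun h1 h2 t ht => (h1 t ht).trans (h2 t ht)⟩
  let κ : E → E := fun i => (Quotient.mk r i).out
  have k1 : ∀ i, ∀ t ∈ NN ω I, t (κ i) = t i := fun i => Quotient.mk_out (s := r) i
  have k2 : ∀ i j, (∀ t ∈ NN ω I, t i = t j) → κ i = κ j := by
    intro i j h
    have : Quotient.mk r i = Quotient.mk r j := Quotient.sound h
    simp only [κ, this]
  have k3 : ∀ i, κ (κ i) = κ i := fun i => k2 _ _ (k1 i)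
  refine ⟨κ, ?_⟩
  set I' : V → Finset E := fun v => (I v).image κ with hI'
  have hle : NN ω I ≤ NN ω I' := by
    intro t ht u i hi j hj
    obtain ⟨i, hi', rfl⟩ := Finset.mem_image.1 hi
    obtain ⟨j, hj', rfl⟩ := Finset.mem_image.1 hj
    rw [k1 i t ht, k1 j t ht]
    exact ht u i hi' j hj'
  have hrep : ∀ u, ∀ i ∈ I' u, κ i = i := by
    intro u i hi
    obtain ⟨i, hi, rfl⟩ := Finset.mem_image.1 hi
    exact k3 i
  have hX : ∃ x : X, x ≠ 0 := (Module.finrank_pos_iff_exists_ne_zero (R := ℝ)).1 (by omega)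
  obtain ⟨x, hx⟩ := hX
  have hsing : ∀ i, κ i ≠ i → (Pi.single i x : E → X) ∈ NN ω I' := by
    intro i hi u k hk l hl
    have h1 : k ≠ i := by rintro rfl; exact hi (hrep u k hk)
    have h2 : l ≠ i := by rintro rfl; exact hi (hrep u l hl)
    simp [h1, h2]
  have hU : Unlocked ω I' := by
    intro i j hij
    by_cases hi : κ i = i
    · by_cases hj : κ j = j
      · by_contra hcon
        push Not at hcon
        apply hij
        rw [← hi, ← hj]
        exact k2 i j (fun t ht => hcon t (hle ht))
      · refine ⟨_, hsing j hj, ?_⟩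
        simp [hij, hx.symm]
    · refine ⟨_, hsing i hi, ?_⟩
      simp [hij.symm, hx]
  have hB := claimB hD S hS ω hG _ I' rfl hU
  let f : (NN ω I × ({e // κ e ≠ e} → X)) →ₗ[ℝ] (E → X) :=
    { toFun := fun p e => if h : κ e = e then p.1.1 e else p.2 ⟨e, h⟩
      map_add' := by
        intro p q; ext e; by_cases h : κ e = e <;> simp [h]
      map_smul' := by
        intro c p; ext e; by_cases h : κ e = e <;> simp [h] }
  have hf : Function.Injective f := by
    intro p q hpq
    have h1 : p.1 = q.1 := by
      ext e
      rw [← k1 e _ p.1.2, ← k1 e _ q.1.2]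
      have := congrFun hpq (κ e)
      simpa [f, k3] using this
    have h2 : p.2 = q.2 := by
      ext ⟨e, he⟩
      have := congrFun hpq e
      simpa [f, he] using this
    exact Prod.ext h1 h2
  have hle2 : LinearMap.range f ≤ NN ω I' := by
    rintro _ ⟨p, rfl⟩ u k hk l hl
    have := hle p.1.2 u k hk l hl
    simpa [f, hrep u k hk, hrep u l hl] using this
  have h1 := Submodule.finrank_mono hle2
  rw [LinearMap.finrank_range_of_inj hf, Module.finrank_prod, Module.finrank_pi_fintype] at h1
  have h2 : Fintype.card {e // κ e ≠ e} + (Finset.univ.image κ).card = Fintype.card E := by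
    have : Finset.univ.image κ = Finset.univ.filter (fun e => κ e = e) := by
      ext e; simp
      constructor
      · rintro ⟨a, rfl⟩; exact k3 a
      · intro h; exact ⟨e, h⟩
    rw [this, Fintype.card_subtype, add_comm]
    exact Finset.card_filter_add_card_filter_not (s := Finset.univ) (fun e => κ e = e)
  simp only [Finset.sum_const, Finset.card_univ, smul_eq_mul] at h1
  rw [← h2, mul_add] at hB
  rw [mul_comm] at h1
  simp only [hI'] at hB h1 ⊢
  omega

/-- relaxed motions -/
def MM (ω : V → X) (ends : E → V × V) (F : Finset E) : Submodule ℝ (V → X) where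
  carrier := {m | ∀ e ∈ F, m (ends e).1 - m (ends e).2 ∈
    Submodule.span ℝ {ω (ends e).1, ω (ends e).2}}
  add_mem' := by
    intro a b ha hb e he
    have := Submodule.add_mem _ (ha e he) (hb e he)
    simpa [add_sub_add_comm] using this
  zero_mem' := by intro e _; simp
  smul_mem' := by
    intro c a ha e he
    have := Submodule.smul_mem _ c (ha e he)
    simpa [smul_sub] using this

def KK (ω : V → X) (ends : E → V × V) (F : Finset E) : Submodule ℝ ((E → X) × (V → X)) where
  carrier := {p | ∀ e ∈ F, p.2 (ends e).1 - p.1 e ∈ Submodule.span ℝ {ω (ends e).1} ∧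
    p.2 (ends e).2 - p.1 e ∈ Submodule.span ℝ {ω (ends e).2}}
  add_mem' := by
    intro a b ha hb e he
    have h1 := Submodule.add_mem _ (ha e he).1 (hb e he).1
    have h2 := Submodule.add_mem _ (ha e he).2 (hb e he).2
    constructor
    · simpa [add_sub_add_comm] using h1
    · simpa [add_sub_add_comm] using h2
  zero_mem' := by intro e _; simp
  smul_mem' := by
    intro c a ha e he
    have h1 := Submodule.smul_mem _ c (ha e he).1
    have h2 := Submodule.smul_mem _ c (ha e he).2
    constructor
    · simpa [smul_sub] using h1
    · simpa [smul_sub] using h2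

def inc (ends : E → V × V) (F : Finset E) (u : V) : Finset E :=
  F.filter (fun e => u = (ends e).1 ∨ u = (ends e).2)

theorem mem_VF (ends : E → V × V) (F : Finset E) (u : V) :
    u ∈ VF ends F ↔ ∃ e ∈ F, u = (ends e).1 ∨ u = (ends e).2 := by
  simp only [VF, Finset.mem_union, Finset.mem_image]
  constructor
  · rintro (⟨e, he, rfl⟩ | ⟨e, he, rfl⟩)
    · exact ⟨e, he, Or.inl rfl⟩
    · exact ⟨e, he, Or.inr rfl⟩
  · rintro ⟨e, he, rfl | rfl⟩
    · exact Or.inl ⟨e, he, rfl⟩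
    · exact Or.inr ⟨e, he, rfl⟩

theorem KK_ge (ω : V → X) (ends : E → V × V) (F : Finset E) :
    Module.finrank ℝ (MM ω ends F) + Module.finrank ℝ X * (Fintype.card E - F.card) ≤
      Module.finrank ℝ (KK ω ends F) := by
  classical
  let g : KK ω ends F →ₗ[ℝ] (V → X) := (LinearMap.snd ℝ _ _).domRestrict _
  have hr : MM ω ends F ≤ LinearMap.range g := by
    intro m hm
    have : ∀ e : E, ∃ x : X, e ∈ F → m (ends e).1 - x ∈ Submodule.span ℝ {ω (ends e).1} ∧
        m (ends e).2 - x ∈ Submodule.span ℝ {ω (ends e).2} := by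
      intro e
      by_cases he : e ∈ F
      · have := hm e he
        rw [Submodule.mem_span_pair] at this
        obtain ⟨a, b, hab⟩ := this
        refine ⟨m (ends e).1 - a • ω (ends e).1, fun _ => ⟨?_, ?_⟩⟩
        · rw [Submodule.mem_span_singleton]; exact ⟨a, by abel⟩
        · rw [Submodule.mem_span_singleton]
          refine ⟨-b, ?_⟩
          have : m (ends e).2 = m (ends e).1 - (a • ω (ends e).1 + b • ω (ends e).2) := by
            rw [hab]; abel
          rw [this, neg_smul]; abel
      · exact ⟨0, fun h => absurd h he⟩
    choose t ht using this
    exact ⟨⟨(t, m), fun e he => ht e he⟩, rfl⟩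
  have h0 := LinearMap.finrank_range_add_finrank_ker g
  have h1 := Submodule.finrank_mono hr
  let f : ({e // e ∉ F} → X) →ₗ[ℝ] ((E → X) × (V → X)) :=
    { toFun := fun p => (fun e => if h : e ∈ F then 0 else p ⟨e, h⟩, 0)
      map_add' := by
        intro p q; ext e
        · by_cases h : e ∈ F <;> simp [h]
        · simp
      map_smul' := by
        intro c p; ext e
        · by_cases h : e ∈ F <;> simp [h]
        · simp }
  have hf : Function.Injective f := by
    intro p q hpq
    ext ⟨e, he⟩
    have := congrFun (congrArg Prod.fst hpq) e
    simpa [f, he] using this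
  have h2 : LinearMap.range f ≤ (LinearMap.ker g).map (KK ω ends F).subtype := by
    rintro _ ⟨p, rfl⟩
    refine ⟨⟨f p, ?_⟩, ?_, rfl⟩
    · intro e he
      simp [f, he]
    · rw [SetLike.mem_coe, LinearMap.mem_ker]; rfl
  have h3 := Submodule.finrank_mono h2
  rw [LinearMap.finrank_range_of_inj hf, Submodule.finrank_map_subtype_eq,
    Module.finrank_pi_fintype] at h3
  have h4 : Fintype.card {e // e ∉ F} = Fintype.card E - F.card := by
    rw [Fintype.card_subtype_compl]; simp
  simp only [Finset.sum_const, Finset.card_univ, h4, smul_eq_mul] at h3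
  rw [mul_comm]
  omega

theorem KK_le (ω : V → X) (ends : E → V × V) (F : Finset E) :
    Module.finrank ℝ (KK ω ends F) ≤ Module.finrank ℝ (NN ω (inc ends F)) + (VF ends F).card +
      Module.finrank ℝ X * (Fintype.card V - (VF ends F).card) := by
  classical
  let g : KK ω ends F →ₗ[ℝ] (E → X) := (LinearMap.fst ℝ _ _).domRestrict _
  have h0 := LinearMap.finrank_range_add_finrank_ker g
  have hr : LinearMap.range g ≤ NN ω (inc ends F) := by
    rintro _ ⟨⟨⟨t, m⟩, hp⟩, rfl⟩ u
    have key : ∀ i ∈ inc ends F u, m u - t i ∈ Submodule.span ℝ {ω u} := by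
      intro i hi
      simp only [inc, Finset.mem_filter] at hi
      rcases hi with ⟨hi, h | h⟩
      · have := (hp i hi).1
        rw [← h] at this; exact this
      · have := (hp i hi).2
        rw [← h] at this; exact this
    intro i hi j hj
    have := Submodule.sub_mem _ (key j hj) (key i hi)
    simpa [g] using this
  have h1 := Submodule.finrank_mono hr
  let f : (({v // v ∈ VF ends F} → ℝ) × ({v // v ∉ VF ends F} → X)) →ₗ[ℝ]
      ((E → X) × (V → X)) :=
    { toFun := fun p => (0, fun e => if h : e ∈ VF ends F then p.1 ⟨e, h⟩ • ω e else p.2 ⟨e, h⟩)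
      map_add' := by
        intro p q; ext e
        · simp
        · by_cases h : e ∈ VF ends F <;> simp [h, add_smul]
      map_smul' := by
        intro c p; ext e
        · simp
        · by_cases h : e ∈ VF ends F <;> simp [h, mul_smul] }
  have h2 : (LinearMap.ker g).map (KK ω ends F).subtype ≤ LinearMap.range f := by
    rintro _ ⟨⟨⟨t, m⟩, hp⟩, hk, rfl⟩
    have ht : t = 0 := hk
    subst ht
    have : ∀ v : {v // v ∈ VF ends F}, ∃ c : ℝ, c • ω v = m v := by
      rintro ⟨v, hv⟩
      rw [mem_VF] at hv
      obtain ⟨e, he, h | h⟩ := hv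
      · have := (hp e he).1
        rw [← h, Submodule.mem_span_singleton] at this
        simpa using this
      · have := (hp e he).2
        rw [← h, Submodule.mem_span_singleton] at this
        simpa using this
    choose c hc using this
    refine ⟨(c, fun v => m v), ?_⟩
    refine Prod.ext rfl ?_
    ext v
    by_cases h : v ∈ VF ends F
    · simpa [f, h] using hc ⟨v, h⟩
    · simp [f, h]
  have h3 := (Submodule.finrank_mono h2).trans (LinearMap.finrank_range_le f)
  rw [Submodule.finrank_map_subtype_eq, Module.finrank_prod, Module.finrank_pi_fintype, Module.finrank_pi_fintype] at h3
  have h4 : Fintype.card {e // e ∉ VF ends F} = Fintype.card V - (VF ends F).card := by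
    rw [Fintype.card_subtype_compl]; simp
  simp only [Finset.sum_const, Finset.card_univ, h4, smul_eq_mul, Module.finrank_pi,
    Fintype.card_coe, Module.finrank_fintype_fun_eq_card] at h3
  rw [mul_comm (Module.finrank ℝ X)]
  simp at h3
  omega

theorem motion_bound (hD : 6 ≤ Module.finrank ℝ X) (S : Set X) (hS : Submodule.span ℝ S = ⊤)
    (ω : V → X) (hG : Gen E S ω) (ends : E → V × V) (F : Finset E)
    (hsp : ∀ F' : Finset E, F' ⊆ F → F'.Nonempty → (F'.card : ℤ) ≤
      ((Module.finrank ℝ X : ℤ) - 1) * (VF ends F').card - (Module.finrank ℝ X : ℤ)) :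
    Module.finrank ℝ (MM ω ends F) + F.card ≤ Module.finrank ℝ X * Fintype.card V := by
  obtain ⟨κ, hκ⟩ := claimA hD S hS ω hG (inc ends F)
  have h1 := KK_ge ω ends F
  have h2 := KK_le ω ends F
  have hF : F.card ≤ Fintype.card E := Finset.card_le_univ _
  have hV : (VF ends F).card ≤ Fintype.card V := Finset.card_le_univ _
  have h3 : (Finset.univ.image κ).card ≤ (F.image κ).card + (Fintype.card E - F.card) := by
    have : Finset.univ.image κ = F.image κ ∪ Fᶜ.image κ := by
      rw [← Finset.image_union]; simp
    rw [this]
    refine (Finset.card_union_le _ _).trans ?_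
    have := Finset.card_image_le (s := Fᶜ) (f := κ)
    rw [Finset.card_compl] at this
    omega
  have h4 : ∑ v, (((inc ends F v).image κ).card - 1) + (VF ends F).card =
      ∑ v, ((inc ends F v).image κ).card := by
    have : (VF ends F).card = ∑ v, if v ∈ VF ends F then 1 else 0 := by simp
    rw [this, ← Finset.sum_add_distrib]
    apply Finset.sum_congr rfl
    intro v _
    split_ifs with h
    · rw [mem_VF] at h
      obtain ⟨e, he, h⟩ := h
      have : 0 < ((inc ends F v).image κ).card :=
        Finset.card_pos.2 ⟨κ e, Finset.mem_image_of_mem _ (by simp [inc, he, h])⟩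
      omega
    · have : inc ends F v = ∅ := by
        rw [Finset.eq_empty_iff_forall_notMem]
        intro e he
        simp only [inc, Finset.mem_filter] at he
        exact h ((mem_VF _ _ _).2 ⟨e, he⟩)
      simp [this]
  have h5 : ∑ v, ((inc ends F v).image κ).card =
      ∑ g ∈ F.image κ, (VF ends (F.filter (fun e => κ e = g))).card := by
    have e1 : ∀ v, ((inc ends F v).image κ).card =
        ∑ g ∈ F.image κ, if v ∈ VF ends (F.filter (fun e => κ e = g)) then 1 else 0 := by
      intro v
      rw [← Finset.sum_filter, Finset.sum_const, smul_eq_mul, mul_one]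
      congr 1
      ext g
      simp only [Finset.mem_image, Finset.mem_filter, mem_VF, inc]
      constructor
      · rintro ⟨e, ⟨he, h⟩, rfl⟩
        exact ⟨⟨e, he, rfl⟩, e, ⟨he, rfl⟩, h⟩
      · rintro ⟨_, e, ⟨he, rfl⟩, h⟩
        exact ⟨e, ⟨he, h⟩, rfl⟩
    simp only [e1]
    rw [Finset.sum_comm]
    apply Finset.sum_congr rfl
    intro g _
    simp
  have h6 : (F.card : ℤ) ≤ ((Module.finrank ℝ X : ℤ) - 1) *
      (∑ g ∈ F.image κ, (VF ends (F.filter (fun e => κ e = g))).card : ℕ) -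
      (Module.finrank ℝ X : ℤ) * (F.image κ).card := by
    rw [Finset.card_eq_sum_card_image κ F]
    push_cast
    rw [Finset.mul_sum, mul_comm (Module.finrank ℝ X : ℤ), ← nsmul_eq_mul, ← Finset.sum_const,
      ← Finset.sum_sub_distrib]
    apply Finset.sum_le_sum
    intro g hg
    apply hsp _ (Finset.filter_subset _ _)
    obtain ⟨e, he, rfl⟩ := Finset.mem_image.1 hg
    exact ⟨e, by simp [he]⟩
  rw [← h5, ← h4] at h6
  generalize ∑ v, (((inc ends F v).image κ).card - 1) = s at *
  zify [hF, hV, (by omega : 1 ≤ Module.finrank ℝ X)] at *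
  nlinarith
end core2
end RB

set_option synthInstance.maxHeartbeats 1000000
set_option maxHeartbeats 1000000
set_option linter.unusedSectionVars false
set_option linter.unusedSimpArgs false
set_option linter.unusedVariables false
namespace RB
section rado
variable {E Z : Type} [Fintype E] [DecidableEq E]
  [AddCommGroup Z] [Module ℝ Z] [FiniteDimensional ℝ Z]

theorem avoid (A : Submodule ℝ Z) (T : Finset (Submodule ℝ Z)) (hT : ∀ B ∈ T, ¬ A ≤ B) :
    ∃ x ∈ A, ∀ B ∈ T, x ∉ B := by
  classical
  have h := Subspace.biUnion_ne_univ_of_top_notMem (k := ℝ) (E := A)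
    (s := T.image (fun B => B.comap A.subtype)) (by
      intro h
      obtain ⟨B, hB, h2⟩ := Finset.mem_image.1 h
      apply hT B hB
      intro x hx
      have : (⟨x, hx⟩ : A) ∈ Submodule.comap A.subtype B := by rw [h2]; trivial
      exact this)
  rw [Set.ne_univ_iff_exists_notMem] at h
  obtain ⟨⟨x, hx⟩, h⟩ := h
  refine ⟨x, hx, fun B hB hxB => h ?_⟩
  simp only [Set.mem_iUnion]
  exact ⟨_, Finset.mem_image_of_mem _ hB, hxB⟩

theorem finrank_lt_sup (B : Submodule ℝ Z) (x : Z) (hx : x ∉ B) :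
    Module.finrank ℝ B + 1 ≤ Module.finrank ℝ ↥(B ⊔ Submodule.span ℝ {x}) := by
  apply Submodule.finrank_lt_finrank_of_lt
  refine lt_of_le_of_ne le_sup_left ?_
  intro h
  apply hx
  rw [h]
  exact Submodule.mem_sup_right (Submodule.mem_span_singleton_self x)

theorem rado (A : E → Submodule ℝ Z) (s : Finset E) : ∀ (Q : Submodule ℝ Z),
    (∀ F ⊆ s, Module.finrank ℝ Q + F.card ≤ Module.finrank ℝ ↥(Q ⊔ ⨆ e ∈ F, A e)) →
    ∃ q : E → Z, (∀ e ∈ s, q e ∈ A e) ∧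
      Module.finrank ℝ Q + s.card ≤ Module.finrank ℝ ↥(Q ⊔ Submodule.span ℝ (q '' s)) := by
  induction s using Finset.induction_on with
  | empty => intro Q _; exact ⟨0, by simp, Submodule.finrank_mono le_sup_left⟩
  | insert e s he ih =>
    intro Q hQ
    set T : Finset (Submodule ℝ Z) := (s.powerset.filter (fun F =>
      Module.finrank ℝ ↥(Q ⊔ ⨆ e ∈ F, A e) ≤ Module.finrank ℝ Q + F.card)).image
        (fun F => Q ⊔ ⨆ e ∈ F, A e) with hT
    obtain ⟨x, hxA, hx⟩ := avoid (A e) T (by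
      intro B hB hle
      obtain ⟨F, hF, rfl⟩ := Finset.mem_image.1 hB
      rw [Finset.mem_filter, Finset.mem_powerset] at hF
      have h1 := hQ (insert e F) (Finset.insert_subset_insert _ hF.1)
      rw [Finset.card_insert_of_notMem (fun h => he (hF.1 h)), Finset.iSup_insert] at h1
      have : Q ⊔ (A e ⊔ ⨆ e ∈ F, A e) = Q ⊔ ⨆ e ∈ F, A e := by
        apply le_antisymm
        · exact sup_le le_sup_left (sup_le hle le_sup_right)
        · exact sup_le_sup_left le_sup_right _
      rw [this] at h1
      omega)
    have hxQ : x ∉ Q := by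
      have := hx (Q ⊔ ⨆ e ∈ (∅ : Finset E), A e) (by
        rw [hT]
        apply Finset.mem_image_of_mem (fun F : Finset E => Q ⊔ ⨆ e ∈ F, A e)
        have h0 : (Q ⊔ ⨆ e ∈ (∅ : Finset E), A e) = Q := by simp
        rw [Finset.mem_filter, h0]
        simp)
      simpa using this
    have hQ1 := finrank_lt_sup Q x hxQ
    have hQ2 : Module.finrank ℝ ↥(Q ⊔ Submodule.span ℝ {x}) ≤ Module.finrank ℝ Q + 1 := by
      refine (Submodule.finrank_add_le_finrank_add_finrank _ _).trans ?_
      have := finrank_span_le_card (R := ℝ) ({x} : Set Z)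
      simp at this
      omega
    obtain ⟨q, hq1, hq2⟩ := ih (Q ⊔ Submodule.span ℝ {x}) (by
      intro F hF
      have hcomm : Q ⊔ Submodule.span ℝ {x} ⊔ ⨆ e ∈ F, A e =
        (Q ⊔ ⨆ e ∈ F, A e) ⊔ Submodule.span ℝ {x} := by
        rw [sup_assoc, sup_comm (Submodule.span ℝ {x}), sup_assoc]
      rw [hcomm]
      by_cases ht : Module.finrank ℝ ↥(Q ⊔ ⨆ e ∈ F, A e) ≤ Module.finrank ℝ Q + F.card
      · have h1 := finrank_lt_sup (Q ⊔ ⨆ e ∈ F, A e) x (hx _ (by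
          rw [hT]
          apply Finset.mem_image_of_mem (fun F : Finset E => Q ⊔ ⨆ e ∈ F, A e)
          simp [hF, ht]))
        have h2 := hQ F (hF.trans (Finset.subset_insert _ _))
        omega
      · have := Submodule.finrank_mono
          (le_sup_left : (Q ⊔ ⨆ e ∈ F, A e) ≤ (Q ⊔ ⨆ e ∈ F, A e) ⊔ Submodule.span ℝ {x})
        omega)
    refine ⟨Function.update q e x, ?_, ?_⟩
    · intro f hf
      by_cases hfe : f = e
      · subst hfe; simpa using hxA
      · rw [Function.update_of_ne hfe]
        exact hq1 f (Finset.mem_of_mem_insert_of_ne hf hfe)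
    · have himg : Function.update q e x '' (s : Set E) = q '' s := by
        apply Set.image_congr
        intro f hf
        rw [Function.update_of_ne]
        rintro rfl; exact he hf
      rw [Finset.coe_insert, Set.image_insert_eq, himg, Function.update_self,
        Submodule.span_insert, ← sup_assoc, Finset.card_insert_of_notMem he]
      omega

theorem exch (S : E → Set Z) (x : E → Z) (hx : LinearIndependent ℝ x)
    (hS : ∀ e, x e ∈ Submodule.span ℝ (S e)) (s : Finset E) :
    ∃ y : E → Z, LinearIndependent ℝ y ∧ (∀ e ∈ s, y e ∈ S e) ∧ ∀ e ∉ s, y e = x e := by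
  induction s using Finset.induction_on with
  | empty => exact ⟨x, hx, by simp, by simp⟩
  | insert e s he ih =>
    obtain ⟨y, hy, h1, h2⟩ := ih
    rw [← linearIndepOn_univ_iff, show (Set.univ : Set E) = insert e {e}ᶜ by
      ext a; simp [em], linearIndepOn_insert (by simp)] at hy
    obtain ⟨z, hzS, hz⟩ : ∃ z ∈ S e, z ∉ Submodule.span ℝ (y '' {e}ᶜ) := by
      by_contra hcon
      push Not at hcon
      apply hy.2
      rw [h2 e he]
      exact (Submodule.span_le.2 hcon) (hS e)
    have himg : ∀ f ∈ ({e}ᶜ : Set E), Function.update y e z f = y f := by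
      intro f hf
      rw [Function.update_of_ne hf]
    refine ⟨Function.update y e z, ?_, ?_, ?_⟩
    · rw [← linearIndepOn_univ_iff, show (Set.univ : Set E) = insert e {e}ᶜ by
        ext a; simp [em], linearIndepOn_insert (by simp), Set.image_congr himg,
        Function.update_self]
      exact ⟨(linearIndepOn_congr himg).2 hy.1, hz⟩
    · intro f hf
      by_cases hfe : f = e
      · subst hfe; simpa using hzS
      · rw [Function.update_of_ne hfe]
        exact h1 f (Finset.mem_of_mem_insert_of_ne hf hfe)
    · intro f hf
      rw [Finset.mem_insert, not_or] at hf
      rw [Function.update_of_ne hf.1]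
      exact h2 f hf.2

theorem select (S : E → Set Z)
    (h : ∀ F : Finset E, F.card ≤ Module.finrank ℝ ↥(⨆ e ∈ F, Submodule.span ℝ (S e))) :
    ∃ y : E → Z, (∀ e, y e ∈ S e) ∧ LinearIndependent ℝ y := by
  obtain ⟨q, hq1, hq2⟩ := rado (fun e => Submodule.span ℝ (S e)) Finset.univ ⊥ (by
    intro F _
    have := h F
    rw [bot_sup_eq]
    simpa using this)
  have hq : LinearIndependent ℝ q := by
    rw [linearIndependent_iff_card_le_finrank_span, Set.finrank]
    rw [bot_sup_eq, Finset.coe_univ, Set.image_univ] at hq2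
    simpa using hq2
  obtain ⟨y, h1, h2, _⟩ := exch S q hq (fun e => hq1 e (Finset.mem_univ e)) Finset.univ
  exact ⟨y, fun e => h2 e (Finset.mem_univ e), h1⟩

/-- kernel of the rows in `F` -/
def kers (x : E → Module.Dual ℝ Z) (F : Set E) : Submodule ℝ Z :=
  (Submodule.span ℝ (x '' F)).dualCoannihilator

theorem mem_kers (x : E → Module.Dual ℝ Z) (F : Set E) (z : Z) :
    z ∈ kers x F ↔ ∀ e ∈ F, x e z = 0 := by
  rw [kers, Submodule.mem_dualCoannihilator]
  constructor
  · intro h e he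
    exact h _ (Submodule.subset_span ⟨e, he, rfl⟩)
  · intro h φ hφ
    induction hφ using Submodule.span_induction with
    | mem a ha => obtain ⟨e, he, rfl⟩ := ha; exact h e he
    | zero => rfl
    | add a b _ _ ha hb => simp [ha, hb]
    | smul c a _ ha => simp [ha]

theorem finrank_kers_add (x : E → Module.Dual ℝ Z) (F : Set E) :
    Module.finrank ℝ ↥(Submodule.span ℝ (x '' F)) + Module.finrank ℝ (kers x F) =
      Module.finrank ℝ Z :=
  Subspace.finrank_add_finrank_dualCoannihilator_eq _

theorem finrank_kers_indep (x : E → Module.Dual ℝ Z) (hx : LinearIndependent ℝ x) (F : Finset E) :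
    F.card + Module.finrank ℝ (kers x F) = Module.finrank ℝ Z := by
  classical
  rw [← finrank_kers_add x F]
  congr 1
  have := finrank_span_set_eq_card (R := ℝ) (s := x '' (F : Set E)) ((hx.linearIndepOn (s := (F : Set E))).id_image)
  rw [this, ← Set.ncard_eq_toFinset_card', Set.ncard_image_of_injective _ hx.injective,
    Set.ncard_coe_finset]

theorem indep_of_kers (x : E → Module.Dual ℝ Z)
    (h : ∀ e, Module.finrank ℝ (kers x Set.univ) + 1 ≤ Module.finrank ℝ (kers x {f | f ≠ e})) :
    LinearIndependent ℝ x := by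
  rw [linearIndependent_iff_notMem_span]
  intro e he
  have h1 := h e
  have : kers x Set.univ = kers x {f | f ≠ e} := by
    unfold kers
    congr 1
    apply le_antisymm
    · rw [Submodule.span_le]
      rintro _ ⟨f, _, rfl⟩
      by_cases hf : f = e
      · rw [hf]
        have : (Set.univ \ {e} : Set E) = {f | f ≠ e} := by ext; simp
        rw [this] at he; exact he
      · exact Submodule.subset_span ⟨f, hf, rfl⟩
    · exact Submodule.span_mono (Set.image_mono (Set.subset_univ _))
  rw [this] at h1
  omega
end rado
end RB

set_option synthInstance.maxHeartbeats 1000000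
set_option maxHeartbeats 1000000
set_option linter.unusedSectionVars false
set_option linter.unusedSimpArgs false
set_option linter.unusedVariables false
open ExteriorAlgebra
namespace RB
section ext
variable {d : ℕ}

theorem extGrade_eq (d k : ℕ) : extGrade d k = ⋀[ℝ]^k (Wd d) := rfl

instance (d k : ℕ) : FiniteDimensional ℝ (extGrade d k) :=
  inferInstanceAs (Module.Finite ℝ (⋀[ℝ]^k (Wd d)))

theorem finrank_extGrade (d k : ℕ) : Module.finrank ℝ (extGrade d k) = (d + 1).choose k := by
  have := exteriorPower.finrank_eq (R := ℝ) (M := Wd d) (n := k)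
  rw [extGrade_eq, this]; simp

theorem ι_mem (a : Wd d) : ι ℝ a ∈ extGrade d 1 := by
  rw [extGrade, pow_one]; exact ⟨a, rfl⟩

theorem ι_mul_mem {k : ℕ} (a : Wd d) {x : ExtAlg d} (hx : x ∈ extGrade d k) :
    ι ℝ a * x ∈ extGrade d (k + 1) := by
  rw [extGrade, pow_succ']
  exact Submodule.mul_mem_mul ⟨a, rfl⟩ hx

theorem ι_swap (a b : Wd d) : ι ℝ a * ι ℝ b = - (ι ℝ b * ι ℝ a) := by
  have := ι_add_mul_swap (R := ℝ) a b
  exact eq_neg_of_add_eq_zero_left this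

theorem exists_vol (d : ℕ) : ∃ vol : ExtAlg d →ₗ[ℝ] ℝ, ∀ x ∈ extGrade d (d + 1), vol x = 0 → x = 0 := by
  have h1 : Module.finrank ℝ (extGrade d (d + 1)) = Module.finrank ℝ ℝ := by
    rw [finrank_extGrade]; simp
  let e := LinearEquiv.ofFinrankEq _ _ h1
  obtain ⟨vol, hvol⟩ := LinearMap.exists_extend e.toLinearMap
  refine ⟨vol, fun x hx h => ?_⟩
  have h2 := LinearMap.congr_fun hvol ⟨x, hx⟩
  simp only [LinearMap.comp_apply, Submodule.subtype_apply, h] at h2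
  have h3 := e.map_eq_zero_iff.1 h2.symm
  simpa using congrArg Subtype.val h3

noncomputable def con (i : Fin (d + 1)) : ExtAlg d →ₗ[ℝ] ExtAlg d :=
  CliffordAlgebra.contractLeft (Q := (0 : QuadraticForm ℝ (Wd d))) (LinearMap.proj i)

theorem con_ι_mul (i : Fin (d + 1)) (a : Wd d) (x : ExtAlg d) :
    con i (ι ℝ a * x) = a i • x - ι ℝ a * con i x :=
  CliffordAlgebra.contractLeft_ι_mul _ _ _

theorem con_one (i : Fin (d + 1)) : con i (1 : ExtAlg d) = 0 :=
  CliffordAlgebra.contractLeft_one _ _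

noncomputable def bas (i : Fin (d + 1)) : Wd d := Pi.single i 1

theorem sum_bas (a : Wd d) : ∑ i, a i • (bas i : Wd d) = a := by
  ext j; simp [bas, Finset.sum_apply, Pi.single_apply]

theorem euler (k : ℕ) : ∀ x ∈ extGrade d k,
    ∑ i, ι ℝ (bas i) * con i x = (k : ℝ) • x := by
  induction k with
  | zero =>
    intro x hx
    rw [extGrade, pow_zero, Submodule.mem_one] at hx
    obtain ⟨c, rfl⟩ := hx
    simp [Algebra.algebraMap_eq_smul_one, con_one]
  | succ k ih =>
    intro x hx
    rw [extGrade, pow_succ'] at hx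
    refine Submodule.mul_induction_on hx ?_ ?_
    · intro y hy x hx
      obtain ⟨a, rfl⟩ := hy
      have h1 : ∀ i, ι ℝ (bas i) * con i (ι ℝ a * x) =
          ι ℝ (a i • bas i) * x + ι ℝ a * (ι ℝ (bas i) * con i x) := by
        intro i
        rw [con_ι_mul, mul_sub, ← mul_assoc, ι_swap (bas i) a, map_smul]
        simp [mul_assoc]
      simp only [h1]
      rw [Finset.sum_add_distrib, ← Finset.sum_mul, ← Finset.mul_sum, ← map_sum, sum_bas, ih x hx]
      push_cast
      rw [add_smul, one_smul, mul_smul_comm]; abel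
    · intro x y hx hy
      simp only [map_add, mul_add, Finset.sum_add_distrib, hx, hy, smul_add]

theorem nondeg {k : ℕ} (hk : k < d + 1) (x : ExtAlg d) (hx : x ∈ extGrade d k)
    (h : ∀ a : Wd d, ι ℝ a * x = 0) : x = 0 := by
  have h1 := euler k x hx
  have h2 : ∀ i : Fin (d + 1), ι ℝ (bas i) * con i x = x := by
    intro i
    have := con_ι_mul i (bas i) x
    rw [h, map_zero] at this
    simp [bas] at this
    simpa [bas] using (sub_eq_zero.1 this.symm).symm
  simp only [h2] at h1
  simp only [Finset.sum_const, Finset.card_univ, Fintype.card_fin, ← Nat.cast_smul_eq_nsmul ℝ] at h1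
  rw [← sub_eq_zero, ← sub_smul, smul_eq_zero] at h1
  rcases h1 with h1 | h1
  · exfalso
    have : ((d + 1 : ℕ) : ℝ) = k := by linarith
    have := Nat.cast_injective this
    omega
  · exact h1

/-- bracket -/
noncomputable def br (vol : ExtAlg d →ₗ[ℝ] ℝ) (x : ExtAlg d) : Wd d →ₗ[ℝ] Wd d →ₗ[ℝ] ℝ :=
  LinearMap.mk₂ ℝ (fun a b => vol (ι ℝ a * ι ℝ b * x))
    (by intros; simp [add_mul]) (by intros; simp)
    (by intros; simp [mul_add, add_mul]) (by intros; simp)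

theorem br_apply (vol : ExtAlg d →ₗ[ℝ] ℝ) (x : ExtAlg d) (a b : Wd d) :
    br vol x a b = vol (ι ℝ a * ι ℝ b * x) := rfl

theorem br_swap (vol : ExtAlg d →ₗ[ℝ] ℝ) (x : ExtAlg d) (a b : Wd d) :
    br vol x a b = - br vol x b a := by
  rw [br_apply, br_apply, ι_swap]; simp

theorem br_self (vol : ExtAlg d →ₗ[ℝ] ℝ) (x : ExtAlg d) (a : Wd d) : br vol x a a = 0 := by
  rw [br_apply]; simp

theorem br_add (vol : ExtAlg d →ₗ[ℝ] ℝ) (x y : ExtAlg d) (a b : Wd d) :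
    br vol (x + y) a b = br vol x a b + br vol y a b := by simp [br_apply, mul_add]

theorem br_sub (vol : ExtAlg d →ₗ[ℝ] ℝ) (x y : ExtAlg d) (a b : Wd d) :
    br vol (x - y) a b = br vol x a b - br vol y a b := by simp [br_apply, mul_sub]

theorem br_smul (vol : ExtAlg d →ₗ[ℝ] ℝ) (c : ℝ) (x : ExtAlg d) (a b : Wd d) :
    br vol (c • x) a b = c * br vol x a b := by simp [br_apply]

theorem br_nondeg {k : ℕ} (hk : k + 2 = d + 1) (vol : ExtAlg d →ₗ[ℝ] ℝ)
    (hvol : ∀ x ∈ extGrade d (d + 1), vol x = 0 → x = 0) (x : ExtAlg d) (hx : x ∈ extGrade d k)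
    (h : ∀ a b, br vol x a b = 0) : x = 0 := by
  apply nondeg (by omega) x hx
  intro b
  apply nondeg (k := k + 1) (by omega) _ (ι_mul_mem b hx)
  intro a
  apply hvol
  · have := ι_mul_mem a (ι_mul_mem b hx)
    rw [show k + 1 + 1 = d + 1 from hk] at this
    exact this
  · rw [← mul_assoc]; exact h a b

/-- decomposable from vectors -/
noncomputable def dec {k : ℕ} (w : Fin k → Wd d) : ExtAlg d := (List.ofFn fun i => ι ℝ (w i)).prod

theorem dec_eq {k : ℕ} (w : Fin k → Wd d) : dec w = ιMulti ℝ k w := (ιMulti_apply w).symm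

theorem dec_mem {k : ℕ} (w : Fin k → Wd d) : dec w ∈ extGrade d k := by
  rw [dec_eq, extGrade_eq]; exact ιMulti_range ℝ k ⟨w, rfl⟩

theorem ι_mul_dec {k : ℕ} (a : Wd d) (w : Fin k → Wd d) :
    ι ℝ a * dec w = dec (Fin.cons a w : Fin (k + 1) → Wd d) := by
  simp [dec, List.ofFn_succ]

theorem ι_mul_dec_zero {k : ℕ} (w : Fin k → Wd d) (a : Wd d)
    (ha : a ∈ Submodule.span ℝ (Set.range w)) : ι ℝ a * dec w = 0 := by
  induction ha using Submodule.span_induction with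
  | mem a ha =>
    obtain ⟨i, rfl⟩ := ha
    rw [ι_mul_dec, dec_eq]
    exact AlternatingMap.map_eq_zero_of_eq _ _ (i := 0) (j := i.succ) (by simp)
      (Fin.succ_ne_zero i).symm
  | zero => simp
  | add a b _ _ ha hb => simp [add_mul, ha, hb]
  | smul c a _ ha => simp [ha]

theorem br_dec_right {k : ℕ} (vol : ExtAlg d →ₗ[ℝ] ℝ) (w : Fin k → Wd d) (a b : Wd d)
    (hb : b ∈ Submodule.span ℝ (Set.range w)) : br vol (dec w) a b = 0 := by
  rw [br_apply, mul_assoc, ι_mul_dec_zero w b hb]; simp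

theorem br_dec_left {k : ℕ} (vol : ExtAlg d →ₗ[ℝ] ℝ) (w : Fin k → Wd d) (a b : Wd d)
    (ha : a ∈ Submodule.span ℝ (Set.range w)) : br vol (dec w) a b = 0 := by
  rw [br_swap, br_dec_right vol w b a ha, neg_zero]

theorem span_of_br {k : ℕ} (hk : k + 2 = d + 1) (vol : ExtAlg d →ₗ[ℝ] ℝ) (w : Fin k → Wd d)
    (a b : Wd d) (h : br vol (dec w) a b ≠ 0) (x : Wd d) :
    ∃ α β : ℝ, ∃ z ∈ Submodule.span ℝ (Set.range w), x = α • a + β • b + z := by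
  have h1 : dec (Fin.cons a (Fin.cons b w : Fin (k + 1) → Wd d) : Fin (k + 2) → Wd d) ≠ 0 := by
    rw [← ι_mul_dec, ← ι_mul_dec, ← mul_assoc]
    intro h2
    rw [br_apply, h2, map_zero] at h
    exact h rfl
  have h2 : LinearIndependent ℝ
      (Fin.cons a (Fin.cons b w : Fin (k + 1) → Wd d) : Fin (k + 2) → Wd d) := by
    by_contra hcon
    apply h1
    rw [dec_eq]
    exact AlternatingMap.map_linearDependent _ _ hcon
  have h3 := h2.span_eq_top_of_card_eq_finrank' (by simp [hk])
  rw [Fin.range_cons, Fin.range_cons] at h3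
  have hx : x ∈ Submodule.span ℝ (insert a (insert b (Set.range w))) := by rw [h3]; trivial
  rw [Submodule.mem_span_insert] at hx
  obtain ⟨α, y, hy, rfl⟩ := hx
  rw [Submodule.mem_span_insert] at hy
  obtain ⟨β, z, hz, rfl⟩ := hy
  exact ⟨α, β, z, hz, by rw [add_assoc]⟩

theorem star {k : ℕ} (hk : k + 2 = d + 1) (vol : ExtAlg d →ₗ[ℝ] ℝ)
    (hvol : ∀ x ∈ extGrade d (d + 1), vol x = 0 → x = 0) (w w' : Fin k → Wd d) (i j : Fin k)
    (h1 : br vol (dec w) (w' i) (w' j) ≠ 0) (h2 : br vol (dec w') (w i) (w j) ≠ 0)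
    (m : ExtAlg d) (hm : m ∈ extGrade d k)
    (h : ∀ a b, br vol (dec w) a b = 0 → br vol (dec w') a b = 0 → br vol m a b = 0) :
    m ∈ Submodule.span ℝ {dec w, dec w'} := by
  set b0 := w' i with hb0
  set b1 := w' j with hb1
  set b2 := w i with hb2
  set b3 := w j with hb3
  have m0 : b0 ∈ Submodule.span ℝ (Set.range w') := Submodule.subset_span ⟨i, rfl⟩
  have m1 : b1 ∈ Submodule.span ℝ (Set.range w') := Submodule.subset_span ⟨j, rfl⟩
  have m2 : b2 ∈ Submodule.span ℝ (Set.range w) := Submodule.subset_span ⟨i, rfl⟩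
  have m3 : b3 ∈ Submodule.span ℝ (Set.range w) := Submodule.subset_span ⟨j, rfl⟩
  set c := br vol m b0 b1 / br vol (dec w) b0 b1 with hc
  set c' := br vol m b2 b3 / br vol (dec w') b2 b3 with hc'
  set m' := m - c • dec w - c' • dec w' with hm'
  have hB : ∀ a b, br vol m' a b = br vol m a b - c * br vol (dec w) a b
      - c' * br vol (dec w') a b := by
    intro a b; rw [hm', br_sub, br_sub, br_smul, br_smul]
  have h' : ∀ a b, br vol (dec w) a b = 0 → br vol (dec w') a b = 0 → br vol m' a b = 0 := by
    intro a b e1 e2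
    rw [hB, h a b e1 e2, e1, e2]; simp
  have z01 : br vol m' b0 b1 = 0 := by
    rw [hB, br_dec_right vol w' b0 b1 m1, hc]; field_simp; ring
  have z23 : br vol m' b2 b3 = 0 := by
    rw [hB, br_dec_right vol w b2 b3 m3, hc']; field_simp; ring
  have mix : ∀ x ∈ Submodule.span ℝ (Set.range w'), ∀ y ∈ Submodule.span ℝ (Set.range w),
      br vol m' x y = 0 := fun x hx y hy =>
    h' x y (br_dec_right vol w x y hy) (br_dec_left vol w' x y hx)
  have rad : ∀ x y, y ∈ Submodule.span ℝ (Set.range w) → y ∈ Submodule.span ℝ (Set.range w') →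
      br vol m' x y = 0 := fun x y hy hy' =>
    h' x y (br_dec_right vol w x y hy) (br_dec_right vol w' x y hy')
  have exp : ∀ a : Wd d, ∃ (x y z t : ℝ) (k : Wd d), k ∈ Submodule.span ℝ (Set.range w) ∧
      k ∈ Submodule.span ℝ (Set.range w') ∧ a = x • b0 + y • b1 + (z • b2 + t • b3 + k) := by
    intro a
    obtain ⟨x, y, k, hk1, rfl⟩ := span_of_br hk vol w b0 b1 h1 a
    obtain ⟨z, t, k', hk2, rfl⟩ := span_of_br hk vol w' b2 b3 h2 k
    refine ⟨x, y, z, t, k', ?_, hk2, rfl⟩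
    have := Submodule.sub_mem _ hk1 (Submodule.add_mem _ (Submodule.smul_mem _ z m2)
      (Submodule.smul_mem _ t m3))
    simpa using this
  have hzero : m' = 0 := by
    apply br_nondeg hk vol hvol m'
    · exact Submodule.sub_mem _ (Submodule.sub_mem _ hm (Submodule.smul_mem _ _ (dec_mem w)))
        (Submodule.smul_mem _ _ (dec_mem w'))
    · intro a b
      obtain ⟨x, y, z, t, k, hk1, hk2, rfl⟩ := exp a
      obtain ⟨x', y', z', t', k', hk1', hk2', rfl⟩ := exp b
      have r1 : ∀ x, br vol m' x k' = 0 := fun x => rad x k' hk1' hk2'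
      have r2 : ∀ x, br vol m' k x = 0 := fun x => by rw [br_swap, rad x k hk1 hk2, neg_zero]
      have s10 : br vol m' b1 b0 = 0 := by rw [br_swap, z01, neg_zero]
      have s32 : br vol m' b3 b2 = 0 := by rw [br_swap, z23, neg_zero]
      have n02 := mix b0 m0 b2 m2
      have n03 := mix b0 m0 b3 m3
      have n12 := mix b1 m1 b2 m2
      have n13 := mix b1 m1 b3 m3
      have n20 : br vol m' b2 b0 = 0 := by rw [br_swap, n02, neg_zero]
      have n30 : br vol m' b3 b0 = 0 := by rw [br_swap, n03, neg_zero]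
      have n21 : br vol m' b2 b1 = 0 := by rw [br_swap, n12, neg_zero]
      have n31 : br vol m' b3 b1 = 0 := by rw [br_swap, n13, neg_zero]
      simp only [map_add, map_smul, LinearMap.add_apply, LinearMap.smul_apply, r1, r2, s10, s32,
        n02, n03, n12, n13, n20, n30, n21, n31, z01, z23, br_self, smul_zero, add_zero]
  rw [Submodule.mem_span_pair]
  refine ⟨c, c', ?_⟩
  rw [hm', sub_sub, sub_eq_zero] at hzero
  exact hzero.symm
end ext
end RB

set_option synthInstance.maxHeartbeats 1000000
set_option maxHeartbeats 1000000
set_option linter.unusedSectionVars false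
set_option linter.unusedSimpArgs false
set_option linter.unusedVariables false
open ExteriorAlgebra
namespace RB
section poly
variable {P : Type}

def IsPoly (f : (P → ℝ) → ℝ) : Prop := ∃ q : MvPolynomial P ℝ, ∀ p, f p = MvPolynomial.eval p q

theorem IsPoly.const (c : ℝ) : IsPoly (fun _ : P → ℝ => c) := ⟨MvPolynomial.C c, by simp⟩
theorem IsPoly.coord (i : P) : IsPoly (fun p : P → ℝ => p i) := ⟨MvPolynomial.X i, by simp⟩
theorem IsPoly.add {f g : (P → ℝ) → ℝ} (hf : IsPoly f) (hg : IsPoly g) :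
    IsPoly (fun p => f p + g p) := by
  obtain ⟨a, ha⟩ := hf; obtain ⟨b, hb⟩ := hg
  exact ⟨a + b, by simp [ha, hb]⟩
theorem IsPoly.sub {f g : (P → ℝ) → ℝ} (hf : IsPoly f) (hg : IsPoly g) :
    IsPoly (fun p => f p - g p) := by
  obtain ⟨a, ha⟩ := hf; obtain ⟨b, hb⟩ := hg
  exact ⟨a - b, by simp [ha, hb]⟩
theorem IsPoly.mul {f g : (P → ℝ) → ℝ} (hf : IsPoly f) (hg : IsPoly g) :
    IsPoly (fun p => f p * g p) := by
  obtain ⟨a, ha⟩ := hf; obtain ⟨b, hb⟩ := hg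
  exact ⟨a * b, by simp [ha, hb]⟩
theorem IsPoly.sum {J : Type} (s : Finset J) {f : J → (P → ℝ) → ℝ} (hf : ∀ j, IsPoly (f j)) :
    IsPoly (fun p => ∑ j ∈ s, f j p) := by
  choose q hq using hf
  exact ⟨∑ j ∈ s, q j, by simp [hq]⟩
theorem IsPoly.det {r : ℕ} {f : Fin r → Fin r → (P → ℝ) → ℝ} (hf : ∀ i j, IsPoly (f i j)) :
    IsPoly (fun p => Matrix.det (Matrix.of fun i j => f i j p)) := by
  choose q hq using hf
  refine ⟨Matrix.det (Matrix.of fun i j => q i j), fun p => ?_⟩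
  rw [RingHom.map_det]
  refine congrArg Matrix.det ?_
  ext i j
  simp [hq]

theorem IsPoly.simul {J : Type} [Fintype J] {f : J → (P → ℝ) → ℝ} (hf : ∀ j, IsPoly (f j))
    (h : ∀ j, ∃ p, f j p ≠ 0) : ∃ p, ∀ j, f j p ≠ 0 := by
  choose q hq using hf
  have h1 : ∀ j, q j ≠ 0 := by
    intro j hj
    obtain ⟨p, hp⟩ := h j
    rw [hq, hj, map_zero] at hp
    exact hp rfl
  have h2 : ∏ j, q j ≠ 0 := Finset.prod_ne_zero_iff.2 (fun j _ => h1 j)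
  have h3 : ∃ p, MvPolynomial.eval p (∏ j, q j) ≠ 0 := by
    by_contra hcon
    push Not at hcon
    exact h2 (MvPolynomial.funext (by simpa using hcon))
  obtain ⟨p, hp⟩ := h3
  rw [map_prod, Finset.prod_ne_zero_iff] at hp
  exact ⟨p, fun j => by rw [hq]; exact hp j (Finset.mem_univ j)⟩

theorem IsPoly.dec {d : ℕ} : ∀ (k : ℕ) (w : Fin k → (P → ℝ) → Wd d),
    (∀ i j, IsPoly (fun p => w i p j)) → ∀ l : ExtAlg d →ₗ[ℝ] ℝ,
      IsPoly (fun p => l (RB.dec (fun i => w i p))) := by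
  intro k
  induction k with
  | zero =>
    intro w hw l
    simpa [RB.dec] using IsPoly.const (P := P) (l 1)
  | succ k ih =>
    intro w hw l
    have h1 : ∀ p, l (RB.dec (fun i => w i p)) = ∑ j, w 0 p j *
        (l.comp (LinearMap.mulLeft ℝ (ι ℝ (bas j)))) (RB.dec (fun i => w i.succ p)) := by
      intro p
      have : RB.dec (fun i => w i p) = ι ℝ (w 0 p) * RB.dec (fun i => w i.succ p) := by
        simp [RB.dec, List.ofFn_succ]
      rw [this]
      conv_lhs => rw [← sum_bas (w 0 p)]
      simp [Finset.sum_mul]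
    simp only [h1]
    exact IsPoly.sum _ (fun j => (hw 0 j).mul (ih (fun i => w i.succ) (fun i j => hw i.succ j) _))

theorem rank_semi {Y J : Type} [AddCommGroup Y] [Module ℝ Y] [FiniteDimensional ℝ Y] [Fintype J]
    [DecidableEq J]
    (A : (P → ℝ) → (Y →ₗ[ℝ] (J → ℝ))) (hA : ∀ y i, IsPoly (fun p => A p y i)) (p0 : P → ℝ) :
    ∃ f : (P → ℝ) → ℝ, IsPoly f ∧ f p0 ≠ 0 ∧ ∀ p, f p ≠ 0 →
      Module.finrank ℝ (LinearMap.ker (A p)) ≤ Module.finrank ℝ (LinearMap.ker (A p0)) := by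
  classical
  set r := Module.finrank ℝ (LinearMap.range (A p0)) with hr
  let b := Module.finBasis ℝ (LinearMap.range (A p0))
  have hy : ∀ i, ∃ y, A p0 y = b i := fun i => (b i).2
  choose y hy using hy
  have hz : ∀ j, ∃ z : (J → ℝ) →ₗ[ℝ] ℝ, z.comp (LinearMap.range (A p0)).subtype = b.coord j :=
    fun j => LinearMap.exists_extend _
  choose z hz using hz
  refine ⟨fun p => Matrix.det (Matrix.of fun i j => z j (A p (y i))), ?_, ?_, ?_⟩
  · refine IsPoly.det (f := fun i j p => z j (A p (y i))) ?_
    intro i j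
    have : ∀ p, z j (A p (y i)) = ∑ k, A p (y i) k * z j (Pi.single k 1) := by
      intro p
      conv_lhs => rw [pi_eq_sum_univ' (A p (y i))]
      rw [map_sum]
      apply Finset.sum_congr rfl
      intro k _
      rw [map_smul, smul_eq_mul]
    simp only [this]
    exact IsPoly.sum _ (fun k => (hA _ _).mul (IsPoly.const _))
  · have : (Matrix.of fun i j => z j (A p0 (y i))) = 1 := by
      ext i j
      have h1 := LinearMap.congr_fun (hz j) (b i)
      simp only [LinearMap.comp_apply, Submodule.subtype_apply, Module.Basis.coord_apply,
        Module.Basis.repr_self] at h1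
      rw [Matrix.of_apply, hy, h1, Matrix.one_apply, Finsupp.single_apply]
    simp only [this]; simp
  · intro p hp
    have hli : LinearIndependent ℝ (fun i => A p (y i)) := by
      have h1 := Matrix.linearIndependent_rows_of_det_ne_zero hp
      let L : (J → ℝ) →ₗ[ℝ] (Fin r → ℝ) := LinearMap.pi z
      exact LinearIndependent.of_comp L h1
    have h2 : r ≤ Module.finrank ℝ (LinearMap.range (A p)) := by
      have h3 := finrank_span_eq_card hli
      rw [Fintype.card_fin] at h3
      rw [hr, ← h3]
      apply Submodule.finrank_mono
      rw [Submodule.span_le]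
      rintro _ ⟨i, rfl⟩
      exact ⟨y i, rfl⟩
    have h3 := LinearMap.finrank_range_add_finrank_ker (A p)
    have h4 := LinearMap.finrank_range_add_finrank_ker (A p0)
    omega
end poly

section gen
variable {V E X P : Type} [Fintype V] [Fintype E] [DecidableEq V] [DecidableEq E]
  [AddCommGroup X] [Module ℝ X] [FiniteDimensional ℝ X]

/-- the matrix whose kernel is `NN` -/
noncomputable def AA (ω : V → X) (I : V → Finset E) : (E → X) →ₗ[ℝ]
    (V × E × E × Fin (Module.finrank ℝ X) × Fin (Module.finrank ℝ X) → ℝ) :=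
  LinearMap.pi fun q => if q.2.1 ∈ I q.1 ∧ q.2.2.1 ∈ I q.1 then
    ((Module.finBasis ℝ X).coord q.2.2.2.2 (ω q.1)) •
      ((Module.finBasis ℝ X).coord q.2.2.2.1).comp (dif q.2.1 q.2.2.1) -
    ((Module.finBasis ℝ X).coord q.2.2.2.1 (ω q.1)) •
      ((Module.finBasis ℝ X).coord q.2.2.2.2).comp (dif q.2.1 q.2.2.1) else 0

theorem ker_AA (ω : V → X) (hω : ∀ v, ω v ≠ 0) (I : V → Finset E) :
    LinearMap.ker (AA ω I) = NN ω I := by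
  set b := Module.finBasis ℝ X with hb
  ext t
  rw [LinearMap.mem_ker, mem_NN]
  constructor
  · intro h u i hi j hj
    have hl : ∃ l, b.coord l (ω u) ≠ 0 := by
      by_contra hcon
      push Not at hcon
      apply hω u
      rw [← b.forall_coord_eq_zero_iff]
      exact hcon
    obtain ⟨l, hl⟩ := hl
    rw [Submodule.mem_span_singleton]
    refine ⟨b.coord l (t i - t j) / b.coord l (ω u), ?_⟩
    apply b.ext_elem
    intro k
    have := congrFun h (u, i, j, k, l)
    simp [AA, hi, hj, ← hb] at this
    simp at hl
    simp
    field_simp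
    linarith
  · intro h
    ext ⟨u, i, j, k, l⟩
    by_cases hij : i ∈ I u ∧ j ∈ I u
    · have := h u i hij.1 j hij.2
      rw [Submodule.mem_span_singleton] at this
      obtain ⟨c, hc⟩ := this
      simp only [AA, LinearMap.pi_apply, hij, and_self, if_true, LinearMap.sub_apply,
        LinearMap.smul_apply, LinearMap.comp_apply, dif_apply, ← hc, map_smul, smul_eq_mul,
        Pi.zero_apply]
      ring
    · simp [AA, hij]

theorem exists_gen {J : Type} [Fintype J] (S : Set X) (ω : (P → ℝ) → V → X)
    (hpoly : ∀ (v : V) (φ : X →ₗ[ℝ] ℝ), IsPoly (fun p => φ (ω p v)))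
    (hS : ∀ p v, ω p v ∈ S)
    (hsurj : ∀ ω' : V → X, (∀ v, ω' v ∈ S ∧ ω' v ≠ 0) → ∃ p, ω p = ω')
    (g : J → (P → ℝ) → ℝ) (hg : ∀ j, IsPoly (g j)) (hg0 : ∀ j, ∃ p, g j p ≠ 0)
    (hgω : ∀ p, (∀ j, g j p ≠ 0) → ∀ v, ω p v ≠ 0) :
    ∃ p, (∀ j, g j p ≠ 0) ∧ Gen E S (ω p) := by
  classical
  obtain ⟨p1, hp1⟩ := IsPoly.simul hg hg0
  have hI : ∀ I : V → Finset E, ∃ f : (P → ℝ) → ℝ, IsPoly f ∧ (∃ p, f p ≠ 0) ∧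
      ∀ p, (∀ v, ω p v ≠ 0) → f p ≠ 0 → ∀ p', (∀ v, ω p' v ≠ 0) →
        Module.finrank ℝ (NN (ω p) I) ≤ Module.finrank ℝ (NN (ω p') I) := by
    intro I
    obtain ⟨p0, hp0, hmin⟩ : ∃ p0, (∀ v, ω p0 v ≠ 0) ∧ ∀ p', (∀ v, ω p' v ≠ 0) →
        Module.finrank ℝ (NN (ω p0) I) ≤ Module.finrank ℝ (NN (ω p') I) := by
      have hne : ({p | ∀ v, ω p v ≠ 0} : Set (P → ℝ)).Nonempty := ⟨p1, hgω p1 hp1⟩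
      refine ⟨Function.argminOn (fun p => Module.finrank ℝ (NN (ω p) I)) _ hne,
        Function.argminOn_mem _ _ hne, fun p' hp' => ?_⟩
      have hp2 : p' ∈ ({p | ∀ v, ω p v ≠ 0} : Set (P → ℝ)) := hp'
      exact Function.argminOn_le (fun p => Module.finrank ℝ (NN (ω p) I)) _ hp2
    obtain ⟨f, hf1, hf2, hf3⟩ := rank_semi (fun p => AA (ω p) I) (by
      rintro y ⟨u, i, j, k, l⟩
      by_cases hij : i ∈ I u ∧ j ∈ I u
      · simp only [AA, LinearMap.pi_apply, hij, and_self, if_true, LinearMap.sub_apply,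
          LinearMap.smul_apply, LinearMap.comp_apply, smul_eq_mul]
        exact ((hpoly _ _).mul (IsPoly.const _)).sub ((hpoly _ _).mul (IsPoly.const _))
      · simp only [AA, LinearMap.pi_apply, hij, if_false]
        exact IsPoly.const 0) p0
    refine ⟨f, hf1, ⟨p0, hf2⟩, fun p hp hfp p' hp' => ?_⟩
    have := hf3 p hfp
    rw [ker_AA _ hp, ker_AA _ hp0] at this
    exact this.trans (hmin p' hp')
  choose f hf1 hf2 hf3 using hI
  obtain ⟨p, hp⟩ := IsPoly.simul (f := fun j : J ⊕ (V → Finset E) => Sum.elim g f j)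
    (by rintro (j | I); exacts [hg j, hf1 I]) (by rintro (j | I); exacts [hg0 j, hf2 I])
  have hgp : ∀ j, g j p ≠ 0 := fun j => hp (Sum.inl j)
  refine ⟨p, hgp, fun v => ⟨hS p v, hgω p hgp v⟩, fun I ω' hω' => ?_⟩
  obtain ⟨p', rfl⟩ := hsurj ω' hω'
  exact hf3 I p (hgω p hgp) (hp (Sum.inr I)) p' (fun v => (hω' v).2)
end gen
end RB

set_option synthInstance.maxHeartbeats 1000000
set_option maxHeartbeats 1000000
set_option linter.unusedSectionVars false
set_option linter.unusedSimpArgs false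
set_option linter.unusedVariables false
open ExteriorAlgebra
namespace RB
section fin
variable {V E : Type} [Fintype V] [Fintype E] [DecidableEq V] [DecidableEq E] {d : ℕ}

noncomputable def row (vol : ExtAlg d →ₗ[ℝ] ℝ) (ends : E → V × V) (e : E) (a b : Wd d) :
    Module.Dual ℝ (V → extGrade d (d - 1)) :=
  (vol.comp ((LinearMap.mulLeft ℝ (ι ℝ a * ι ℝ b)).comp (extGrade d (d - 1)).subtype)).comp
    ((LinearMap.proj (ends e).1 : (V → extGrade d (d - 1)) →ₗ[ℝ] extGrade d (d - 1))
      - LinearMap.proj (ends e).2)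

theorem row_apply (vol : ExtAlg d →ₗ[ℝ] ℝ) (ends : E → V × V) (e : E) (a b : Wd d)
    (m : V → extGrade d (d - 1)) :
    row vol ends e a b m = vol (ι ℝ a * ι ℝ b * ((m (ends e).1 : ExtAlg d) - m (ends e).2)) := rfl

theorem vol_zero (hd : 3 ≤ d) (vol : ExtAlg d →ₗ[ℝ] ℝ)
    (hvol : ∀ x ∈ extGrade d (d + 1), vol x = 0 → x = 0) (a b : Wd d) (x : ExtAlg d)
    (hx : x ∈ extGrade d (d - 1)) (h : vol (ι ℝ a * ι ℝ b * x) = 0) : ι ℝ a * ι ℝ b * x = 0 := by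
  apply hvol _ _ h
  have := ι_mul_mem a (ι_mul_mem b hx)
  rw [show d - 1 + 1 + 1 = d + 1 by omega, ← mul_assoc] at this
  exact this

theorem motion_kers (hd : 3 ≤ d) (vol : ExtAlg d →ₗ[ℝ] ℝ)
    (hvol : ∀ x ∈ extGrade d (d + 1), vol x = 0 → x = 0) (ends : E → V × V)
    (a b : E → Wd d) (E₀ : Set E) :
    Module.finrank ℝ ↥(motionSpace d ends (fun e => ι ℝ (a e) * ι ℝ (b e)) E₀) =
      Module.finrank ℝ (kers (fun e => row vol ends e (a e) (b e)) E₀) := by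
  let Φ : (V → extGrade d (d - 1)) →ₗ[ℝ] (V → ExtAlg d) :=
    LinearMap.pi fun v => (extGrade d (d - 1)).subtype.comp (LinearMap.proj v)
  have hΦ : Function.Injective Φ := by
    intro m m' h
    ext v
    exact congrFun h v
  have hmap : motionSpace d ends (fun e => ι ℝ (a e) * ι ℝ (b e)) E₀ =
      (kers (fun e => row vol ends e (a e) (b e)) E₀).map Φ := by
    ext m
    simp only [motionSpace, Submodule.mem_inf, Submodule.mem_iInf, Submodule.mem_comap,
      LinearMap.mem_ker, LinearMap.proj_apply, LinearMap.comp_apply, LinearMap.sub_apply,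
      LinearMap.mulLeft_apply, Submodule.mem_map, mem_kers, row_apply]
    constructor
    · rintro ⟨h1, h2⟩
      refine ⟨fun v => ⟨m v, h1 v⟩, fun e he => ?_, rfl⟩
      rw [h2 e he, map_zero]
    · rintro ⟨m, hm, rfl⟩
      refine ⟨fun v => (m v).2, fun e he => ?_⟩
      exact vol_zero hd vol hvol _ _ _ (Submodule.sub_mem _ (m _).2 (m _).2) (hm e he)
  rw [hmap]
  exact (LinearEquiv.finrank_eq (Submodule.equivMapOfInjective Φ hΦ _)).symm

theorem finrank_X (hd : 3 ≤ d) : Module.finrank ℝ (extGrade d (d - 1)) = (d + 1).choose 2 := by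
  rw [finrank_extGrade]
  exact Nat.choose_symm_of_eq_add (by omega)

theorem choose_ge (hd : 3 ≤ d) : 6 ≤ (d + 1).choose 2 := by
  have : (4).choose 2 ≤ (d + 1).choose 2 := Nat.choose_le_choose 2 (by omega)
  exact this

theorem forward (hd : 3 ≤ d) (D : ℕ) (hD : D = (d + 1).choose 2)
    (ends : E → V × V) (hloop : ∀ e : E, (ends e).1 ≠ (ends e).2)
    (r : V → ExtAlg d) (a b : E → Wd d)
    (hr0 : ∀ v : V, r v ≠ 0)
    (hdec : ∀ v : V, IsDecomp d (d - 1) (r v))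
    (hnp : ∀ u v : V, u ≠ v → ∀ c : ℝ, r u ≠ c • r v)
    (hinc : ∀ e : E, (ι ℝ (a e) * ι ℝ (b e)) * r (ends e).1 = 0 ∧
        (ι ℝ (a e) * ι ℝ (b e)) * r (ends e).2 = 0)
    (h1 : Module.finrank ℝ
        ↥(motionSpace d ends (fun e => ι ℝ (a e) * ι ℝ (b e)) Set.univ)
          = D + Fintype.card V)
    (h2 : ∀ e₀ : E, D + Fintype.card V + 1 ≤
        Module.finrank ℝ
          ↥(motionSpace d ends (fun e => ι ℝ (a e) * ι ℝ (b e)) {e : E | e ≠ e₀})) :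
    ((Fintype.card E : ℤ) = ((D : ℤ) - 1) * Fintype.card V - D ∧
      ∀ F : Finset E, F.Nonempty →
        (F.card : ℤ) ≤ ((D : ℤ) - 1) * (VF ends F).card - D) := by
  classical
  obtain ⟨vol, hvol⟩ := exists_vol d
  have hX : Module.finrank ℝ (extGrade d (d - 1)) = D := by rw [finrank_X hd, hD]
  set x := fun e => row vol ends e (a e) (b e) with hx
  simp only [motion_kers hd vol hvol, ← hx] at h1 h2
  have hli : LinearIndependent ℝ x := by
    apply indep_of_kers
    intro e; rw [h1]; exact h2 e
  have hY : Module.finrank ℝ (V → extGrade d (d - 1)) = D * Fintype.card V := by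
    rw [Module.finrank_pi_fintype]; simp [hX, mul_comm]
  constructor
  · have := finrank_kers_indep x hli Finset.univ
    rw [Finset.coe_univ, h1, hY, Finset.card_univ] at this
    zify at this
    linarith
  · intro F hF
    have hk := finrank_kers_indep x hli F
    have hrm : ∀ v, r v ∈ extGrade d (d - 1) := by
      intro v
      obtain ⟨w, hw⟩ := hdec v
      rw [hw]; exact dec_mem w
    let rX : V → extGrade d (d - 1) := fun v => ⟨r v, hrm v⟩
    let f : (extGrade d (d - 1) × ({v // v ∈ VF ends F} → ℝ) ×
        ({v // v ∉ VF ends F} → extGrade d (d - 1))) →ₗ[ℝ] (V → extGrade d (d - 1)) :=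
      { toFun := fun p v => if h : v ∈ VF ends F then p.1 + p.2.1 ⟨v, h⟩ • rX v else p.2.2 ⟨v, h⟩
        map_add' := by
          intro p q; funext v
          by_cases h : v ∈ VF ends F
          · simp only [h, dif_pos, Pi.add_apply, Prod.fst_add, Prod.snd_add, add_smul]; abel
          · simp [h]
        map_smul' := by
          intro c p; funext v
          by_cases h : v ∈ VF ends F
          · simp [h, mul_smul]
          · simp [h] }
    have hf1 : ∀ p v (h : v ∈ VF ends F), f p v = p.1 + p.2.1 ⟨v, h⟩ • rX v := by
      intro p v h; simp [f, h]
    have hf2 : ∀ p v (h : v ∉ VF ends F), f p v = p.2.2 ⟨v, h⟩ := by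
      intro p v h; simp [f, h]
    have hfi : Function.Injective f := by
      rw [← LinearMap.ker_eq_bot, LinearMap.ker_eq_bot']
      intro p hp
      obtain ⟨e, he⟩ := hF
      have hu : (ends e).1 ∈ VF ends F := (mem_VF _ _ _).2 ⟨e, he, Or.inl rfl⟩
      have hv : (ends e).2 ∈ VF ends F := (mem_VF _ _ _).2 ⟨e, he, Or.inr rfl⟩
      have e1 : ∀ w (h : w ∈ VF ends F), p.1 + p.2.1 ⟨w, h⟩ • rX w = 0 := by
        intro w h
        rw [← hf1, hp]; rfl
      have hc : p.2.1 ⟨_, hu⟩ = 0 := by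
        by_contra hc
        apply hnp _ _ (hloop e) ((p.2.1 ⟨_, hu⟩)⁻¹ * p.2.1 ⟨_, hv⟩)
        have h3 : p.2.1 ⟨_, hu⟩ • rX (ends e).1 = p.2.1 ⟨_, hv⟩ • rX (ends e).2 := by
          have := (e1 _ hu).trans (e1 _ hv).symm
          exact add_left_cancel this
        have h4 : p.2.1 ⟨_, hu⟩ • r (ends e).1 = p.2.1 ⟨_, hv⟩ • r (ends e).2 :=
          congrArg Subtype.val h3
        rw [mul_smul, ← h4, smul_smul, inv_mul_cancel₀ hc, one_smul]
      have hx0 : p.1 = 0 := by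
        have := e1 _ hu
        rw [hc, zero_smul, add_zero] at this
        exact this
      have hrX : ∀ v, rX v ≠ 0 := fun v h => hr0 v (congrArg Subtype.val h)
      refine Prod.ext hx0 (Prod.ext ?_ ?_)
      · funext ⟨w, hw⟩
        have := e1 w hw
        rw [hx0, zero_add, smul_eq_zero] at this
        exact this.resolve_right (hrX w)
      · funext ⟨w, hw⟩
        rw [← hf2 p w hw, hp]; rfl
    have hle : LinearMap.range f ≤ kers x F := by
      rintro _ ⟨p, rfl⟩
      rw [mem_kers]
      intro e he
      have hu : (ends e).1 ∈ VF ends F := (mem_VF _ _ _).2 ⟨e, he, Or.inl rfl⟩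
      have hv : (ends e).2 ∈ VF ends F := (mem_VF _ _ _).2 ⟨e, he, Or.inr rfl⟩
      rw [hx]
      simp only [row_apply]
      rw [hf1 p _ hu, hf1 p _ hv]
      have : ((p.1 + p.2.1 ⟨_, hu⟩ • rX (ends e).1 : extGrade d (d - 1)) : ExtAlg d) -
          ((p.1 + p.2.1 ⟨_, hv⟩ • rX (ends e).2 : extGrade d (d - 1)) : ExtAlg d) =
          p.2.1 ⟨_, hu⟩ • r (ends e).1 - p.2.1 ⟨_, hv⟩ • r (ends e).2 := by
        simp [rX]
      rw [this, mul_sub, mul_smul_comm, mul_smul_comm, (hinc e).1, (hinc e).2]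
      simp
    have h3 := Submodule.finrank_mono hle
    rw [LinearMap.finrank_range_of_inj hfi, Module.finrank_prod, Module.finrank_prod,
      Module.finrank_pi_fintype, Module.finrank_pi_fintype] at h3
    have h4 : Fintype.card {e // e ∉ VF ends F} = Fintype.card V - (VF ends F).card := by
      rw [Fintype.card_subtype_compl]; simp
    have hV : (VF ends F).card ≤ Fintype.card V := Finset.card_le_univ _
    simp only [Finset.sum_const, Finset.card_univ, h4, smul_eq_mul, hX, Module.finrank_self,
      Fintype.card_coe, mul_one] at h3
    rw [hY] at hk
    zify [hV] at h3 hk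
    nlinarith

theorem exists_config (hd : 3 ≤ d) (hV : 1 < Fintype.card V) (vol : ExtAlg d →ₗ[ℝ] ℝ)
    (hvol : ∀ x ∈ extGrade d (d + 1), vol x = 0 → x = 0) (i0 i1 : Fin (d - 1)) (hi : i0 ≠ i1) :
    ∃ w : V → Fin (d - 1) → Wd d, (∀ u v, u ≠ v → br vol (dec (w u)) (w v i0) (w v i1) ≠ 0) ∧
      Gen E {x : extGrade d (d - 1) | ∃ w : Fin (d - 1) → Wd d, x.1 = dec w} (fun v => ⟨dec (w v), dec_mem (w v)⟩) := by
  classical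
  let P := V × Fin (d - 1) × Fin (d + 1)
  let wp : (P → ℝ) → V → Fin (d - 1) → Wd d := fun p v i j => p (v, i, j)
  have hbase : ∃ (w0 : Fin (d - 1) → Wd d) (a0 b0 : Wd d), br vol (dec w0) a0 b0 ≠ 0 := by
    by_contra hcon
    push Not at hcon
    have h1 : ∀ w : Fin (d - 1) → Wd d, dec w = 0 := fun w =>
      br_nondeg (k := d - 1) (by omega) vol hvol _ (dec_mem w) (hcon w)
    have h2 : extGrade d (d - 1) = ⊥ := by
      rw [extGrade_eq, ← exteriorPower.ιMulti_span_fixedDegree, Submodule.span_eq_bot]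
      rintro _ ⟨w, rfl⟩
      rw [← dec_eq]; exact h1 w
    have h3 := finrank_X hd
    rw [h2, finrank_bot] at h3
    have := choose_ge hd
    omega
  obtain ⟨w0, a0, b0, hbase⟩ := hbase
  obtain ⟨p, hp1, hp2⟩ := exists_gen (E := E) (P := P) (J := {q : V × V // q.1 ≠ q.2})
    {x : extGrade d (d - 1) | ∃ w : Fin (d - 1) → Wd d, x.1 = dec w}
    (fun p v => ⟨dec (wp p v), dec_mem (wp p v)⟩) (by
      intro v φ
      obtain ⟨l, hl⟩ := LinearMap.exists_extend φ
      have : ∀ p, φ ⟨dec (wp p v), dec_mem (wp p v)⟩ = l (dec (fun i => wp p v i)) := by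
        intro p; rw [← hl]; rfl
      simp only [this]
      exact IsPoly.dec (d - 1) (fun i p => wp p v i) (fun i j => IsPoly.coord _) l)
    (fun p v => ⟨wp p v, rfl⟩)
    (by
      intro ω' hω'
      have := fun v => (hω' v).1
      choose w hw using this
      refine ⟨fun q => w q.1 q.2.1 q.2.2, ?_⟩
      funext v
      exact Subtype.ext (hw v).symm)
    (fun q p => br vol (dec (wp p q.1.1)) (wp p q.1.2 i0) (wp p q.1.2 i1))
    (by
      rintro ⟨⟨u, v⟩, huv⟩
      have : ∀ p, br vol (dec (wp p u)) (wp p v i0) (wp p v i1) = vol (dec (fun i =>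
          (Fin.cons (fun p => wp p v i0) (Fin.cons (fun p => wp p v i1) (fun i p => wp p u i) :
            Fin (d - 1 + 1) → (P → ℝ) → Wd d) : Fin (d - 1 + 2) → (P → ℝ) → Wd d) i p)) := by
        intro p
        rw [br_apply, mul_assoc, ι_mul_dec, ι_mul_dec]
        congr 2
        funext i
        refine Fin.cases ?_ (fun i => ?_) i
        · simp
        · refine Fin.cases ?_ (fun i => ?_) i
          · simp
          · simp
      simp only [this]
      apply IsPoly.dec
      intro i j
      refine Fin.cases ?_ (fun i => ?_) i
      · simp only [Fin.cons_zero]; exact IsPoly.coord _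
      · refine Fin.cases ?_ (fun i => ?_) i
        · simp only [Fin.cons_zero, Fin.cons_succ]; exact IsPoly.coord _
        · simp only [Fin.cons_succ]; exact IsPoly.coord _)
    (by
      rintro ⟨⟨u, v⟩, huv⟩
      refine ⟨fun q => if q.1 = u then w0 q.2.1 q.2.2 else
        if q.2.1 = i0 then a0 q.2.2 else b0 q.2.2, ?_⟩
      have huv' : v ≠ u := fun h => huv h.symm
      simpa [wp, huv', hi.symm] using hbase)
    (by
      intro p hp v h0
      obtain ⟨u, hu⟩ := Fintype.exists_ne_of_one_lt_card hV v
      apply hp ⟨(v, u), hu.symm⟩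
      have : dec (wp p v) = 0 := congrArg Subtype.val h0
      simp only [br_apply, this, mul_zero, map_zero])
  exact ⟨wp p, fun u v huv => hp1 ⟨(u, v), huv⟩, hp2⟩

theorem span_dec (d k : ℕ) :
    Submodule.span ℝ {x : extGrade d k | ∃ w : Fin k → Wd d, x.1 = dec w} = ⊤ := by
  have h := exteriorPower.ιMulti_span_fixedDegree ℝ k (M := Wd d)
  apply Submodule.map_injective_of_injective (extGrade d k).injective_subtype
  rw [Submodule.map_span, Submodule.map_top, Submodule.range_subtype]
  refine Eq.trans ?_ ((extGrade_eq d k).trans h.symm).symm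
  congr 1
  ext x
  constructor
  · rintro ⟨y, ⟨w, hw⟩, rfl⟩
    exact ⟨w, by rw [← dec_eq]; exact hw.symm⟩
  · rintro ⟨w, rfl⟩
    exact ⟨⟨dec w, dec_mem w⟩, ⟨w, rfl⟩, dec_eq w⟩

theorem backward (hd : 3 ≤ d) (D : ℕ) (hD : D = (d + 1).choose 2)
    (ends : E → V × V) (hloop : ∀ e : E, (ends e).1 ≠ (ends e).2)
    (hE : (Fintype.card E : ℤ) = ((D : ℤ) - 1) * Fintype.card V - D)
    (hF : ∀ F : Finset E, F.Nonempty →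
        (F.card : ℤ) ≤ ((D : ℤ) - 1) * (VF ends F).card - D) :
    ∃ (r : V → ExtAlg d) (a b : E → Wd d),
      (∀ v : V, r v ≠ 0) ∧
      (∀ v : V, IsDecomp d (d - 1) (r v)) ∧
      (∀ u v : V, u ≠ v → ∀ c : ℝ, r u ≠ c • r v) ∧
      (∀ e : E, ι ℝ (a e) * ι ℝ (b e) ≠ 0) ∧
      (∀ e : E, (ι ℝ (a e) * ι ℝ (b e)) * r (ends e).1 = 0 ∧
        (ι ℝ (a e) * ι ℝ (b e)) * r (ends e).2 = 0) ∧
      Module.finrank ℝ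
        ↥(motionSpace d ends (fun e => ι ℝ (a e) * ι ℝ (b e)) Set.univ)
          = D + Fintype.card V ∧
      (∀ e₀ : E, D + Fintype.card V + 1 ≤
        Module.finrank ℝ
          ↥(motionSpace d ends (fun e => ι ℝ (a e) * ι ℝ (b e)) {e : E | e ≠ e₀})) := by
  classical
  obtain ⟨vol, hvol⟩ := exists_vol d
  have hX : Module.finrank ℝ (extGrade d (d - 1)) = D := by rw [finrank_X hd, hD]
  have hD6 : 6 ≤ D := by rw [hD]; exact choose_ge hd
  have hY : Module.finrank ℝ (V → extGrade d (d - 1)) = D * Fintype.card V := by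
    rw [Module.finrank_pi_fintype]; simp [hX, mul_comm]
  have hV : 1 < Fintype.card V := by
    by_contra hcon
    have h1 : Fintype.card V = 0 ∨ Fintype.card V = 1 := by omega
    rcases h1 with h1 | h1 <;> rw [h1] at hE <;> push_cast at hE <;> omega
  obtain ⟨w, hw, hG⟩ := exists_config (E := E) hd hV vol hvol ⟨0, by omega⟩ ⟨1, by omega⟩ (by simp)
  set ω : V → extGrade d (d - 1) := fun v => ⟨dec (w v), dec_mem (w v)⟩ with hω
  let S : E → Set (Module.Dual ℝ (V → extGrade d (d - 1))) := fun e =>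
    {φ | ∃ a b, br vol (dec (w (ends e).1)) a b = 0 ∧ br vol (dec (w (ends e).2)) a b = 0 ∧
      φ = row vol ends e a b}
  obtain ⟨y, hyS, hy⟩ := select S (by
    intro F
    have h1 := motion_bound (by rw [hX]; exact hD6) _ (span_dec d (d - 1)) ω hG ends F (by
      intro F' _ hF'
      rw [hX]; exact hF F' hF')
    have h2 := Subspace.finrank_add_finrank_dualCoannihilator_eq
      (⨆ e ∈ F, Submodule.span ℝ (S e))
    have h3 : (⨆ e ∈ F, Submodule.span ℝ (S e)).dualCoannihilator ≤ MM ω ends F := by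
      intro m hm e he
      rw [Submodule.mem_dualCoannihilator] at hm
      have h4 := star (k := d - 1) (by omega) vol hvol (w (ends e).1) (w (ends e).2)
        ⟨0, by omega⟩ ⟨1, by omega⟩ (hw _ _ (hloop e)) (hw _ _ (hloop e).symm)
        ((m (ends e).1 : ExtAlg d) - m (ends e).2) (Submodule.sub_mem _ (m _).2 (m _).2) (by
          intro a b ha hb
          have := hm (row vol ends e a b) (by
            have hle : Submodule.span ℝ (S e) ≤ ⨆ e ∈ F, Submodule.span ℝ (S e) :=
              le_iSup₂_of_le e he le_rfl
            exact hle (Submodule.subset_span ⟨a, b, ha, hb, rfl⟩))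
          rw [row_apply] at this
          exact this)
      rw [Submodule.mem_span_pair] at h4 ⊢
      obtain ⟨c, c', h4⟩ := h4
      exact ⟨c, c', Subtype.ext h4⟩
    have h4 := Submodule.finrank_mono h3
    rw [hY] at h2
    rw [hX] at h1
    omega)
  choose a b ha hb hab using hyS
  have hyr : y = fun e => row vol ends e (a e) (b e) := funext hab
  refine ⟨fun v => dec (w v), a, b, ?_, ?_, ?_, ?_, ?_, ?_, ?_⟩
  · intro v h
    exact (hG.1 v).2 (Subtype.ext h)
  · intro v; exact ⟨w v, rfl⟩
  · intro u v huv c h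
    apply hw u v huv
    have h' : dec (w u) = c • dec (w v) := h
    rw [h', br_smul, br_dec_right _ _ _ _ (Submodule.subset_span ⟨_, rfl⟩), mul_zero]
  · intro e h
    apply hy.ne_zero e
    rw [hab]
    refine LinearMap.ext fun m => ?_
    rw [row_apply, h]; simp
  · intro e
    exact ⟨vol_zero hd vol hvol _ _ _ (dec_mem _) (ha e),
      vol_zero hd vol hvol _ _ _ (dec_mem _) (hb e)⟩
  · rw [motion_kers hd vol hvol, ← hyr]
    have := finrank_kers_indep y hy Finset.univ
    rw [Finset.coe_univ, hY, Finset.card_univ] at this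
    zify at this ⊢
    linarith
  · intro e₀
    rw [motion_kers hd vol hvol, ← hyr]
    have := finrank_kers_indep y hy (Finset.univ.erase e₀)
    have hset : ((Finset.univ.erase e₀ : Finset E) : Set E) = {e | e ≠ e₀} := by ext; simp
    rw [hset, hY, Finset.card_erase_of_mem (Finset.mem_univ _), Finset.card_univ] at this
    have hpos : 1 ≤ Fintype.card E := Fintype.card_pos_iff.2 ⟨e₀⟩
    zify [hpos] at this ⊢
    linarith
end fin
end RB

theorem statement_4
    (d : ℕ) (hd : 3 ≤ d) (D : ℕ) (hD : D = (d + 1).choose 2)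
    (V E : Type) [Fintype V] [Fintype E] [DecidableEq V] [DecidableEq E]
    (ends : E → V × V) (hloop : ∀ e : E, (ends e).1 ≠ (ends e).2) :
    (∃ (r : V → ExtAlg d) (a b : E → Wd d),
      (∀ v : V, r v ≠ 0) ∧
      (∀ v : V, IsDecomp d (d - 1) (r v)) ∧
      (∀ u v : V, u ≠ v → ∀ c : ℝ, r u ≠ c • r v) ∧
      (∀ e : E, ι ℝ (a e) * ι ℝ (b e) ≠ 0) ∧
      (∀ e : E, (ι ℝ (a e) * ι ℝ (b e)) * r (ends e).1 = 0 ∧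
        (ι ℝ (a e) * ι ℝ (b e)) * r (ends e).2 = 0) ∧
      Module.finrank ℝ
        ↥(motionSpace d ends (fun e => ι ℝ (a e) * ι ℝ (b e)) Set.univ)
          = D + Fintype.card V ∧
      (∀ e₀ : E, D + Fintype.card V + 1 ≤
        Module.finrank ℝ
          ↥(motionSpace d ends (fun e => ι ℝ (a e) * ι ℝ (b e)) {e : E | e ≠ e₀})))
    ↔
    ((Fintype.card E : ℤ) = ((D : ℤ) - 1) * Fintype.card V - D ∧
      ∀ F : Finset E, F.Nonempty →
        (F.card : ℤ) ≤ ((D : ℤ) - 1) * (VF ends F).card - D) := by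
  constructor
  · rintro ⟨r, a, b, h0, h1, h2, _, h4, h5, h6⟩
    exact RB.forward hd D hD ends hloop r a b h0 h1 h2 h4 h5 h6
  · rintro ⟨hE, hF⟩
    exact RB.backward hd D hD ends hloop hE hF
end

section
/- Let d≥2 be an integer, W=ℝ^{d+1}, D=binom(d+1,2). Let G=(V,E) be a finite multigraph. Then there exist maps a,b:E→W such that, setting q_e := a_e∧b_e ∈ ⋀²W and, for each edge e with endpoints u and v, v_e := δ_u·q_e − δ_v·q_e in the space of functions V→⋀²W, the following holds for every F⊆E: the family (v_e)_{e∈F} is linearly independent if and only if |F'| ≤ D·(|V(F')|−1) for every nonempty F'⊆F (equivalently, if and only if F is independent in the union of D copies of the graphic matroid of G). (Tay's theorem: the generic body-bar matroid equals the union of D copies of the graphic matroid.) -/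
/- STATEMENT 6 (Tay): the generic body-bar matroid equals the union of `D` copies of the
graphic matroid: for a generic bar-configuration `q`, a set of edge vectors
`δ_u·q_e − δ_v·q_e` is linearly independent iff `|F'| ≤ D(|V(F')|-1)` for all nonempty
`F' ⊆ F`. -/

set_option synthInstance.maxHeartbeats 1000000
set_option maxHeartbeats 1000000

open ExteriorAlgebra

set_option linter.unusedSectionVars false

section Rado
variable {J K M : Type} [Fintype J] [DecidableEq J] [DecidableEq K] [AddCommGroup M] [Module ℝ M]
  [FiniteDimensional ℝ M]

noncomputable def spanU (x : J → K → M) (A : J → Finset K) (s : Finset J) : Submodule ℝ M :=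
  s.sup (fun j => Submodule.span ℝ (x j '' (A j : Set K)))

theorem spanU_mono (x : J → K → M) (A : J → Finset K) {s t : Finset J} (h : s ⊆ t) :
    spanU x A s ≤ spanU x A t := Finset.sup_mono h

theorem spanU_update_not_mem (x : J → K → M) (A : J → Finset K) (i : J) (B : Finset K)
    (s : Finset J) (h : i ∉ s) : spanU x (Function.update A i B) s = spanU x A s := by
  unfold spanU
  apply Finset.sup_congr rfl
  intro j hj
  have : j ≠ i := by rintro rfl; exact h hj
  simp [Function.update_of_ne this]

theorem spanU_update_insert (x : J → K → M) (A : J → Finset K) (i : J) (B : Finset K)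
    (s : Finset J) (h : i ∉ s) : spanU x (Function.update A i B) (insert i s) =
      Submodule.span ℝ (x i '' (B : Set K)) ⊔ spanU x A s := by
  rw [← spanU_update_not_mem x A i B s h]
  unfold spanU
  rw [Finset.sup_insert]
  simp

theorem rado_aux (x : J → K → M) (n : ℕ) : ∀ (A : J → Finset K), (∑ j, (A j).card = n) →
    (∀ s : Finset J, s.card ≤ Module.finrank ℝ (spanU x A s)) →
    ∃ c : J → K, LinearIndependent ℝ (fun j => x j (c j)) := by
  induction n using Nat.strong_induction_on with
  | _ n ih =>
  intro A hn hA
  by_cases hbig : ∃ i, 1 < (A i).card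
  · obtain ⟨i, hi⟩ := hbig
    obtain ⟨k, hk, l, hl, hkl⟩ := Finset.one_lt_card.1 hi
    have key : ∀ k ∈ A i, (∃ c : J → K, LinearIndependent ℝ (fun j => x j (c j))) ∨
        ∃ s : Finset J, i ∉ s ∧ Module.finrank ℝ
          ↥(Submodule.span ℝ (x i '' (((A i).erase k : Finset K) : Set K)) ⊔ spanU x A s) ≤ s.card := by
      intro k hk
      by_cases h : ∀ s : Finset J, s.card ≤
          Module.finrank ℝ (spanU x (Function.update A i ((A i).erase k)) s)
      · left
        refine ih (∑ j, (Function.update A i ((A i).erase k) j).card) ?_ _ rfl h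
        rw [← hn]
        apply Finset.sum_lt_sum
        · intro j _
          by_cases hj : j = i
          · subst hj; simpa using Finset.card_erase_le
          · simp [Function.update_of_ne hj]
        · refine ⟨i, Finset.mem_univ _, ?_⟩
          simpa using Finset.card_erase_lt_of_mem hk
      · right
        push Not at h
        obtain ⟨s, hs⟩ := h
        have his : i ∈ s := by
          by_contra hh
          rw [spanU_update_not_mem _ _ _ _ _ hh] at hs
          exact absurd (hA s) (by omega)
        refine ⟨s.erase i, Finset.notMem_erase _ _, ?_⟩
        rw [← spanU_update_insert _ _ _ _ _ (Finset.notMem_erase _ _), Finset.insert_erase his]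
        have := Finset.card_erase_of_mem his
        omega
    rcases key k hk with h | ⟨s, his, hs⟩
    · exact h
    rcases key l hl with h | ⟨t, hit, ht⟩
    · exact h
    exfalso
    set P := Submodule.span ℝ (x i '' (((A i).erase k : Finset K) : Set K)) ⊔ spanU x A s with hP
    set Q := Submodule.span ℝ (x i '' (((A i).erase l : Finset K) : Set K)) ⊔ spanU x A t with hQ
    have h1 : spanU x A (insert i (s ∪ t)) ≤ P ⊔ Q := by
      unfold spanU
      refine Finset.sup_le ?_
      intro j hj
      rw [Finset.mem_insert, Finset.mem_union] at hj
      rcases hj with rfl | hj | hj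
      · rw [Submodule.span_le]
        rintro _ ⟨m, hm, rfl⟩
        by_cases hmk : m = k
        · have hml : m ≠ l := by rw [hmk]; exact hkl
          exact Submodule.mem_sup_right (Submodule.mem_sup_left (Submodule.subset_span
            ⟨m, by simpa using ⟨hm, hml⟩, rfl⟩))
        · exact Submodule.mem_sup_left (Submodule.mem_sup_left (Submodule.subset_span
            ⟨m, by simpa using ⟨hm, hmk⟩, rfl⟩))
      · exact (Finset.le_sup (f := fun j => Submodule.span ℝ (x j '' (A j : Set K))) hj).trans
          (le_sup_right.trans le_sup_left)
      · exact (Finset.le_sup (f := fun j => Submodule.span ℝ (x j '' (A j : Set K))) hj).trans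
          (le_sup_right.trans le_sup_right)
    have h2 : spanU x A (s ∩ t) ≤ P ⊓ Q :=
      le_inf ((spanU_mono x A Finset.inter_subset_left).trans le_sup_right)
        ((spanU_mono x A Finset.inter_subset_right).trans le_sup_right)
    have e := Submodule.finrank_sup_add_finrank_inf_eq P Q
    have f1 := Submodule.finrank_mono h1
    have f2 := Submodule.finrank_mono h2
    have g1 := hA (insert i (s ∪ t))
    have g2 := hA (s ∩ t)
    rw [Finset.card_insert_of_notMem (by simp [his, hit])] at g1
    have := Finset.card_union_add_card_inter s t
    omega
  · push Not at hbig
    have hone : ∀ i, ∃ k, A i = {k} := by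
      intro i
      rw [← Finset.card_eq_one]
      have h := hA {i}
      have : (A i).card ≠ 0 := by
        intro h0
        rw [Finset.card_eq_zero] at h0
        rw [spanU, Finset.sup_singleton, h0] at h
        simp at h
      have := hbig i
      omega
    choose c hc using hone
    refine ⟨c, ?_⟩
    rw [linearIndependent_iff_card_le_finrank_span]
    refine (hA Finset.univ).trans (Submodule.finrank_mono ?_)
    refine Finset.sup_le ?_
    intro j _
    apply Submodule.span_mono
    rw [hc j]
    simp
end Rado

section Tay
variable {V E I : Type} [Fintype V] [Fintype E] [Fintype I] [DecidableEq V] [DecidableEq E]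
  [DecidableEq I]

/-- incidence coefficient -/
def inc (ends : E → V × V) (e : E) (v : V) : ℝ :=
  (if v = (ends e).1 then 1 else 0) - (if v = (ends e).2 then 1 else 0)

def wvec (ends : E → V × V) (e : E) (q : I → ℝ) : V × I → ℝ := fun p => inc ends e p.1 * q p.2

theorem sum_inc_mul (ends : E → V × V) (e : E) (f : V → ℝ) :
    ∑ v, inc ends e v * f v = f (ends e).1 - f (ends e).2 := by
  simp [inc, sub_mul, Finset.sum_sub_distrib]

theorem necessity (ends : E → V × V) (q : E → I → ℝ) (F : Finset E)
    (hF : LinearIndependent ℝ (fun e : {x // x ∈ F} => wvec ends e.1 (q e.1)))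
    (hne : F.Nonempty) :
    (F.card : ℤ) ≤ (Fintype.card I : ℤ) * ((VF ends F).card - 1) := by
  obtain ⟨e0, he0⟩ := hne
  have hv0 : (ends e0).1 ∈ VF ends F :=
    Finset.mem_union_left _ (Finset.mem_image_of_mem _ he0)
  set v0 := (ends e0).1
  let T := {v // v ∈ (VF ends F).erase v0}
  let R : (V × I → ℝ) →ₗ[ℝ] (T × I → ℝ) := LinearMap.funLeft ℝ ℝ (fun p => (p.1.1, p.2))
  let N : Submodule ℝ (V × I → ℝ) :=
    { carrier := {f | (∀ v i, v ∉ VF ends F → f (v, i) = 0) ∧ ∀ i, ∑ v, f (v, i) = 0}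
      add_mem' := by
        rintro f g ⟨h1, h2⟩ ⟨h3, h4⟩
        exact ⟨fun v i h => by simp [h1 v i h, h3 v i h],
          fun i => by simp [Finset.sum_add_distrib, h2 i, h4 i]⟩
      zero_mem' := by simp
      smul_mem' := by
        rintro c f ⟨h1, h2⟩
        exact ⟨fun v i h => by simp [h1 v i h],
          fun i => by simp [← Finset.mul_sum, h2 i]⟩ }
  have hspan : Submodule.span ℝ (Set.range (fun e : {x // x ∈ F} => wvec ends e.1 (q e.1))) ≤ N := by
    rw [Submodule.span_le]
    rintro _ ⟨⟨e, he⟩, rfl⟩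
    refine ⟨?_, ?_⟩
    · intro v i hv
      have h1 : v ≠ (ends e).1 := by
        rintro rfl; exact hv (Finset.mem_union_left _ (Finset.mem_image_of_mem _ he))
      have h2 : v ≠ (ends e).2 := by
        rintro rfl
        exact hv (Finset.mem_union_right _
          (Finset.mem_image_of_mem (fun e => (ends e).2) he))
      simp [wvec, inc, h1, h2]
    · intro i
      have := sum_inc_mul ends e (fun _ => q e i)
      simpa [wvec] using this
  have hdisj : Disjoint N (LinearMap.ker R) := by
    rw [Submodule.disjoint_def]
    rintro f ⟨h1, h2⟩ h3
    have h4 : ∀ v i, v ≠ v0 → f (v, i) = 0 := by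
      intro v i hv
      by_cases hvF : v ∈ VF ends F
      · exact congrFun (LinearMap.mem_ker.1 h3)
          ((⟨v, Finset.mem_erase.2 ⟨hv, hvF⟩⟩ : T), i)
      · exact h1 v i hvF
    ext ⟨v, i⟩
    by_cases hv : v = v0
    · have := h2 i
      rw [Finset.sum_eq_single v0 (fun b _ hb => h4 b i hb) (by simp)] at this
      rw [hv]; exact this
    · exact h4 v i hv
  have hR := hF.map (hdisj.mono_left hspan)
  have hc := hR.fintype_card_le_finrank
  simp only [Module.finrank_fintype_fun_eq_card, Fintype.card_prod, Fintype.card_coe, T] at hc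
  have h5 := Finset.card_erase_add_one hv0
  have h6 : ((VF ends F).card : ℤ) - 1 = ((VF ends F).erase v0).card := by
    rw [← h5]; push_cast; ring
  rw [h6]
  rw [mul_comm] at hc
  exact_mod_cast hc

theorem span_dim (ends : E → V × V) (F : Finset E)
    (hF : ∀ F' ⊆ F, F'.Nonempty →
      (F'.card : ℤ) ≤ (Fintype.card I : ℤ) * ((VF ends F').card - 1)) :
    F.card ≤ Module.finrank ℝ (Submodule.span ℝ
      (Set.range (fun p : {x // x ∈ F} × I => wvec ends p.1.1 (Pi.single p.2 (1 : ℝ))))) := by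
  classical
  let Mx : Matrix ({x // x ∈ F} × I) (V × I) ℝ :=
    fun p => wvec ends p.1.1 (Pi.single p.2 (1 : ℝ))
  have hrow : Mx.rank = Module.finrank ℝ (Submodule.span ℝ (Set.range Mx)) :=
    Mx.rank_eq_finrank_span_row
  change _ ≤ Module.finrank ℝ (Submodule.span ℝ (Set.range Mx))
  rw [← hrow]
  have hrn := LinearMap.finrank_range_add_finrank_ker Mx.mulVecLin
  have hrk : Mx.rank = Module.finrank ℝ (LinearMap.range Mx.mulVecLin) := rfl
  rw [← hrk] at hrn
  simp only [Module.finrank_fintype_fun_eq_card, Fintype.card_prod] at hrn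
  let st : Setoid V := Relation.EqvGen.setoid
    (fun u v => ∃ e ∈ F, u = (ends e).1 ∧ v = (ends e).2)
  let C := Quotient st
  have hedge : ∀ e ∈ F, (Quotient.mk st (ends e).1) = Quotient.mk st (ends e).2 :=
    fun e he => Quotient.sound (Relation.EqvGen.rel _ _ ⟨e, he, rfl, rfl⟩)
  -- kernel
  have hker : Module.finrank ℝ (LinearMap.ker Mx.mulVecLin) ≤ Fintype.card C * Fintype.card I := by
    let R : (V × I → ℝ) →ₗ[ℝ] (C × I → ℝ) := LinearMap.funLeft ℝ ℝ (fun p => (p.1.out, p.2))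
    have hinj : Function.Injective (R.comp (LinearMap.ker Mx.mulVecLin).subtype) := by
      rw [← LinearMap.ker_eq_bot, LinearMap.ker_eq_bot']
      rintro ⟨f, hf⟩ hRf
      have hfe : ∀ e ∈ F, ∀ i, f ((ends e).1, i) = f ((ends e).2, i) := by
        intro e he i
        have h := congrFun (LinearMap.mem_ker.1 hf) (⟨e, he⟩, i)
        have h' : ∑ v, inc ends e v * f (v, i) = 0 := by
          change ∑ p : V × I, wvec ends e (Pi.single i (1 : ℝ)) p * f p = 0 at h
          rw [← h]
          simp [wvec, Fintype.sum_prod_type, Pi.single_apply]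
        rw [sum_inc_mul ends e (fun v => f (v, i))] at h'
        linarith
      have hfc : ∀ u v, Relation.EqvGen (fun u v => ∃ e ∈ F, u = (ends e).1 ∧ v = (ends e).2) u v →
          ∀ i, f (u, i) = f (v, i) := by
        intro u v h
        induction h with
        | rel u v h => obtain ⟨e, he, rfl, rfl⟩ := h; exact hfe e he
        | refl => intro i; rfl
        | symm _ _ _ ih => intro i; exact (ih i).symm
        | trans _ _ _ _ _ ih1 ih2 => intro i; exact (ih1 i).trans (ih2 i)
      ext ⟨v, i⟩
      have h1 : f ((Quotient.mk st v).out, i) = 0 := congrFun hRf (Quotient.mk st v, i)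
      have h2 := hfc _ _ (Quotient.mk_out (s := st) v) i
      exact h2.symm.trans h1
    have := LinearMap.finrank_le_finrank_of_injective hinj
    simpa using this
  -- count
  have hcount : (F.card : ℤ) ≤ Fintype.card I * (Fintype.card V - Fintype.card C) := by
    have e1 : F.card = ∑ c : C, (F.filter (fun e => Quotient.mk st (ends e).1 = c)).card :=
      Finset.card_eq_sum_card_fiberwise (fun _ _ => Finset.mem_univ _)
    have e2 : Fintype.card V =
        ∑ c : C, (Finset.univ.filter (fun v => Quotient.mk st v = c)).card := by
      rw [← Finset.card_univ]
      exact Finset.card_eq_sum_card_fiberwise (fun _ _ => Finset.mem_univ _)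
    have e3 : (Fintype.card C : ℤ) = ∑ c : C, 1 := by simp
    rw [e1, e2, e3]
    push_cast
    rw [← Finset.sum_sub_distrib, Finset.mul_sum]
    apply Finset.sum_le_sum
    intro c _
    set Fc := F.filter (fun e => Quotient.mk st (ends e).1 = c) with hFc
    rcases Fc.eq_empty_or_nonempty with h | h
    · rw [h]
      have : 1 ≤ (Finset.univ.filter (fun v => Quotient.mk st v = c)).card := by
        rw [Nat.one_le_iff_ne_zero, ← Nat.pos_iff_ne_zero, Finset.card_pos]
        exact ⟨c.out, by simp [Quotient.out_eq]⟩
      have h0 : (0 : ℤ) ≤ ((Finset.univ.filter (fun v => Quotient.mk st v = c)).card : ℤ) - 1 := by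
        have : (1 : ℤ) ≤ ((Finset.univ.filter (fun v => Quotient.mk st v = c)).card : ℤ) := by
          exact_mod_cast this
        linarith
      simpa using mul_nonneg (Int.natCast_nonneg (Fintype.card I)) h0
    · refine (hF Fc (Finset.filter_subset _ _) h).trans ?_
      apply mul_le_mul_of_nonneg_left _ (Int.natCast_nonneg _)
      apply sub_le_sub_right
      norm_cast
      apply Finset.card_le_card
      intro v hv
      simp only [VF, Finset.mem_union, Finset.mem_image, hFc, Finset.mem_filter] at hv
      simp only [Finset.mem_filter, Finset.mem_univ, true_and]
      rcases hv with ⟨e, ⟨he, hc⟩, rfl⟩ | ⟨e, ⟨he, hc⟩, rfl⟩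
      · exact hc
      · rw [← hedge e he]; exact hc
  zify at hrn hker ⊢
  nlinarith

theorem exists_choice (ends : E → V × V) (F : Finset E)
    (hF : ∀ F' ⊆ F, F'.Nonempty →
      (F'.card : ℤ) ≤ (Fintype.card I : ℤ) * ((VF ends F').card - 1)) :
    ∃ c : {x // x ∈ F} → I, LinearIndependent ℝ
      (fun e : {x // x ∈ F} => wvec ends e.1 (Pi.single (c e) (1 : ℝ))) := by
  refine rado_aux (fun (e : {x // x ∈ F}) (i : I) => wvec ends e.1 (Pi.single i (1 : ℝ))) _
    (fun _ => Finset.univ) rfl ?_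
  intro s
  have h := span_dim (I := I) ends (s.map (Function.Embedding.subtype _)) (fun F' hF' =>
    hF F' (hF'.trans (by intro e he; simp at he; exact he.1)))
  rw [Finset.card_map] at h
  refine h.trans (Submodule.finrank_mono ?_)
  rw [Submodule.span_le]
  rintro _ ⟨⟨⟨e, he⟩, i⟩, rfl⟩
  rw [Finset.mem_map] at he
  obtain ⟨e', he', rfl⟩ := he
  refine (Finset.le_sup (f := fun j : {x // x ∈ F} => Submodule.span ℝ ((fun i : I => 
    wvec ends j.1 (Pi.single i (1 : ℝ))) '' ((Finset.univ : Finset I) : Set I))) he')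
    (Submodule.subset_span ⟨i, by simp, rfl⟩)
end Tay

section Generic
variable {V E : Type} [Fintype V] [Fintype E] [DecidableEq V] [DecidableEq E]

abbrev PI (n : ℕ) : Type := {p : Fin n × Fin n // p.1 < p.2}

def pl {n : ℕ} (a b : Fin n → ℝ) : PI n → ℝ :=
  fun p => a p.1.1 * b p.1.2 - a p.1.2 * b p.1.1

theorem card_PI (n : ℕ) : Fintype.card (PI n) = n.choose 2 := by
  have h1 : Fintype.card (PI n) = ∑ i : Fin n, (Finset.univ.filter (fun j : Fin n => j < i)).card := by
    rw [Fintype.card_subtype, Finset.card_filter, Fintype.sum_prod_type, Finset.sum_comm]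
    simp only [Finset.card_filter]
  rw [h1]
  have h2 : ∀ i : Fin n, (Finset.univ.filter (fun j : Fin n => j < i)).card = (i : ℕ) := by
    intro i
    have : Finset.univ.filter (fun j : Fin n => j < i) = Finset.Iio i := by ext; simp
    rw [this, Fin.card_Iio]
  simp only [h2]
  rw [Fin.sum_univ_eq_sum_range (fun i => i) n, Finset.sum_range_id, Nat.choose_two_right]

theorem pl_single {n : ℕ} (p : PI n) :
    pl (Pi.single p.1.1 1) (Pi.single p.1.2 1) = Pi.single p (1 : ℝ) := by
  obtain ⟨⟨i, j⟩, hij⟩ := p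
  ext ⟨⟨k, l⟩, hkl⟩
  simp only [pl, Pi.single_apply, Subtype.mk.injEq, Prod.mk.injEq]
  simp only at hij hkl
  by_cases h1 : k = i <;> by_cases h2 : l = j <;> by_cases h3 : l = i <;> by_cases h4 : k = j <;>
    simp [h1, h2, h3, h4] <;> omega

theorem indep_iff_gram {m k : Type} [Fintype m] [DecidableEq m] [Fintype k] (A : Matrix m k ℝ) :
    LinearIndependent ℝ A ↔ (A * A.transpose).det ≠ 0 := by
  have h1 : LinearIndependent ℝ A ↔ Fintype.card m = A.rank := by
    rw [Matrix.rank_eq_finrank_span_row]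
    exact linearIndependent_iff_card_eq_finrank_span
  have h2 : LinearIndependent ℝ (A * A.transpose) ↔ Fintype.card m = (A * A.transpose).rank := by
    rw [Matrix.rank_eq_finrank_span_row]
    exact linearIndependent_iff_card_eq_finrank_span
  rw [h1, ← Matrix.rank_self_mul_transpose, ← h2, ← isUnit_iff_ne_zero,
    ← Matrix.isUnit_iff_isUnit_det]
  exact Matrix.linearIndependent_rows_iff_isUnit

noncomputable def polyMat (n : ℕ) (ends : E → V × V) (F : Finset E) :
    Matrix {x // x ∈ F} (V × PI n) (MvPolynomial (E × Fin n × Bool) ℝ) :=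
  fun e p => MvPolynomial.C (inc ends e.1 p.1) *
    (MvPolynomial.X (e.1, p.2.1.1, true) * MvPolynomial.X (e.1, p.2.1.2, false) -
     MvPolynomial.X (e.1, p.2.1.2, true) * MvPolynomial.X (e.1, p.2.1.1, false))

theorem indep_iff_poly (n : ℕ) (ends : E → V × V) (F : Finset E) (z : E × Fin n × Bool → ℝ) :
    LinearIndependent ℝ (fun e : {x // x ∈ F} => wvec ends e.1
      (pl (fun i => z (e.1, i, true)) (fun i => z (e.1, i, false)))) ↔
    MvPolynomial.eval z ((polyMat n ends F) * (polyMat n ends F).transpose).det ≠ 0 := by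
  rw [RingHom.map_det, RingHom.mapMatrix_apply, Matrix.map_mul, Matrix.transpose_map]
  rw [← indep_iff_gram]
  have : (polyMat n ends F).map (MvPolynomial.eval z) = (fun e : {x // x ∈ F} => wvec ends e.1
      (pl (fun i => z (e.1, i, true)) (fun i => z (e.1, i, false)))) := by
    ext e p
    simp [polyMat, wvec, pl]
  rw [this]

theorem generic (n : ℕ) (ends : E → V × V) :
    ∃ a b : E → Fin n → ℝ, ∀ F : Finset E,
      (∀ F' ⊆ F, F'.Nonempty →
        (F'.card : ℤ) ≤ (Fintype.card (PI n) : ℤ) * ((VF ends F').card - 1)) →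
      LinearIndependent ℝ (fun e : {x // x ∈ F} => wvec ends e.1 (pl (a e.1) (b e.1))) := by
  classical
  let good : Finset (Finset E) := Finset.univ.filter (fun F => ∀ F' ⊆ F, F'.Nonempty →
        (F'.card : ℤ) ≤ (Fintype.card (PI n) : ℤ) * ((VF ends F').card - 1))
  let P : MvPolynomial (E × Fin n × Bool) ℝ :=
    ∏ F ∈ good, ((polyMat n ends F) * (polyMat n ends F).transpose).det
  have hP : P ≠ 0 := by
    rw [Finset.prod_ne_zero_iff]
    intro F hF h0
    obtain ⟨c, hc⟩ := exists_choice (I := PI n) ends F (Finset.mem_filter.1 hF).2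
    let z : E × Fin n × Bool → ℝ := fun t => if h : t.1 ∈ F then
      (if t.2.2 then (Pi.single (c ⟨t.1, h⟩).1.1 1 : Fin n → ℝ) t.2.1
        else (Pi.single (c ⟨t.1, h⟩).1.2 1 : Fin n → ℝ) t.2.1) else 0
    have := (indep_iff_poly n ends F z).1 (by
      convert hc using 3 with e
      rw [← pl_single]
      simp [z])
    rw [h0] at this
    simp at this
  have : ∃ z, MvPolynomial.eval z P ≠ 0 := by
    by_contra hh
    push Not at hh
    exact hP (MvPolynomial.funext (by simpa using hh))
  obtain ⟨z, hz⟩ := this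
  refine ⟨fun e i => z (e, i, true), fun e i => z (e, i, false), ?_⟩
  intro F hF
  rw [indep_iff_poly]
  rw [map_prod, Finset.prod_ne_zero_iff] at hz
  exact hz F (Finset.mem_filter.2 ⟨Finset.mem_univ _, hF⟩)

noncomputable def plFun (d : ℕ) (p : PI (d + 1)) : ExtAlg d →ₗ[ℝ] ℝ :=
  liftAlternating (R := ℝ) (M := Wd d) (N := ℝ) (fun i => if h : i = 2 then
    h ▸ ((Matrix.detRowAlternating (n := Fin 2) (R := ℝ)).compLinearMap
      (LinearMap.funLeft ℝ ℝ ![p.1.1, p.1.2])) else 0)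

theorem plFun_apply (d : ℕ) (p : PI (d + 1)) (a b : Wd d) :
    plFun d p (ι ℝ a * ι ℝ b) = pl a b p := by
  have h : ι ℝ a * ι ℝ b = ιMulti ℝ 2 ![a, b] := by
    simp [ιMulti_apply]
  rw [h, plFun, liftAlternating_apply_ιMulti]
  simp only [dite_true]
  change Matrix.det (Matrix.of (fun i => LinearMap.funLeft ℝ ℝ ![p.1.1, p.1.2] (![a, b] i))) = _
  rw [Matrix.det_fin_two]
  simp [pl, LinearMap.funLeft_apply]

noncomputable def Smap (V : Type) (d : ℕ) : (V → ExtAlg d) →ₗ[ℝ] (V × PI (d + 1) → ℝ) :=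
  LinearMap.pi (fun p => (plFun d p.2).comp (LinearMap.proj p.1))

noncomputable def Tmap (V : Type) (d : ℕ) : (V × PI (d + 1) → ℝ) →ₗ[ℝ] (V → ExtAlg d) :=
  LinearMap.pi (fun v => ∑ p : PI (d + 1),
    (LinearMap.toSpanSingleton ℝ (ExtAlg d) (ι ℝ (Pi.single p.1.1 1) * ι ℝ (Pi.single p.1.2 1))).comp
      (LinearMap.proj (v, p)))

theorem sum_split {n : ℕ} {M : Type} [AddCommGroup M] (f : Fin n → Fin n → M)
    (h : ∀ i, f i i = 0) :
    ∑ i, ∑ j, f i j = ∑ p : PI n, (f p.1.1 p.1.2 + f p.1.2 p.1.1) := by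
  have e1 : ∀ g : Fin n → Fin n → M, ∑ p : PI n, g p.1.1 p.1.2 =
      ∑ i, ∑ j, if i < j then g i j else 0 := by
    intro g
    rw [← Fintype.sum_prod_type' (fun i j => if i < j then g i j else 0)]
    rw [← Finset.sum_filter]
    exact (Finset.sum_subtype _ (by simp) (fun p : Fin n × Fin n => g p.1 p.2)).symm
  rw [Finset.sum_add_distrib, e1 f, e1 (fun i j => f j i),
    Finset.sum_comm (f := fun i j => if i < j then f j i else 0)]
  rw [← Finset.sum_add_distrib]
  apply Finset.sum_congr rfl
  intro i _
  rw [← Finset.sum_add_distrib]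
  apply Finset.sum_congr rfl
  intro j _
  rcases lt_trichotomy i j with hij | hij | hij
  · simp [hij, hij.le, not_lt.2 hij.le]
  · subst hij; simp [h]
  · simp [hij, not_lt.2 hij.le]

theorem wedge_expand (d : ℕ) (a b : Wd d) : ι ℝ a * ι ℝ b = ∑ p : PI (d + 1),
    pl a b p • (ι ℝ (Pi.single p.1.1 1 : Wd d) * ι ℝ (Pi.single p.1.2 1 : Wd d)) := by
  have hx : ∀ a : Wd d, ι ℝ a = ∑ i, a i • ι ℝ (Pi.single i 1 : Wd d) := by
    intro a
    conv_lhs => rw [pi_eq_sum_univ' a]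
    rw [map_sum]
    apply Finset.sum_congr rfl
    intro i _
    rw [map_smul]
  conv_lhs => rw [hx a, hx b, Finset.sum_mul_sum]
  rw [sum_split]
  · apply Finset.sum_congr rfl
    intro p _
    have := eq_neg_of_add_eq_zero_right
      (ι_add_mul_swap (R := ℝ) (Pi.single p.1.1 1 : Wd d) (Pi.single p.1.2 1))
    rw [smul_mul_smul_comm, smul_mul_smul_comm, this, pl, sub_smul, smul_neg, sub_eq_add_neg]
  · intro i
    rw [smul_mul_smul_comm, ι_sq_zero, smul_zero]

theorem Smap_apply (d : ℕ) (ends : E → V × V) (e : E) (a b : Wd d) :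
    Smap V d (Pi.single (ends e).1 (ι ℝ a * ι ℝ b) - Pi.single (ends e).2 (ι ℝ a * ι ℝ b)) =
      wvec ends e (pl a b) := by
  ext ⟨v, p⟩
  have h : ∀ u : V, plFun d p ((Pi.single u (ι ℝ a * ι ℝ b) : V → ExtAlg d) v) =
      (if v = u then 1 else 0) * pl a b p := by
    intro u
    rw [Pi.single_apply]
    split_ifs
    · rw [plFun_apply, one_mul]
    · simp
  change plFun d p ((Pi.single (ends e).1 (ι ℝ a * ι ℝ b) : V → ExtAlg d) v -
    (Pi.single (ends e).2 (ι ℝ a * ι ℝ b) : V → ExtAlg d) v) = inc ends e v * pl a b p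
  rw [map_sub, h, h, inc, sub_mul]

theorem Tmap_apply (d : ℕ) (ends : E → V × V) (e : E) (a b : Wd d) :
    Tmap V d (wvec ends e (pl a b)) =
      Pi.single (ends e).1 (ι ℝ a * ι ℝ b) - Pi.single (ends e).2 (ι ℝ a * ι ℝ b) := by
  funext v
  have h : Tmap V d (wvec ends e (pl a b)) v = inc ends e v • (ι ℝ a * ι ℝ b) := by
    rw [wedge_expand d a b, Finset.smul_sum]
    simp [Tmap, wvec, LinearMap.sum_apply, mul_smul]
  rw [h, inc, sub_smul, Pi.sub_apply, Pi.single_apply, Pi.single_apply]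
  simp only [ite_smul, one_smul, zero_smul]

theorem indep_iff_w (d : ℕ) (ends : E → V × V) (a b : E → Wd d) (F : Finset E) :
    LinearIndependent ℝ
          (fun e : {x // x ∈ F} =>
            (Pi.single (ends e.1).1 (ι ℝ (a e.1) * ι ℝ (b e.1))
              - Pi.single (ends e.1).2 (ι ℝ (a e.1) * ι ℝ (b e.1)) : V → ExtAlg d)) ↔
    LinearIndependent ℝ (fun e : {x // x ∈ F} => wvec ends e.1 (pl (a e.1) (b e.1))) := by
  constructor
  · intro h
    refine LinearIndependent.of_comp (Tmap V d) ?_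
    convert h using 2 with e
    exact Tmap_apply d ends e.1 _ _
  · intro h
    refine LinearIndependent.of_comp (Smap V d) ?_
    convert h using 2 with e
    exact Smap_apply d ends e.1 _ _
end Generic

theorem statement_6
    (d : ℕ) (hd : 2 ≤ d) (D : ℕ) (hD : D = (d + 1).choose 2)
    (V E : Type) [Fintype V] [Fintype E] [DecidableEq V] [DecidableEq E]
    (ends : E → V × V) (hloop : ∀ e : E, (ends e).1 ≠ (ends e).2) :
    ∃ a b : E → Wd d,
      ∀ F : Finset E,
        LinearIndependent ℝ
          (fun e : {x // x ∈ F} =>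
            (Pi.single (ends e.1).1 (ι ℝ (a e.1) * ι ℝ (b e.1))
              - Pi.single (ends e.1).2 (ι ℝ (a e.1) * ι ℝ (b e.1)) : V → ExtAlg d)) ↔
        ∀ F' ⊆ F, F'.Nonempty →
          (F'.card : ℤ) ≤ D * ((VF ends F').card - 1) := by
  obtain ⟨a, b, hab⟩ := generic (d + 1) ends
  refine ⟨a, b, fun F => ?_⟩
  rw [hD, ← card_PI, indep_iff_w]
  refine ⟨fun h F' hF' hne => ?_, hab F⟩
  exact necessity ends (fun e => pl (a e) (b e)) F'
    (h.comp (fun e : {x // x ∈ F'} => (⟨e.1, hF' e.2⟩ : {x // x ∈ F}))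
      (fun x y hxy => Subtype.ext (congrArg (fun t => t.1) hxy))) hne
end

section
/- Let d≥2 be an integer and G=(V,E) a finite multigraph. Then there exists an injective map p:V→ℝ^d such that for every nonempty F⊆E, the dimension of the subspace Σ_{e∈F} A_e(p) of the space of functions V→ℝ^d equals the minimum of Σ_{i=1}^k (d·|V(F_i)| − (d+1)) over all partitions {F_1,…,F_k} of F into nonempty parts. (Existential form of: for almost all joint-configurations, the direction-rigidity polymatroid equals the polymatroid induced by f'(F)=d|V(F)|−(d+1).) -/
/- STATEMENT 7: for a suitable (generic) joint-configuration `p`, the direction-rigidity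
polymatroid of the flats `A_e(p)` equals the polymatroid induced by
`f'(F) = d·|V(F)| - (d+1)`. -/

set_option synthInstance.maxHeartbeats 1000000
set_option maxHeartbeats 1000000

/-- `P` is a partition of `F` into nonempty parts. -/
def IsPartitionOf {E : Type} [DecidableEq E] (F : Finset E) (P : Finset (Finset E)) : Prop :=
  (∀ p ∈ P, p.Nonempty) ∧ (P : Set (Finset E)).PairwiseDisjoint id ∧ P.biUnion id = F

/-- The flat `A_e(p) = {δ_u·α − δ_v·α : α ∈ ℝ^d, ⟨p(u) - p(v), α⟩ = 0}` inside the space of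
functions `V → ℝ^d`; the orthogonality constraint is expressed via the orthogonal
complement of the line spanned by `p(u) - p(v)`. -/
noncomputable def dirFlat {V E : Type} [DecidableEq V] (d : ℕ) (ends : E → V × V)
    (p : V → EuclideanSpace ℝ (Fin d)) (e : E) :
    Submodule ℝ (V → EuclideanSpace ℝ (Fin d)) :=
  ((Submodule.span ℝ {p (ends e).1 - p (ends e).2})ᗮ).map
    (LinearMap.single ℝ (fun _ : V => EuclideanSpace ℝ (Fin d)) (ends e).1
      - LinearMap.single ℝ (fun _ : V => EuclideanSpace ℝ (Fin d)) (ends e).2)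

open Topology Filter

noncomputable def lovB {E W : Type*} [NormedAddCommGroup W] [NormedSpace ℝ W]
    (A : E → Submodule ℝ W) (h : W →ₗ[ℝ] ℝ) (F : Finset E) : Submodule ℝ W :=
  ⨆ e ∈ F, A e ⊓ LinearMap.ker h

theorem lovB_mem_of {E W : Type*} [NormedAddCommGroup W] [NormedSpace ℝ W]
    {A : E → Submodule ℝ W} {h : W →ₗ[ℝ] ℝ} {F : Finset E} {e : E} (he : e ∈ F) {x : W}
    (hx : x ∈ A e) (hx' : h x = 0) : x ∈ lovB A h F :=
  (le_iSup₂_of_le (f := fun e (_ : e ∈ F) => A e ⊓ LinearMap.ker h) e he le_rfl) ⟨hx, hx'⟩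

theorem lovB_curve_one {E W : Type*} [NormedAddCommGroup W] [NormedSpace ℝ W]
    {A : E → Submodule ℝ W} {h : W →ₗ[ℝ] ℝ} {F : Finset E} {a : E → W}
    (ha : ∀ e, a e ∈ A e) (ha1 : ∀ e, h (a e) = 1) (φ : W →ₗ[ℝ] ℝ) (b : E → W)
    (hb : ∀ e ∈ F, b e ∈ A e ⊓ LinearMap.ker h) (t : ℝ) :
    ∑ e ∈ F, b e + t • ∑ e ∈ F, (φ (a e) • b e - φ (b e) • a e) ∈ lovB A (h + t • φ) F := by
  rw [Finset.smul_sum, ← Finset.sum_add_distrib]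
  refine Submodule.sum_mem _ fun e he => ?_
  obtain ⟨h1, h2⟩ := hb e he
  have h2' : h (b e) = 0 := h2
  refine lovB_mem_of he ?_ ?_
  · exact add_mem h1 (Submodule.smul_mem _ _ (sub_mem (Submodule.smul_mem _ _ h1)
      (Submodule.smul_mem _ _ (ha e))))
  · simp [h2', ha1]; ring

theorem lovB_curve {E W : Type*} [NormedAddCommGroup W] [NormedSpace ℝ W]
    {A : E → Submodule ℝ W} {h : W →ₗ[ℝ] ℝ} {F : Finset E} {a : E → W}
    (ha : ∀ e, a e ∈ A e) (ha1 : ∀ e, h (a e) = 1) (φ : W →ₗ[ℝ] ℝ) (x : W)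
    (hx : x ∈ lovB A h F) :
    ∃ w : W, ∀ t : ℝ, x + t • w ∈ lovB A (h + t • φ) F := by
  obtain ⟨μ, hμ⟩ := (Submodule.mem_iSup_finset_iff_exists_sum _ _).1 hx
  refine ⟨∑ e ∈ F, (φ (a e) • (μ e : W) - φ (μ e : W) • a e), fun t => ?_⟩
  rw [← hμ]
  exact lovB_curve_one ha ha1 φ (fun e => (μ e : W)) (fun e _ => (μ e).2) t

theorem lov_semicont {W ι : Type*} [NormedAddCommGroup W] [NormedSpace ℝ W]
    [FiniteDimensional ℝ W] [Fintype ι] (y w : ι → W) (hy : LinearIndependent ℝ y)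
    (S : ℝ → Submodule ℝ W) (hS : ∀ t : ℝ, t ≠ 0 → ∀ i, y i + t • w i ∈ S t) :
    ∀ᶠ t in 𝓝[≠] (0 : ℝ), Fintype.card ι ≤ Module.finrank ℝ (S t) := by
  have h1 := LinearIndependent.eventually hy
  have hc : Tendsto (fun t : ℝ => fun i => y i + t • w i) (𝓝 0) (𝓝 y) := by
    have : Continuous (fun t : ℝ => fun i => y i + t • w i) := by fun_prop
    simpa using this.tendsto 0
  have h2 := (hc.mono_left (nhdsWithin_le_nhds (s := {0}ᶜ))).eventually h1
  filter_upwards [h2, self_mem_nhdsWithin] with t ht ht0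
  have : LinearIndependent ℝ (fun i => (⟨y i + t • w i, hS t ht0 i⟩ : S t)) := by
    apply LinearIndependent.of_comp (S t).subtype
    exact ht
  exact this.fintype_card_le_finrank

theorem lov_generic {E W : Type*} [Fintype E] [DecidableEq E]
    [NormedAddCommGroup W] [NormedSpace ℝ W] [FiniteDimensional ℝ W]
    (A : E → Submodule ℝ W) (U : Set (W →ₗ[ℝ] ℝ)) (hne : U.Nonempty)
    (hU : ∀ h ∈ U, ∀ φ : W →ₗ[ℝ] ℝ, ∀ᶠ t : ℝ in 𝓝 0, h + t • φ ∈ U) :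
    ∃ h ∈ U, ∀ (F : Finset E) (a : E → W), (∀ e, a e ∈ A e) → (∀ e, h (a e) = 1) →
      ∀ (φ : W →ₗ[ℝ] ℝ) (b : E → W), (∀ e ∈ F, b e ∈ A e ⊓ LinearMap.ker h) →
        ∑ e ∈ F, b e = 0 → ∑ e ∈ F, φ (b e) • a e ∈ lovB A h F := by
  obtain ⟨h, hhU, hmax⟩ : ∃ h ∈ U, ∀ h' ∈ U, ∑ F : Finset E, Module.finrank ℝ (lovB A h' F)
      ≤ ∑ F : Finset E, Module.finrank ℝ (lovB A h F) := by
    let N : (W →ₗ[ℝ] ℝ) → ℕ := fun h => ∑ F : Finset E, Module.finrank ℝ (lovB A h F)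
    have hbd : BddAbove (N '' U) := by
      refine ⟨∑ F : Finset E, Module.finrank ℝ W, ?_⟩
      rintro _ ⟨h, -, rfl⟩
      exact Finset.sum_le_sum fun F _ => Submodule.finrank_le _
    obtain ⟨h, hh, hN⟩ := Nat.sSup_mem (hne.image N) hbd
    refine ⟨h, hh, fun h' hh' => ?_⟩
    change N h' ≤ N h
    rw [hN]
    exact le_csSup hbd ⟨h', hh', rfl⟩
  refine ⟨h, hhU, fun F a ha ha1 φ b hb hb0 => ?_⟩
  by_contra hcon
  have hw : ∑ e ∈ F, (φ (a e) • b e - φ (b e) • a e) ∉ lovB A h F := by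
    intro hw
    apply hcon
    have : ∑ e ∈ F, φ (a e) • b e ∈ lovB A h F :=
      Submodule.sum_mem _ fun e he => Submodule.smul_mem _ _ (lovB_mem_of he (hb e he).1 (hb e he).2)
    have h3 := sub_mem this hw
    rw [Finset.sum_sub_distrib] at h3
    simpa using h3
  set w := ∑ e ∈ F, (φ (a e) • b e - φ (b e) • a e) with hwdef
  have hwt : ∀ t : ℝ, t ≠ 0 → w ∈ lovB A (h + t • φ) F := by
    intro t ht
    have := lovB_curve_one ha ha1 φ b hb t
    rw [hb0, zero_add] at this
    exact (Submodule.smul_mem_iff _ ht).1 this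
  have hall : ∀ F' : Finset E, ∀ᶠ t in 𝓝[≠] (0 : ℝ),
      Module.finrank ℝ (lovB A h F') ≤ Module.finrank ℝ (lovB A (h + t • φ) F') := by
    intro F'
    let B := Module.finBasis ℝ (lovB A h F')
    choose y hy using fun i => lovB_curve ha ha1 φ (B i : W) (B i).2
    have := lov_semicont (fun i => (B i : W)) y
      (B.linearIndependent.map' (Submodule.subtype _) (Submodule.ker_subtype _))
      (fun t => lovB A (h + t • φ) F') (fun t _ i => hy i t)
    simpa using this
  have hF : ∀ᶠ t in 𝓝[≠] (0 : ℝ),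
      Module.finrank ℝ (lovB A h F) + 1 ≤ Module.finrank ℝ (lovB A (h + t • φ) F) := by
    let B := Module.finBasis ℝ (lovB A h F)
    choose y hy using fun i => lovB_curve ha ha1 φ (B i : W) (B i).2
    have hli := B.linearIndependent.map' (Submodule.subtype _) (Submodule.ker_subtype _)
    have := lov_semicont (fun o : Option (Fin _) => o.elim w (fun i => (B i : W)))
      (fun o => o.elim 0 y)
      (by
        refine linearIndependent_option.2 ⟨hli, ?_⟩
        intro hmem
        apply hw
        refine (Submodule.span_le.2 ?_) hmem
        rintro _ ⟨i, rfl⟩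
        exact (B i).2)
      (fun t => lovB A (h + t • φ) F) (by
        rintro t ht (_ | i)
        · simpa using hwt t ht
        · exact hy i t)
    simpa using this
  obtain ⟨t, ht1, ht2, ht3⟩ := ((eventually_all.2 hall).and
    (hF.and ((hU h hhU φ).filter_mono nhdsWithin_le_nhds))).exists
  have := hmax _ ht3
  have hlt : ∑ F : Finset E, Module.finrank ℝ (lovB A h F)
      < ∑ F : Finset E, Module.finrank ℝ (lovB A (h + t • φ) F) :=
    Finset.sum_lt_sum (fun F' _ => ht1 F') ⟨F, Finset.mem_univ _, ht2⟩
  omega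

open Classical in
theorem lov_sum_zero {E W : Type*} [Fintype E] [DecidableEq E]
    [NormedAddCommGroup W] [NormedSpace ℝ W]
    (K : E → Submodule ℝ W) (a : E → W) (B : Submodule ℝ W) (F G : Finset E)
    (hG : ∀ e ∈ F, ∀ e' ∈ F, e ∈ G → e' ∉ G → a e - a e' ∉ B)
    (hFO : ∀ (φ : W →ₗ[ℝ] ℝ) (b : E → W), (∀ e ∈ F, b e ∈ K e) →
        ∑ e ∈ F, b e = 0 → ∑ e ∈ F, φ (b e) • a e ∈ B) :
    ∀ (n : ℕ) (b : E → W), (F.filter (fun e => b e ≠ 0)).card = n → (∀ e ∈ F, b e ∈ K e) →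
      ∑ e ∈ F, b e = 0 → ∑ e ∈ F, (if e ∈ G then b e else 0) = 0 := by
  intro n
  induction n using Nat.strong_induction_on with
  | _ n ih =>
  intro b hn hb hb0
  by_cases hsplit : ∃ μ : E → ℝ, ∑ e ∈ F, μ e • b e = 0 ∧ ∃ e ∈ F, ∃ e' ∈ F,
      b e ≠ 0 ∧ b e' ≠ 0 ∧ μ e ≠ μ e'
  · obtain ⟨μ, hμ, e, he, e', he', hbe, hbe', hne⟩ := hsplit
    have key : ∀ x ∈ F, b x ≠ 0 → ∑ e ∈ F, (if e ∈ G then (μ e - μ x) • b e else 0) = 0 := by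
      intro x hx hbx
      refine ih _ ?_ (fun e => (μ e - μ x) • b e) rfl
        (fun e he => Submodule.smul_mem _ _ (hb e he)) ?_
      · rw [← hn]
        apply Finset.card_lt_card
        refine ⟨fun y hy => ?_, fun hsub => ?_⟩
        · simp only [Finset.mem_filter] at hy ⊢
          exact ⟨hy.1, fun h0 => hy.2 (by rw [h0, smul_zero])⟩
        · have := hsub (Finset.mem_filter.2 ⟨hx, hbx⟩)
          simp at this
      · simp only [sub_smul, Finset.sum_sub_distrib, ← Finset.smul_sum]
        rw [hμ, hb0]; simp
    have h1 := key e he hbe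
    have h2 := key e' he' hbe'
    have h3 : (μ e - μ e') • ∑ x ∈ F, (if x ∈ G then b x else 0) = 0 := by
      have h4 : ∑ x ∈ F, (if x ∈ G then (μ x - μ e') • b x else 0)
          - ∑ x ∈ F, (if x ∈ G then (μ x - μ e) • b x else 0) = 0 := by rw [h1, h2, sub_zero]
      refine Eq.trans ?_ h4
      rw [← Finset.sum_sub_distrib, Finset.smul_sum]
      refine Finset.sum_congr rfl fun x _ => ?_
      split_ifs
      · rw [← sub_smul]; congr 1; ring
      · simp
    exact (smul_eq_zero.1 h3).resolve_left (sub_ne_zero.2 hne)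
  · push Not at hsplit
    by_cases hex : ∃ e ∈ F, ∃ e' ∈ F, b e ≠ 0 ∧ b e' ≠ 0 ∧ e ∈ G ∧ e' ∉ G
    · exfalso
      obtain ⟨e, he, e', he', hbe, hbe', heG, heG'⟩ := hex
      let T : (E → ℝ) →ₗ[ℝ] W := Fintype.linearCombination ℝ (fun x => if x ∈ F then b x else 0)
      have hT : ∀ μ, T μ = ∑ x ∈ F, μ x • b x := by
        intro μ
        simp [T, Fintype.linearCombination_apply]
      let ℓ : (E → ℝ) →ₗ[ℝ] ℝ :=
        (LinearMap.proj e : (E → ℝ) →ₗ[ℝ] ℝ) - (LinearMap.proj e' : (E → ℝ) →ₗ[ℝ] ℝ)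
      have hℓ : ℓ ∈ LinearMap.range T.dualMap := by
        rw [LinearMap.range_dualMap_eq_dualAnnihilator_ker, Submodule.mem_dualAnnihilator]
        intro μ hμ
        have : T μ = 0 := hμ
        rw [hT] at this
        have := hsplit μ this e he e' he' hbe hbe'
        simp [ℓ, this]
      obtain ⟨φ, hφ⟩ := hℓ
      have hφb : ∀ x ∈ F, φ (b x) = (if x = e then 1 else 0) - (if x = e' then 1 else 0) := by
        intro x hx
        have h1 : φ (T (Pi.single x 1)) = ℓ (Pi.single x 1) := by rw [← hφ]; rfl
        have h2 : T (Pi.single x 1) = b x := by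
          simp [T, hx]
        rw [h2] at h1
        rw [h1]
        simp [ℓ, Pi.single_apply, eq_comm]
      have := hFO φ b hb hb0
      apply hG e he e' he' heG heG'
      rw [Finset.sum_congr rfl (fun x hx => by rw [hφb x hx])] at this
      simpa [sub_smul, Finset.sum_sub_distrib, he, he'] using this
    · push Not at hex
      by_cases hex2 : ∃ e ∈ F, b e ≠ 0 ∧ e ∈ G
      · obtain ⟨e, he, hbe, heG⟩ := hex2
        refine Eq.trans (Finset.sum_congr rfl fun x hx => ?_) hb0
        split_ifs with hxG
        · rfl
        · by_contra h0
          exact hxG (hex e he x hx hbe (Ne.symm h0) heG)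
      · push Not at hex2
        refine Finset.sum_eq_zero fun x hx => ?_
        split_ifs with hxG
        · by_contra h0
          exact hex2 x hx h0 hxG
        · rfl

theorem lovB_mono {E W : Type*} [NormedAddCommGroup W] [NormedSpace ℝ W]
    {A : E → Submodule ℝ W} {h : W →ₗ[ℝ] ℝ} {F G : Finset E} (hG : G ⊆ F) :
    lovB A h G ≤ lovB A h F :=
  biSup_mono fun _ he => hG he

theorem lov_finrank_disjoint {W : Type*} [NormedAddCommGroup W] [NormedSpace ℝ W]
    [FiniteDimensional ℝ W] {S T R : Submodule ℝ W} (hST : Disjoint S T) (hS : S ≤ R)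
    (hT : T ≤ R) : Module.finrank ℝ S + Module.finrank ℝ T ≤ Module.finrank ℝ R := by
  have h1 := Submodule.finrank_sup_add_finrank_inf_eq S T
  rw [hST.eq_bot, finrank_bot] at h1
  have h2 := Submodule.finrank_mono (sup_le hS hT)
  omega

theorem lov_split {E W : Type*} [Fintype E] [DecidableEq E]
    [NormedAddCommGroup W] [NormedSpace ℝ W] [FiniteDimensional ℝ W]
    (A : E → Submodule ℝ W) (h : W →ₗ[ℝ] ℝ) (a : E → W)
    (ha : ∀ e, a e ∈ A e) (ha1 : ∀ e, h (a e) = 1) (F : Finset E) (hF : F.Nonempty)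
    (hFO : ∀ (φ : W →ₗ[ℝ] ℝ) (b : E → W), (∀ e ∈ F, b e ∈ A e ⊓ LinearMap.ker h) →
        ∑ e ∈ F, b e = 0 → ∑ e ∈ F, φ (b e) • a e ∈ lovB A h F) :
    (∃ G ⊂ F, G.Nonempty ∧ Disjoint (lovB A h G) (lovB A h (F \ G))) ∨
      Module.finrank ℝ ↥(⨆ e ∈ F, A e) ≤ Module.finrank ℝ (lovB A h F) + 1 := by
  classical
  obtain ⟨e0, he0⟩ := hF
  by_cases hall : ∀ e ∈ F, a e - a e0 ∈ lovB A h F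
  · right
    have hle : (⨆ e ∈ F, A e) ≤ lovB A h F ⊔ Submodule.span ℝ {a e0} := by
      refine iSup₂_le fun e he x hx => ?_
      have h1 : x - h x • a e ∈ lovB A h F :=
        lovB_mem_of he (sub_mem hx (Submodule.smul_mem _ _ (ha e))) (by simp [ha1])
      have h2 : h x • (a e - a e0) ∈ lovB A h F := Submodule.smul_mem _ _ (hall e he)
      refine Submodule.mem_sup.2 ⟨_, add_mem h1 h2, h x • a e0,
        Submodule.smul_mem _ _ (Submodule.mem_span_singleton_self _), ?_⟩
      rw [smul_sub]; abel
    have h0 : a e0 ≠ 0 := by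
      intro h0
      have := ha1 e0
      rw [h0, map_zero] at this
      exact zero_ne_one this
    have hsp : Module.finrank ℝ (Submodule.span ℝ {a e0}) ≤ 1 := (finrank_span_singleton h0).le
    calc _ ≤ _ := Submodule.finrank_mono hle
      _ ≤ _ := Submodule.finrank_add_le_finrank_add_finrank _ _
      _ ≤ _ := Nat.add_le_add_left hsp _
  · left
    push Not at hall
    obtain ⟨e1, he1, hne1⟩ := hall
    let G := F.filter (fun e => a e - a e0 ∈ lovB A h F)
    have hGF : G ⊆ F := Finset.filter_subset _ _
    refine ⟨G, ⟨hGF, fun hsub => ?_⟩, ⟨e0, ?_⟩, ?_⟩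
    · exact hne1 (Finset.mem_filter.1 (hsub he1)).2
    · simp [G, he0]
    · rw [Submodule.disjoint_def]
      intro x hx1 hx2
      obtain ⟨μ, hμ⟩ := (Submodule.mem_iSup_finset_iff_exists_sum _ _).1 hx1
      obtain ⟨ν, hν⟩ := (Submodule.mem_iSup_finset_iff_exists_sum _ _).1 hx2
      have key := lov_sum_zero (fun e => A e ⊓ LinearMap.ker h) a (lovB A h F) F G
        (by
          intro e he e' he' heG heG' hmem
          apply heG'
          refine Finset.mem_filter.2 ⟨he', ?_⟩
          have := sub_mem (Finset.mem_filter.1 heG).2 hmem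
          convert this using 1
          abel) hFO _ (fun e => if e ∈ G then (μ e : W) else -(ν e : W)) rfl
        (by
          intro e _
          split_ifs
          · exact (μ e).2
          · exact neg_mem (ν e).2)
        (by
          rw [← Finset.sum_sdiff hGF,
            Finset.sum_congr rfl (fun e he => if_pos he : ∀ e ∈ G, _ = (μ e : W)), hμ,
            Finset.sum_congr rfl (fun e he => if_neg (Finset.mem_sdiff.1 he).2 :
              ∀ e ∈ F \ G, _ = -(ν e : W)), Finset.sum_neg_distrib, hν]
          simp)
      rw [← hμ, ← key, ← Finset.sum_filter]
      have : F.filter (fun e => e ∈ G) = G := by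
        ext e; simp only [Finset.mem_filter]; exact ⟨fun h => h.2, fun h => ⟨hGF h, h⟩⟩
      rw [this]
      exact Finset.sum_congr rfl (fun e he => (if_pos he).symm)

theorem lov_part_union {E : Type} [DecidableEq E] {F G : Finset E} (hG : G ⊆ F)
    {P Q : Finset (Finset E)} (hP : IsPartitionOf G P) (hQ : IsPartitionOf (F \ G) Q) (c : Finset E → ℤ) :
    IsPartitionOf F (P ∪ Q) ∧ ∑ q ∈ P ∪ Q, c q = ∑ q ∈ P, c q + ∑ q ∈ Q, c q := by
  obtain ⟨p1, p2, p3⟩ := hP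
  obtain ⟨q1, q2, q3⟩ := hQ
  have hd : ∀ x ∈ P, ∀ y ∈ Q, Disjoint x y := by
    intro x hx y hy
    have h1 : x ⊆ G := by rw [← p3]; exact Finset.subset_biUnion_of_mem id hx
    have h2 : y ⊆ F \ G := by rw [← q3]; exact Finset.subset_biUnion_of_mem id hy
    exact Finset.disjoint_of_subset_left h1 (Finset.disjoint_of_subset_right h2
      Finset.disjoint_sdiff)
  refine ⟨⟨?_, ?_, ?_⟩, ?_⟩
  · intro x hx
    rcases Finset.mem_union.1 hx with h | h
    exacts [p1 x h, q1 x h]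
  · rw [Finset.coe_union, Set.pairwiseDisjoint_union]
    exact ⟨p2, q2, fun x hx y hy _ => hd x hx y hy⟩
  · rw [Finset.union_biUnion, p3, q3]; exact Finset.union_sdiff_of_subset hG
  · apply Finset.sum_union
    rw [Finset.disjoint_left]
    intro x hx hx'
    have := hd x hx x hx'
    rw [disjoint_self] at this
    exact (p1 x hx).ne_empty this

/-- functions supported on `T` -/
def suppS {V M : Type} [AddCommGroup M] [Module ℝ M] (T : Set V) : Submodule ℝ (V → M) where
  carrier := {x | ∀ v, v ∉ T → x v = 0}
  add_mem' := by
    intro a b ha hb v hv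
    simp [ha v hv, hb v hv]
  zero_mem' := by intro v _; rfl
  smul_mem' := by
    intro c x hx v hv
    simp [hx v hv]

theorem finrank_suppS {V : Type} [Fintype V] [DecidableEq V] (d : ℕ) (T : Finset V) :
    Module.finrank ℝ (suppS (T : Set V) : Submodule ℝ (V → EuclideanSpace ℝ (Fin d))) = d * T.card := by
  let f : (T → EuclideanSpace ℝ (Fin d)) →ₗ[ℝ] (V → EuclideanSpace ℝ (Fin d)) :=
    LinearMap.pi fun v => if hv : v ∈ T then LinearMap.proj (⟨v, hv⟩ : T) else 0
  have hf : ∀ x v (hv : v ∈ T), f x v = x ⟨v, hv⟩ := by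
    intro x v hv
    simp [f, hv]
  have hf' : ∀ x v (hv : v ∉ T), f x v = 0 := by
    intro x v hv
    simp [f, hv]
  have hinj : Function.Injective f := by
    intro x y hxy
    ext1 ⟨v, hv⟩
    rw [← hf x v hv, ← hf y v hv, hxy]
  have hr : LinearMap.range f = suppS (T : Set V) := by
    ext x
    constructor
    · rintro ⟨y, rfl⟩ v hv
      exact hf' y v hv
    · intro hx
      refine ⟨fun v => x v, ?_⟩
      ext1 v
      by_cases hv : v ∈ T
      · rw [hf _ v hv]
      · rw [hf' _ v hv, hx v hv]
  rw [← hr, LinearMap.finrank_range_of_inj hinj, Module.finrank_pi_fintype]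
  simp [mul_comm]

noncomputable def dD {V : Type} [DecidableEq V] (d : ℕ) (u v : V) :
    EuclideanSpace ℝ (Fin d) →ₗ[ℝ] (V → EuclideanSpace ℝ (Fin d)) :=
  LinearMap.single ℝ (fun _ : V => EuclideanSpace ℝ (Fin d)) u
      - LinearMap.single ℝ (fun _ : V => EuclideanSpace ℝ (Fin d)) v

theorem dD_apply {V : Type} [DecidableEq V] (d : ℕ) (u v : V) (α : EuclideanSpace ℝ (Fin d)) :
    dD d u v α = Pi.single u α - Pi.single v α := rfl

theorem mem_suppS_dD {V : Type} [DecidableEq V] {d : ℕ} {u v : V} {T : Set V} (hu : u ∈ T)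
    (hv : v ∈ T) (α : EuclideanSpace ℝ (Fin d)) : dD d u v α ∈ suppS T := by
  intro w hw
  have h1 : w ≠ u := fun h => hw (h ▸ hu)
  have h2 : w ≠ v := fun h => hw (h ▸ hv)
  simp [dD_apply, h1, h2]

theorem VF_left {V E : Type} [DecidableEq V] {ends : E → V × V} {F : Finset E} {e : E}
    (he : e ∈ F) : (ends e).1 ∈ VF ends F :=
  Finset.mem_union_left _ (Finset.mem_image_of_mem _ he)

theorem VF_right {V E : Type} [DecidableEq V] {ends : E → V × V} {F : Finset E} {e : E}
    (he : e ∈ F) : (ends e).2 ∈ VF ends F :=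
  Finset.mem_union_right _ (Finset.mem_image_of_mem _ he)

noncomputable def bigA {V E : Type} [DecidableEq V] (d : ℕ) (ends : E → V × V) (e : E) :
    Submodule ℝ (V → EuclideanSpace ℝ (Fin d)) :=
  LinearMap.range (dD d (ends e).1 (ends e).2)

theorem finrank_single {V : Type} [Fintype V] [DecidableEq V] (d : ℕ) (u : V) :
    Module.finrank ℝ (LinearMap.range
      (LinearMap.single ℝ (fun _ : V => EuclideanSpace ℝ (Fin d)) u)) = d := by
  rw [LinearMap.finrank_range_of_inj]
  · simp
  · exact Pi.single_injective (M := fun _ : V => EuclideanSpace ℝ (Fin d)) u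

theorem bigA_upper {V E : Type} [Fintype V] [DecidableEq V] (d : ℕ) (ends : E → V × V)
    (F : Finset E) (hF : F.Nonempty) :
    Module.finrank ℝ ↥(⨆ e ∈ F, bigA d ends e) + d ≤ d * (VF ends F).card := by
  obtain ⟨e0, he0⟩ := hF
  rw [← finrank_suppS]
  refine le_trans (Nat.add_le_add_left (finrank_single d (ends e0).1).ge _) ?_
  apply lov_finrank_disjoint
  · rw [Submodule.disjoint_def]
    rintro _ hx ⟨α, rfl⟩
    let s : (V → EuclideanSpace ℝ (Fin d)) →ₗ[ℝ] EuclideanSpace ℝ (Fin d) :=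
      ∑ v, LinearMap.proj v
    have hs : ∀ x, s x = ∑ v, x v := by intro x; simp [s]
    have hle : (⨆ e ∈ F, bigA d ends e) ≤ LinearMap.ker s := by
      refine iSup₂_le fun e _ => ?_
      rintro _ ⟨β, rfl⟩
      rw [LinearMap.mem_ker, hs]
      simp [dD_apply, Finset.sum_sub_distrib]
    have := hle hx
    rw [LinearMap.mem_ker, hs] at this
    have h2 : α = 0 := by simpa using this
    rw [h2, map_zero]
  · refine iSup₂_le fun e he => ?_
    rintro _ ⟨β, rfl⟩
    exact mem_suppS_dD (VF_left he) (VF_right he) β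
  · rintro _ ⟨α, rfl⟩ w hw
    have h1 : w ≠ (ends e0).1 := fun h => hw (h ▸ VF_left he0)
    simp [h1]

theorem bigA_split {V E : Type} [Fintype V] [DecidableEq V] [DecidableEq E] (d : ℕ)
    (ends : E → V × V) (F : Finset E) (hF : F.Nonempty) :
    (∃ G ⊂ F, G.Nonempty ∧ Disjoint (⨆ e ∈ G, bigA d ends e) (⨆ e ∈ F \ G, bigA d ends e)) ∨
    d * (VF ends F).card ≤ Module.finrank ℝ ↥(⨆ e ∈ F, bigA d ends e) + d := by
  classical
  obtain ⟨e0, he0⟩ := hF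
  set A := (⨆ e ∈ F, bigA d ends e) with hA
  let S : Set V := {v | ∀ α, dD d v (ends e0).1 α ∈ A}
  have hedge : ∀ e ∈ F, ∀ α, dD d (ends e).1 (ends e).2 α ∈ A := by
    intro e he α
    exact (le_iSup₂_of_le (f := fun e (_ : e ∈ F) => bigA d ends e) e he le_rfl) ⟨α, rfl⟩
  have hiff : ∀ e ∈ F, ((ends e).1 ∈ S ↔ (ends e).2 ∈ S) := by
    intro e he
    constructor
    · intro h α
      have := sub_mem (h α) (hedge e he α)
      simpa [dD_apply] using this
    · intro h α
      have := add_mem (h α) (hedge e he α)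
      convert this using 1
      simp only [dD_apply]; abel
  let G := F.filter (fun e => (ends e).1 ∈ S)
  by_cases hGF : G = F
  · right
    have hall : ∀ v ∈ VF ends F, v ∈ S := by
      intro v hv
      rcases Finset.mem_union.1 hv with h | h
      · obtain ⟨e, he, rfl⟩ := Finset.mem_image.1 h
        rw [← hGF] at he
        exact (Finset.mem_filter.1 he).2
      · obtain ⟨e, he, rfl⟩ := Finset.mem_image.1 h
        refine (hiff e he).1 ?_
        rw [← hGF] at he
        exact (Finset.mem_filter.1 he).2
    rw [← finrank_suppS]
    refine le_trans ?_ (Nat.add_le_add_left (finrank_single d (ends e0).1).le _)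
    refine le_trans (Submodule.finrank_mono ?_) (Submodule.finrank_add_le_finrank_add_finrank _ _)
    intro x hx
    have hx' : x = ∑ v ∈ VF ends F, Pi.single v (x v) := by
      ext1 w
      rw [Finset.sum_apply]
      simp only [Finset.sum_pi_single]
      split_ifs with hw
      · rfl
      · exact hx w hw
    rw [hx']
    refine Submodule.sum_mem _ fun v hv => ?_
    refine Submodule.mem_sup.2 ⟨_, hall v hv (x v), _, ⟨x v, rfl⟩, ?_⟩
    simp [dD_apply]
  · left
    refine ⟨G, ⟨Finset.filter_subset _ _, fun h => hGF (le_antisymm (Finset.filter_subset _ _) h)⟩,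
      ⟨e0, ?_⟩, ?_⟩
    · refine Finset.mem_filter.2 ⟨he0, fun α => ?_⟩
      simp [dD_apply]
    · have h1 : (⨆ e ∈ G, bigA d ends e) ≤ suppS S := by
        refine iSup₂_le fun e he => ?_
        rintro _ ⟨β, rfl⟩
        have := Finset.mem_filter.1 he
        exact mem_suppS_dD this.2 ((hiff e this.1).1 this.2) β
      have h2 : (⨆ e ∈ F \ G, bigA d ends e) ≤ suppS Sᶜ := by
        refine iSup₂_le fun e he => ?_
        rintro _ ⟨β, rfl⟩
        have := Finset.mem_sdiff.1 he
        have h3 : (ends e).1 ∉ S := fun h => this.2 (Finset.mem_filter.2 ⟨this.1, h⟩)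
        exact mem_suppS_dD (T := Sᶜ) h3 (fun h => h3 ((hiff e this.1).2 h)) β
      refine Disjoint.mono h1 h2 ?_
      rw [Submodule.disjoint_def]
      intro x hx1 hx2
      ext1 v
      by_cases hv : v ∈ S
      · exact hx2 v (fun h => h hv)
      · exact hx1 v hv

theorem lov_lower {V E : Type} [Fintype V] [Fintype E] [DecidableEq V] [DecidableEq E] (d : ℕ)
    (ends : E → V × V) (h : (V → EuclideanSpace ℝ (Fin d)) →ₗ[ℝ] ℝ)
    (a : E → (V → EuclideanSpace ℝ (Fin d)))
    (ha : ∀ e, a e ∈ bigA d ends e) (ha1 : ∀ e, h (a e) = 1)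
    (hFO : ∀ (F : Finset E) (φ : (V → EuclideanSpace ℝ (Fin d)) →ₗ[ℝ] ℝ)
      (b : E → (V → EuclideanSpace ℝ (Fin d))),
        (∀ e ∈ F, b e ∈ bigA d ends e ⊓ LinearMap.ker h) →
        ∑ e ∈ F, b e = 0 → ∑ e ∈ F, φ (b e) • a e ∈ lovB (bigA d ends) h F) :
    ∀ (n : ℕ) (F : Finset E), F.card = n → F.Nonempty →
      ∃ P : Finset (Finset E), IsPartitionOf F P ∧
        ∑ q ∈ P, ((d : ℤ) * (VF ends q).card - (d + 1)) ≤
          Module.finrank ℝ (lovB (bigA d ends) h F) := by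
  intro n
  induction n using Nat.strong_induction_on with
  | _ n ih =>
  intro F hn hF
  by_cases hs : ∃ G ⊂ F, G.Nonempty ∧
      Disjoint (lovB (bigA d ends) h G) (lovB (bigA d ends) h (F \ G))
  · obtain ⟨G, hG, hGne, hdis⟩ := hs
    obtain ⟨P, hP, hPc⟩ := ih _ (by rw [← hn]; exact Finset.card_lt_card hG) G rfl hGne
    obtain ⟨Q, hQ, hQc⟩ := ih _ (by
      rw [← hn]
      exact Finset.card_lt_card (Finset.sdiff_ssubset hG.1 hGne)) (F \ G) rfl
      (Finset.sdiff_nonempty.2 hG.2)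
    obtain ⟨h1, h2⟩ := lov_part_union hG.1 hP hQ (fun q => (d : ℤ) * (VF ends q).card - (d + 1))
    refine ⟨P ∪ Q, h1, ?_⟩
    have h3 := lov_finrank_disjoint hdis (lovB_mono hG.1) (lovB_mono Finset.sdiff_subset)
    rw [h2]
    zify at h3
    linarith
  · have h1 := (lov_split (bigA d ends) h a ha ha1 F hF (hFO F)).resolve_left hs
    have h2 := (bigA_split d ends F hF).resolve_left (by
      rintro ⟨G, hG, hGne, hdis⟩
      exact hs ⟨G, hG, hGne, hdis.mono (iSup₂_mono fun _ _ => inf_le_left)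
        (iSup₂_mono fun _ _ => inf_le_left)⟩)
    refine ⟨{F}, ⟨by simpa using hF, by simp, by simp⟩, ?_⟩
    rw [Finset.sum_singleton]
    zify at h1 h2
    linarith

theorem finrank_biSup_le {ι W : Type*} [DecidableEq ι] [NormedAddCommGroup W] [NormedSpace ℝ W]
    [FiniteDimensional ℝ W] (S : ι → Submodule ℝ W) (P : Finset ι) :
    Module.finrank ℝ ↥(⨆ q ∈ P, S q) ≤ ∑ q ∈ P, Module.finrank ℝ (S q) := by
  induction P using Finset.induction_on with
  | empty => simp
  | insert x P hx ih =>
    rw [Finset.iSup_insert, Finset.sum_insert hx]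
    exact (Submodule.finrank_add_le_finrank_add_finrank _ _).trans (Nat.add_le_add_left ih _)

theorem lov_upper {V E : Type} [Fintype V] [DecidableEq V] [DecidableEq E] (d : ℕ)
    (ends : E → V × V) (h : (V → EuclideanSpace ℝ (Fin d)) →ₗ[ℝ] ℝ)
    (a : E → (V → EuclideanSpace ℝ (Fin d)))
    (ha : ∀ e, a e ∈ bigA d ends e) (ha1 : ∀ e, h (a e) = 1) (F : Finset E)
    (P : Finset (Finset E)) (hP : IsPartitionOf F P) :
    (Module.finrank ℝ (lovB (bigA d ends) h F) : ℤ) ≤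
      ∑ q ∈ P, ((d : ℤ) * (VF ends q).card - (d + 1)) := by
  have h1 : lovB (bigA d ends) h F ≤ ⨆ q ∈ P, lovB (bigA d ends) h q := by
    refine iSup₂_le fun e he => ?_
    rw [← hP.2.2] at he
    obtain ⟨q, hq, heq⟩ := Finset.mem_biUnion.1 he
    refine le_trans ?_ (le_iSup₂_of_le q hq le_rfl)
    intro x hx
    exact lovB_mem_of heq hx.1 hx.2
  have h2 := (Submodule.finrank_mono h1).trans (finrank_biSup_le _ P)
  have h3 : (Module.finrank ℝ (lovB (bigA d ends) h F) : ℤ) ≤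
      ∑ q ∈ P, (Module.finrank ℝ (lovB (bigA d ends) h q) : ℤ) := by exact_mod_cast h2
  refine h3.trans (Finset.sum_le_sum fun q hq => ?_)
  have h4 := bigA_upper d ends q (hP.1 q hq)
  obtain ⟨e, he⟩ := hP.1 q hq
  have h5 : lovB (bigA d ends) h q < ⨆ e ∈ q, bigA d ends e := by
    refine lt_of_le_of_ne (iSup₂_mono fun _ _ => inf_le_left) fun heq => ?_
    have h6 : a e ∈ lovB (bigA d ends) h q := by
      rw [heq]
      exact (le_iSup₂_of_le (f := fun e (_ : e ∈ q) => bigA d ends e) e he le_rfl) (ha e)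
    have h7 : lovB (bigA d ends) h q ≤ LinearMap.ker h := iSup₂_le fun _ _ => inf_le_right
    have h8 : h (a e) = 0 := h7 h6
    rw [ha1] at h8
    exact one_ne_zero h8
  have h9 := Submodule.finrank_lt_finrank_of_lt h5
  zify at h4 h9
  linarith

theorem statement_7
    (d : ℕ) (hd : 2 ≤ d)
    (V E : Type) [Fintype V] [Fintype E] [DecidableEq V] [DecidableEq E]
    (ends : E → V × V) (hloop : ∀ e : E, (ends e).1 ≠ (ends e).2) :
    ∃ p : V → EuclideanSpace ℝ (Fin d),
      Function.Injective p ∧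
      ∀ F : Finset E, F.Nonempty →
        IsLeast
          {s : ℤ | ∃ P : Finset (Finset E), IsPartitionOf F P ∧
            s = ∑ q ∈ P, ((d : ℤ) * (VF ends q).card - (d + 1))}
          (Module.finrank ℝ ↥(⨆ e ∈ F, dirFlat d ends p e) : ℤ) := by
  let U : Set ((V → EuclideanSpace ℝ (Fin d)) →ₗ[ℝ] ℝ) :=
    {h | ∀ u v : V, u ≠ v → ∃ α, h (dD d u v α) ≠ 0}
  have hne : U.Nonempty := by
    let i0 : Fin d := ⟨0, by omega⟩
    let f : V → ℝ := fun v => ((Fintype.equivFin V v : ℕ) : ℝ)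
    have hf : Function.Injective f := by
      intro u v huv
      have : ((Fintype.equivFin V u : ℕ)) = (Fintype.equivFin V v : ℕ) := by
        simpa [f] using huv
      exact (Fintype.equivFin V).injective (Fin.ext this)
    let g : EuclideanSpace ℝ (Fin d) →ₗ[ℝ] ℝ := (EuclideanSpace.proj i0 : _ →L[ℝ] ℝ).toLinearMap
    refine ⟨∑ v, f v • (g ∘ₗ LinearMap.proj v), fun u v huv => ⟨EuclideanSpace.single i0 1, ?_⟩⟩
    have hg : g (EuclideanSpace.single i0 1) = 1 := by simp [g]
    have : ∀ w, (∑ v, f v • (g ∘ₗ LinearMap.proj v) :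
        (V → EuclideanSpace ℝ (Fin d)) →ₗ[ℝ] ℝ) (Pi.single w (EuclideanSpace.single i0 1)) = f w := by
      intro w
      simp only [LinearMap.sum_apply, LinearMap.smul_apply, LinearMap.comp_apply,
        LinearMap.proj_apply]
      rw [Finset.sum_eq_single w]
      · simp [hg]
      · intro b _ hb
        simp [hb]
      · simp
    rw [dD_apply, map_sub, this, this]
    exact sub_ne_zero.2 (hf.ne huv)
  have hU : ∀ h ∈ U, ∀ φ : (V → EuclideanSpace ℝ (Fin d)) →ₗ[ℝ] ℝ,
      ∀ᶠ t : ℝ in 𝓝 0, h + t • φ ∈ U := by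
    intro h hh φ
    refine eventually_all.2 fun u => eventually_all.2 fun v => ?_
    by_cases huv : u = v
    · exact Eventually.of_forall fun t hne => absurd huv hne
    · obtain ⟨α, hα⟩ := hh u v huv
      have hc : Continuous (fun t : ℝ => h (dD d u v α) + t * φ (dD d u v α)) := by fun_prop
      have := hc.continuousAt.eventually_ne (x := 0) (y := 0) (by simpa using hα)
      filter_upwards [this] with t ht _
      exact ⟨α, by simpa using ht⟩
  obtain ⟨h, hhU, hgen⟩ := lov_generic (bigA d ends) U hne hU
  have hex : ∀ e, ∃ a ∈ bigA d ends e, h a = 1 := by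
    intro e
    obtain ⟨α, hα⟩ := hhU _ _ (hloop e)
    refine ⟨(h (dD d (ends e).1 (ends e).2 α))⁻¹ • dD d (ends e).1 (ends e).2 α,
      Submodule.smul_mem _ _ ⟨α, rfl⟩, ?_⟩
    rw [map_smul, smul_eq_mul, inv_mul_cancel₀ hα]
  choose a ha ha1 using hex
  let p : V → EuclideanSpace ℝ (Fin d) := fun v =>
    (InnerProductSpace.toDual ℝ (EuclideanSpace ℝ (Fin d))).symm
      (LinearMap.toContinuousLinearMap
        (h ∘ₗ LinearMap.single ℝ (fun _ : V => EuclideanSpace ℝ (Fin d)) v))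
  have hp : ∀ v α, inner ℝ (p v) α = h (Pi.single v α) := by
    intro v α
    simp [p, InnerProductSpace.toDual_symm_apply]
  have hpD : ∀ u v α, inner ℝ (p u - p v) α = h (dD d u v α) := by
    intro u v α
    rw [inner_sub_left, hp, hp, dD_apply, map_sub]
  have hflat : ∀ e, dirFlat d ends p e = bigA d ends e ⊓ LinearMap.ker h := by
    intro e
    ext x
    constructor
    · rintro ⟨α, hα, rfl⟩
      refine ⟨⟨α, rfl⟩, ?_⟩
      have := Submodule.mem_orthogonal_singleton_iff_inner_right.1 hα
      rw [hpD] at this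
      exact this
    · rintro ⟨⟨α, rfl⟩, hx⟩
      refine ⟨α, ?_, rfl⟩
      apply Submodule.mem_orthogonal_singleton_iff_inner_right.2
      rw [hpD]
      exact hx
  refine ⟨p, ?_, fun F hF => ?_⟩
  · intro u v huv
    by_contra hne'
    obtain ⟨α, hα⟩ := hhU u v hne'
    apply hα
    rw [← hpD, huv, sub_self, inner_zero_left]
  · have hB : (⨆ e ∈ F, dirFlat d ends p e) = lovB (bigA d ends) h F := by
      unfold lovB
      simp only [hflat]
    rw [hB]
    constructor
    · obtain ⟨P, hP, hPc⟩ := lov_lower d ends h a ha ha1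
        (fun F φ b => hgen F a ha ha1 φ b) _ F rfl hF
      exact ⟨P, hP, le_antisymm (lov_upper d ends h a ha ha1 F P hP) hPc⟩
    · rintro s ⟨P, hP, rfl⟩
      exact lov_upper d ends h a ha ha1 F P hP
end

section
/- Let d≥2 be an integer and G=(V,E) a finite multigraph. Then there exists an injective map p:V→ℝ^d such that the following are equivalent: (1) the framework (G,p) is direction-rigid, i.e., the space of maps m:V→ℝ^d such that for every edge e with endpoints u,v there is t∈ℝ with m(u)−m(v) = t·(p(u)−p(v)), has dimension exactly d+1; (2) there exists c:E→{0,1,…,d−1} with Σ_{e∈E} c(e) = d|V| − (d+1) and Σ_{e∈F} c(e) ≤ d|V(F)| − (d+1) for every nonempty F⊆E. (Whiteley's characterization of generic direction-rigidity.) -/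
/- STATEMENT 8 (Whiteley): generic direction-rigidity of a bar-joint framework in ℝ^d is
characterized by the existence of a multiplicity function `c : E → {0,…,d-1}` (encoding a
subset of `(d-1)∘E`) with `Σ c(e) = d|V| - (d+1)` and `Σ_{e∈F} c(e) ≤ d|V(F)| - (d+1)` for
every nonempty `F ⊆ E`. -/

set_option synthInstance.maxHeartbeats 1000000
set_option maxHeartbeats 1000000

/-- The space of direction-constrained infinitesimal motions: maps `m : V → ℝ^d` such that
`m(u) - m(v)` is parallel to `p(u) - p(v)` for every edge. -/
noncomputable def dirMotionSpace {V E : Type} (d : ℕ) (ends : E → V × V)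
    (p : V → (Fin d → ℝ)) : Submodule ℝ (V → (Fin d → ℝ)) :=
  ⨅ e : E,
    (Submodule.span ℝ {p (ends e).1 - p (ends e).2}).comap
      ((LinearMap.proj (ends e).1 : (V → (Fin d → ℝ)) →ₗ[ℝ] (Fin d → ℝ))
        - LinearMap.proj (ends e).2)

section helpers
open Module

theorem rado_aux_s8 {W : Type} [AddCommGroup W] [Module ℝ W] [FiniteDimensional ℝ W]
    {I : Type} [Fintype I] [DecidableEq I] (n : ℕ) : ∀ (A : I → Submodule ℝ W),
    ∑ i, finrank ℝ (A i) = n → (∀ F : Finset I, F.card ≤ finrank ℝ ↥(F.sup A)) →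
    ∃ w : I → W, (∀ i, w i ∈ A i) ∧ LinearIndependent ℝ w := by
  induction n using Nat.strong_induction_on with
  | _ n ih =>
  intro A hn hA
  by_cases h1 : ∀ i, finrank ℝ (A i) ≤ 1
  · have h2 : ∀ i, ∃ w ∈ A i, A i ≤ Submodule.span ℝ {w} := by
      intro i
      obtain ⟨v, hv⟩ := finrank_le_one_iff.1 (h1 i)
      refine ⟨v, v.2, fun x hx => ?_⟩
      obtain ⟨c, hc⟩ := hv ⟨x, hx⟩
      rw [Submodule.mem_span_singleton]
      exact ⟨c, congrArg Subtype.val hc⟩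
    choose w hw hw2 using h2
    refine ⟨w, hw, ?_⟩
    rw [linearIndependent_iff_card_le_finrank_span]
    refine (hA Finset.univ).trans ?_
    refine Submodule.finrank_mono ?_
    refine Finset.sup_le fun i _ => (hw2 i).trans ?_
    exact Submodule.span_mono (by simp)
  · push Not at h1
    obtain ⟨j, hj⟩ := h1
    have hsplit : ∃ B B' : Submodule ℝ W, B < A j ∧ B' < A j ∧ B ⊔ B' = A j := by
      have : Nontrivial (A j) := Module.nontrivial_of_finrank_pos (R := ℝ) (by omega)
      obtain ⟨w, hw⟩ := exists_ne (0 : A j)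
      obtain ⟨C, hC⟩ := Submodule.exists_isCompl (Submodule.span ℝ {w})
      have hs : (Submodule.span ℝ {w}).map (A j).subtype ⊔ C.map (A j).subtype = A j := by
        rw [← Submodule.map_sup, hC.sup_eq_top, Submodule.map_top, Submodule.range_subtype]
      refine ⟨(Submodule.span ℝ {w}).map (A j).subtype, C.map (A j).subtype, ?_, ?_, hs⟩
      · refine lt_of_le_of_ne (Submodule.map_subtype_le _ _) fun h => ?_
        have h3 := congrArg (fun S : Submodule ℝ W => finrank ℝ S) h
        simp only [Submodule.finrank_map_subtype_eq] at h3
        have := finrank_span_singleton (K := ℝ) hw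
        omega
      · refine lt_of_le_of_ne (Submodule.map_subtype_le _ _) fun h => ?_
        have h3 := congrArg (fun S : Submodule ℝ W => finrank ℝ S) h
        simp only [Submodule.finrank_map_subtype_eq] at h3
        have h4 := Submodule.finrank_add_eq_of_isCompl hC
        have := finrank_span_singleton (K := ℝ) hw
        omega
    obtain ⟨B, B', hB, hB', hBB⟩ := hsplit
    have key : ∀ B : Submodule ℝ W, B < A j →
        (∃ w : I → W, (∀ i, w i ∈ A i) ∧ LinearIndependent ℝ w) ∨
        ∃ F : Finset I, j ∉ F ∧ finrank ℝ ↥(B ⊔ F.sup A) ≤ F.card := by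
      intro B hB
      by_cases hc : ∀ F : Finset I, F.card ≤ finrank ℝ ↥(F.sup (Function.update A j B))
      · left
        have hlt : ∑ i, finrank ℝ (Function.update A j B i) < n := by
          rw [← hn]
          refine Finset.sum_lt_sum (fun i _ => ?_) ⟨j, Finset.mem_univ _, ?_⟩
          · by_cases h : i = j
            · subst h; rw [Function.update_self]; exact Submodule.finrank_mono hB.le
            · rw [Function.update_of_ne h]
          · rw [Function.update_self]; exact Submodule.finrank_lt_finrank_of_lt hB
        obtain ⟨w, hw, hl⟩ := ih _ hlt _ rfl hc
        refine ⟨w, fun i => ?_, hl⟩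
        have := hw i
        by_cases h : i = j
        · subst h; exact hB.le (by simpa using this)
        · simpa [Function.update_of_ne h] using this
      · right
        push Not at hc
        obtain ⟨F, hF⟩ := hc
        have hsup : ∀ F : Finset I, j ∉ F → F.sup (Function.update A j B) = F.sup A := by
          intro F hF
          refine Finset.sup_congr rfl fun i hi => ?_
          rw [Function.update_of_ne]
          rintro rfl; exact hF hi
        by_cases hjF : j ∈ F
        · refine ⟨F.erase j, by simp, ?_⟩
          rw [← Finset.insert_erase hjF, Finset.sup_insert, hsup _ (by simp),
            Finset.card_insert_of_notMem (by simp), Function.update_self] at hF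
          omega
        · rw [hsup F hjF] at hF
          have := hA F
          omega
    rcases key B hB with h | ⟨F, hjF, hF⟩
    · exact h
    rcases key B' hB' with h | ⟨F', hjF', hF'⟩
    · exact h
    exfalso
    have e1 := Submodule.finrank_sup_add_finrank_inf_eq (B ⊔ F.sup A) (B' ⊔ F'.sup A)
    have e2 := hA (insert j (F ∪ F'))
    have e3 := hA (F ∩ F')
    have e4 : (insert j (F ∪ F')).sup A = (B ⊔ F.sup A) ⊔ (B' ⊔ F'.sup A) := by
      rw [Finset.sup_insert, Finset.sup_union, ← hBB]
      ac_rfl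
    have e5 : finrank ℝ ↥((F ∩ F').sup A) ≤
        finrank ℝ ↥((B ⊔ F.sup A) ⊓ (B' ⊔ F'.sup A)) := by
      refine Submodule.finrank_mono (le_inf ?_ ?_)
      · exact (Finset.sup_mono Finset.inter_subset_left).trans le_sup_right
      · exact (Finset.sup_mono Finset.inter_subset_right).trans le_sup_right
    rw [Finset.card_insert_of_notMem (by simp [hjF, hjF']), e4] at e2
    have := Finset.card_union_add_card_inter F F'
    omega

/-- the edge map -/
noncomputable def edgeMap {V : Type} [DecidableEq V] (d : ℕ) (u v : V) :
    (Fin d → ℝ) →ₗ[ℝ] (V → (Fin d → ℝ)) :=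
  LinearMap.single ℝ (fun _ : V => (Fin d → ℝ)) u - LinearMap.single ℝ (fun _ : V => (Fin d → ℝ)) v

theorem hall_cond {V I : Type} [Fintype V] [DecidableEq V] [DecidableEq I] (d : ℕ)
    (a b : I → V)
    (h : ∀ F : Finset I, F.Nonempty → F.card + d ≤ d * (F.image a ∪ F.image b).card)
    (F : Finset I) :
    F.card ≤ finrank ℝ ↥(F.sup (fun i => LinearMap.range (edgeMap d (a i) (b i)))) := by
  classical
  set A := F.sup (fun i => LinearMap.range (edgeMap d (a i) (b i))) with hAdef
  let s : Setoid V :=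
    { r := fun u v => ∀ x, edgeMap d u v x ∈ A
      iseqv :=
        { refl := fun u x => by simp [edgeMap]
          symm := fun {u v} h x => by
            have := A.neg_mem (h x)
            simpa [edgeMap] using this
          trans := fun {u v w} h1 h2 x => by
            have := A.add_mem (h1 x) (h2 x)
            simpa [edgeMap] using this } }
  let K := Quotient s
  let π : V → K := Quotient.mk s
  have hedge : ∀ i ∈ F, π (a i) = π (b i) := by
    intro i hi
    refine Quotient.sound (s := s) fun x => ?_
    have : LinearMap.range (edgeMap d (a i) (b i)) ≤ A :=
      Finset.le_sup (f := fun i => LinearMap.range (edgeMap d (a i) (b i))) hi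
    exact this ⟨x, rfl⟩
  -- counting
  have hcount : F.card + d * Fintype.card K ≤ d * Fintype.card V := by
    have c1 : F.card = ∑ k : K, (F.filter (fun i => π (a i) = k)).card :=
      Finset.card_eq_sum_card_fiberwise (fun _ _ => Finset.mem_univ _)
    have c2 : Fintype.card V = ∑ k : K, (Finset.univ.filter (fun v => π v = k)).card :=
      Finset.card_eq_sum_card_fiberwise (fun _ _ => Finset.mem_univ _)
    have c3 : d * Fintype.card K = ∑ k : K, d := by simp [mul_comm]
    rw [c1, c2, c3, ← Finset.sum_add_distrib, Finset.mul_sum]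
    refine Finset.sum_le_sum fun k _ => ?_
    by_cases hne : (F.filter (fun i => π (a i) = k)).Nonempty
    · refine (h _ hne).trans (Nat.mul_le_mul_left _ (Finset.card_le_card ?_))
      intro v hv
      simp only [Finset.mem_union, Finset.mem_image, Finset.mem_filter] at hv
      simp only [Finset.mem_filter, Finset.mem_univ, true_and]
      rcases hv with ⟨i, ⟨hi, hk⟩, rfl⟩ | ⟨i, ⟨hi, hk⟩, rfl⟩
      · exact hk
      · rw [← hedge i hi]; exact hk
    · rw [Finset.not_nonempty_iff_eq_empty] at hne
      rw [hne]
      obtain ⟨v, hv⟩ := Quotient.exists_rep k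
      have : 0 < (Finset.univ.filter (fun v => π v = k)).card :=
        Finset.card_pos.2 ⟨v, by simpa using hv⟩
      simp only [Finset.card_empty, zero_add]
      exact Nat.le_mul_of_pos_right _ this
  let S : (K → Fin d → ℝ) →ₗ[ℝ] (V → Fin d → ℝ) :=
    ∑ k : K, (LinearMap.single ℝ (fun _ : V => (Fin d → ℝ)) (Quotient.out k)).comp
      (LinearMap.proj k)
  have htop : A ⊔ LinearMap.range S = ⊤ := by
    rw [eq_top_iff]
    intro m _
    have hm : m = ∑ v, LinearMap.single ℝ (fun _ : V => (Fin d → ℝ)) v (m v) := by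
      ext v k
      simp only [Finset.sum_apply, LinearMap.coe_single]
      rw [Finset.sum_eq_single v]
      · simp
      · intro b _ hb; simp [Pi.single_eq_of_ne hb.symm]
      · simp
    rw [hm]
    refine Submodule.sum_mem _ fun v _ => ?_
    have e : LinearMap.single ℝ (fun _ : V => (Fin d → ℝ)) v (m v) =
        edgeMap d v (Quotient.out (π v)) (m v) + S (Pi.single (π v) (m v)) := by
      have : S (Pi.single (π v) (m v)) =
          LinearMap.single ℝ (fun _ : V => (Fin d → ℝ)) (Quotient.out (π v)) (m v) := by
        simp only [S, LinearMap.sum_apply, LinearMap.comp_apply, LinearMap.proj_apply]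
        rw [Finset.sum_eq_single (π v)]
        · simp
        · intro k _ hk; simp [Pi.single_eq_of_ne hk]
        · simp
      rw [this, edgeMap]; simp
    rw [e]
    refine Submodule.add_mem_sup ?_ ⟨_, rfl⟩
    have : s.r v (Quotient.out (π v)) := s.symm (Quotient.mk_out (s := s) v)
    exact this _
  have hd1 := Submodule.finrank_add_le_finrank_add_finrank A (LinearMap.range S)
  rw [htop, finrank_top] at hd1
  have hd2 := LinearMap.finrank_range_le S
  simp only [Module.finrank_pi_fintype, Module.finrank_self, mul_one, Fintype.card_fin, Finset.sum_const,
    Finset.card_univ, smul_eq_mul] at hd1 hd2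
  have m1 := mul_comm (Fintype.card V) d
  have m2 := mul_comm (Fintype.card K) d
  omega

/-- constraint matrix -/
def cmat {V I R : Type} [DecidableEq V] [CommRing R] {d : ℕ} (a b : I → V) (x : I → Fin d → R) :
    Matrix I (V × Fin d) R :=
  Matrix.of fun i q => ((if q.1 = a i then 1 else 0) - (if q.1 = b i then 1 else 0)) * x i q.2

theorem cmat_mulVec {V I : Type} [Fintype V] [DecidableEq V] {d : ℕ} (a b : I → V)
    (x : I → Fin d → ℝ) (m : V → Fin d → ℝ) (i : I) :
    Matrix.mulVec (cmat a b x) (fun q => m q.1 q.2) i = ∑ k, x i k * (m (a i) k - m (b i) k) := by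
  simp only [Matrix.mulVec, dotProduct, cmat, Matrix.of_apply, Fintype.sum_prod_type]
  rw [Finset.sum_comm]
  refine Finset.sum_congr rfl fun k _ => ?_
  simp only [sub_mul, ite_mul, one_mul, zero_mul, Finset.sum_sub_distrib, Finset.sum_ite_eq',
    Finset.mem_univ, if_true]
  ring

theorem cmat_right_inv {V I : Type} [Fintype V] [DecidableEq V] [Fintype I] [DecidableEq I]
    {d : ℕ} (a b : I → V) (x : I → Fin d → ℝ)
    (h : LinearIndependent ℝ (fun i => edgeMap d (a i) (b i) (x i))) :
    ∃ B : Matrix (V × Fin d) I ℝ, cmat a b x * B = 1 := by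
  rw [← Matrix.mulVec_surjective_iff_exists_right_inverse]
  have h1 : LinearIndependent ℝ (cmat a b x).row := by
    have h2 := h.map' (LinearEquiv.curry ℝ ℝ V (Fin d)).symm.toLinearMap (LinearEquiv.ker _)
    suffices he : (cmat a b x).row = (LinearEquiv.curry ℝ ℝ V (Fin d)).symm.toLinearMap ∘
        (fun i => edgeMap d (a i) (b i) (x i)) by
      rw [he]; exact h2
    ext i q
    obtain ⟨v, k⟩ := q
    simp only [cmat, edgeMap, Matrix.row, Matrix.of_apply, Function.comp, LinearEquiv.coe_coe,
      LinearEquiv.coe_curry_symm, Function.uncurry, LinearMap.sub_apply, LinearMap.coe_single,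
      Pi.sub_apply, Pi.single_apply, sub_mul, ite_mul, one_mul, zero_mul]
    congr 1 <;> split_ifs <;> rfl
  have h3 := h1.rank_matrix
  have h4 : LinearMap.range (cmat a b x).mulVecLin = ⊤ := by
    refine Submodule.eq_top_of_finrank_eq ?_
    rw [Module.finrank_fintype_fun_eq_card]
    exact h3
  rw [LinearMap.range_eq_top] at h4
  exact h4

theorem generic_exists {V M : Type} [Fintype V] [DecidableEq V] [Fintype M] [DecidableEq M]
    {d : ℕ} (a b : M → V)
    (h : ∀ u v : V, u ≠ v → ∃ z : Option M → Fin d → ℝ, LinearIndependent ℝ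
      (fun i : Option M => edgeMap d (i.elim u a) (i.elim v b) (z i))) :
    ∃ x : M → Fin d → ℝ, ∀ u v : V, u ≠ v → ∃ y : Fin d → ℝ, Function.Surjective
      (Matrix.mulVec (cmat (fun i : Option M => i.elim u a) (fun i => i.elim v b)
        (fun i => i.elim y x))) := by
  classical
  have h1 : ∀ s : V × V, s.1 ≠ s.2 → ∃ P : MvPolynomial (M × Fin d) ℝ, P ≠ 0 ∧
      ∀ x : M → Fin d → ℝ, MvPolynomial.eval (fun q => x q.1 q.2) P ≠ 0 →
      ∃ y : Fin d → ℝ, Function.Surjective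
      (Matrix.mulVec (cmat (fun i : Option M => i.elim s.1 a) (fun i => i.elim s.2 b)
        (fun i => i.elim y x))) := by
    rintro ⟨u, v⟩ huv
    obtain ⟨z, hz⟩ := h u v huv
    obtain ⟨B, hB⟩ := cmat_right_inv _ _ _ hz
    let A' : Matrix (Option M) (V × Fin d) (MvPolynomial (M × Fin d) ℝ) :=
      (cmat (fun i : Option M => i.elim u a) (fun i => i.elim v b)
        (fun i k => i.elim (MvPolynomial.C (z none k)) (fun m => MvPolynomial.X (m, k))))
    let B' : Matrix (V × Fin d) (Option M) (MvPolynomial (M × Fin d) ℝ) := B.map MvPolynomial.C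
    let AB : Matrix (Option M) (Option M) (MvPolynomial (M × Fin d) ℝ) := A' * B'
    let P : MvPolynomial (M × Fin d) ℝ := AB.det
    have hP : ∀ x : M → Fin d → ℝ, MvPolynomial.eval (fun q => x q.1 q.2) P =
        (cmat (fun i : Option M => i.elim u a) (fun i => i.elim v b)
        (fun i => i.elim (z none) x) * B).det := by
      intro x
      change MvPolynomial.eval _ (Matrix.det (A' * B')) = _
      rw [RingHom.map_det, RingHom.mapMatrix_apply, Matrix.map_mul]
      congr 2
      · ext i q
        simp only [A', cmat, Matrix.map_apply, Matrix.of_apply, map_mul,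
          map_sub]
        congr 1
        · congr 1 <;> split_ifs <;> simp
        · cases i <;> simp
      · ext i q
        simp [B']
    refine ⟨P, ?_, ?_⟩
    · intro h0
      have := hP (fun m => z (some m))
      rw [h0, map_zero] at this
      have hz' : (fun i : Option M => i.elim (z none) (fun m => z (some m))) = z := by
        ext i; cases i <;> rfl
      rw [hz', hB, Matrix.det_one] at this
      exact zero_ne_one this
    · intro x hx
      rw [hP x] at hx
      refine ⟨z none, ?_⟩
      rw [Matrix.mulVec_surjective_iff_exists_right_inverse]
      refine ⟨B * (cmat (fun i : Option M => i.elim u a) (fun i => i.elim v b)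
        (fun i => i.elim (z none) x) * B)⁻¹, ?_⟩
      rw [← Matrix.mul_assoc]
      exact Matrix.mul_nonsing_inv _ (isUnit_iff_ne_zero.2 hx)
  choose! P hP0 hP using h1
  let Q : MvPolynomial (M × Fin d) ℝ := ∏ s ∈ Finset.univ.filter (fun s : V × V => s.1 ≠ s.2), P s
  have hQ : Q ≠ 0 := Finset.prod_ne_zero_iff.2 fun s hs => hP0 s (by simpa using hs)
  have hx : ∃ x : M × Fin d → ℝ, MvPolynomial.eval x Q ≠ 0 := by
    by_contra hc
    push Not at hc
    exact hQ (MvPolynomial.funext fun x => by rw [hc x, map_zero])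
  obtain ⟨x, hx⟩ := hx
  rw [map_prod, Finset.prod_ne_zero_iff] at hx
  refine ⟨fun m k => x (m, k), fun u v huv => hP (u, v) huv _ (hx (u, v) (by simpa using huv))⟩

/-- constraint linear map -/
noncomputable def cmap {V I : Type} [Fintype V] [DecidableEq V] {d : ℕ}
    (a b : I → V) (x : I → Fin d → ℝ) : (V → Fin d → ℝ) →ₗ[ℝ] (I → ℝ) :=
  (cmat a b x).mulVecLin.comp (LinearEquiv.curry ℝ ℝ V (Fin d)).symm.toLinearMap

theorem cmap_apply {V I : Type} [Fintype V] [DecidableEq V] {d : ℕ}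
    (a b : I → V) (x : I → Fin d → ℝ) (m : V → Fin d → ℝ) (i : I) :
    cmap a b x m i = ∑ k, x i k * (m (a i) k - m (b i) k) :=
  cmat_mulVec a b x m i

theorem cmap_finrank_ker {V I : Type} [Fintype V] [DecidableEq V] [Fintype I] {d : ℕ}
    (a b : I → V) (x : I → Fin d → ℝ) (h : Function.Surjective (cmap a b x)) :
    Fintype.card I + finrank ℝ (LinearMap.ker (cmap a b x)) = d * Fintype.card V := by
  have := LinearMap.finrank_range_add_finrank_ker (cmap a b x)
  rw [LinearMap.range_eq_top.2 h, finrank_top] at this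
  simp only [Module.finrank_pi_fintype, Module.finrank_self, Finset.sum_const, Finset.card_univ,
    smul_eq_mul, mul_one, Fintype.card_fin] at this
  rw [this, mul_comm]

theorem main_exists {V E : Type} [Fintype V] [Fintype E] [DecidableEq V] [DecidableEq E]
    (d : ℕ) (hd : 2 ≤ d) (ends : E → V × V) (c : E → ℕ)
    (hsum : (∑ e : E, (c e : ℤ)) = d * Fintype.card V - (d + 1))
    (hF : ∀ F : Finset E, F.Nonempty →
            (∑ e ∈ F, (c e : ℤ)) ≤ d * (VF ends F).card - (d + 1)) :
    ∃ p : V → (Fin d → ℝ), Function.Injective p ∧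
      Module.finrank ℝ ↥(dirMotionSpace d ends p) = d + 1 := by
  classical
  let M := Σ e : E, Fin (c e)
  let a : M → V := fun m => (ends m.1).1
  let b : M → V := fun m => (ends m.1).2
  have hM : Fintype.card M + (d + 1) = d * Fintype.card V := by
    have : Fintype.card M = ∑ e, c e := by simp [M]
    rw [this]; zify; linarith
  have hcnt : ∀ F : Finset M, F.Nonempty →
      F.card + (d + 1) ≤ d * (F.image a ∪ F.image b).card := by
    intro F hne
    have h1 := hF (F.image Sigma.fst) (hne.image _)
    have h2 : VF ends (F.image Sigma.fst) = F.image a ∪ F.image b := by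
      simp only [VF, Finset.image_image]; rfl
    have h3 : F.card ≤ ∑ e ∈ F.image Sigma.fst, c e := by
      have : F ⊆ (F.image Sigma.fst).sigma (fun e => (Finset.univ : Finset (Fin (c e)))) := by
        intro m hm
        exact Finset.mem_sigma.2 ⟨Finset.mem_image_of_mem _ hm, Finset.mem_univ _⟩
      exact (Finset.card_le_card this).trans_eq ((Finset.card_sigma _ _).trans (by simp))
    rw [h2] at h1
    zify at h3 ⊢
    linarith
  have hind : ∀ u v : V, u ≠ v → ∃ z : Option M → Fin d → ℝ, LinearIndependent ℝ
      (fun i : Option M => edgeMap d (i.elim u a) (i.elim v b) (z i)) := by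
    intro u v huv
    have hc : ∀ F : Finset (Option M), F.Nonempty → F.card + d ≤
        d * (F.image (fun i : Option M => i.elim u a) ∪
          F.image (fun i : Option M => i.elim v b)).card := by
      intro F hne
      have hc1 : F.card ≤ (Finset.eraseNone F).card + 1 := by
        have : F ⊆ Finset.insertNone (Finset.eraseNone F) := by
          rw [Finset.insertNone_eraseNone]; exact Finset.subset_insert _ _
        exact (Finset.card_le_card this).trans_eq (Finset.card_insertNone _)
      by_cases he : (Finset.eraseNone F).Nonempty
      · have h1 := hcnt _ he
        have h2 : (Finset.eraseNone F).image a ∪ (Finset.eraseNone F).image b ⊆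
            F.image (fun i : Option M => i.elim u a) ∪
          F.image (fun i : Option M => i.elim v b) := by
          refine Finset.union_subset_union ?_ ?_
          · intro w hw
            simp only [Finset.mem_image, Finset.mem_eraseNone] at hw ⊢
            obtain ⟨m, hm, rfl⟩ := hw
            exact ⟨some m, hm, rfl⟩
          · intro w hw
            simp only [Finset.mem_image, Finset.mem_eraseNone] at hw ⊢
            obtain ⟨m, hm, rfl⟩ := hw
            exact ⟨some m, hm, rfl⟩
        have h3 := Nat.mul_le_mul_left d (Finset.card_le_card h2)
        omega
      · rw [Finset.not_nonempty_iff_eq_empty] at he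
        have hnone : none ∈ F := by
          obtain ⟨o, ho⟩ := hne
          cases o with
          | none => exact ho
          | some m =>
            have : m ∈ Finset.eraseNone F := Finset.mem_eraseNone.2 ho
            rw [he] at this; simp at this
        have h2 : ({u, v} : Finset V) ⊆ F.image (fun i : Option M => i.elim u a) ∪
          F.image (fun i : Option M => i.elim v b) := by
          intro w hw
          simp only [Finset.mem_insert, Finset.mem_singleton] at hw
          rcases hw with rfl | rfl
          · exact Finset.mem_union_left _ (Finset.mem_image.2 ⟨none, hnone, rfl⟩)
          · exact Finset.mem_union_right _ (Finset.mem_image.2 ⟨none, hnone, rfl⟩)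
        have h3 := Nat.mul_le_mul_left d (Finset.card_le_card h2)
        rw [Finset.card_pair huv] at h3
        rw [he, Finset.card_empty] at hc1
        omega
    obtain ⟨w, hw, hl⟩ := rado_aux_s8 _ _ rfl (hall_cond d _ _ hc)
    choose z hz using hw
    refine ⟨z, ?_⟩
    simpa only [hz] using hl
  obtain ⟨x, hx⟩ := generic_exists a b hind
  let cst : (Fin d → ℝ) →ₗ[ℝ] (V → Fin d → ℝ) := LinearMap.pi fun _ => LinearMap.id
  have hcard : 1 < Fintype.card V := by
    by_contra hlt
    have : d * Fintype.card V ≤ d * 1 := Nat.mul_le_mul_left d (by omega)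
    omega
  have : Nontrivial V := Fintype.one_lt_card_iff_nontrivial.1 hcard
  obtain ⟨u0, v0, huv0⟩ := exists_pair_ne V
  have hcst : finrank ℝ (LinearMap.range cst) = d := by
    rw [LinearMap.finrank_range_of_inj]
    · simp
    · intro f g hfg
      exact congrFun hfg u0
  have hsurj : Function.Surjective (cmap a b x) := by
    obtain ⟨y, hy⟩ := hx u0 v0 huv0
    intro f
    obtain ⟨m, hm⟩ := hy (fun i => i.elim 0 f)
    refine ⟨fun v k => m (v, k), ?_⟩
    ext i
    have := congrFun hm (some i)
    have h2 := cmat_mulVec (fun i : Option M => i.elim u0 a) (fun i => i.elim v0 b)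
        (fun i => i.elim y x) (fun v k => m (v, k)) (some i)
    rw [cmap_apply]
    exact h2.symm.trans this
  have hker := cmap_finrank_ker a b x hsurj
  have hcstker : ∀ {I : Type} (a b : I → V) (x : I → Fin d → ℝ),
      LinearMap.range cst ≤ LinearMap.ker (cmap a b x) := by
    rintro I a b x _ ⟨f, rfl⟩
    rw [LinearMap.mem_ker]
    ext i
    rw [cmap_apply]
    simp [cst]
  have hex : ∃ p ∈ LinearMap.ker (cmap a b x), p ∉ LinearMap.range cst := by
    by_contra hc
    push Not at hc
    have := Submodule.finrank_mono (show LinearMap.ker (cmap a b x) ≤ LinearMap.range cst from hc)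
    omega
  obtain ⟨p, hpk, hpc⟩ := hex
  refine ⟨p, ?_, ?_⟩
  · intro u v hp
    by_contra huv
    obtain ⟨y, hy⟩ := hx u v huv
    have hs : Function.Surjective (cmap (fun i : Option M => i.elim u a) (fun i => i.elim v b)
        (fun i => i.elim y x)) := by
      intro f
      obtain ⟨m, hm⟩ := hy f
      refine ⟨fun v k => m (v, k), ?_⟩
      exact hm
    have hk := cmap_finrank_ker _ _ _ hs
    rw [Fintype.card_option] at hk
    have heq : LinearMap.range cst = LinearMap.ker (cmap (fun i : Option M => i.elim u a)
        (fun i => i.elim v b) (fun i => i.elim y x)) :=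
      Submodule.eq_of_le_of_finrank_eq (hcstker _ _ _) (by omega)
    apply hpc
    rw [heq, LinearMap.mem_ker]
    ext i
    rw [cmap_apply]
    cases i with
    | none => simp [hp]
    | some i =>
      have := congrFun (LinearMap.mem_ker.1 hpk) i
      rw [cmap_apply] at this
      exact this
  · apply le_antisymm
    · have hle : dirMotionSpace d ends p ≤ LinearMap.ker (cmap a b x) := by
        intro m hm
        rw [LinearMap.mem_ker]
        ext i
        rw [cmap_apply]
        have h1 := (Submodule.mem_iInf _).1 hm i.1
        rw [Submodule.mem_comap, Submodule.mem_span_singleton] at h1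
        obtain ⟨t, ht⟩ := h1
        have h2 := congrFun (LinearMap.mem_ker.1 hpk) i
        rw [cmap_apply] at h2
        have h3 : ∀ k, m (a i) k - m (b i) k = t * (p (a i) k - p (b i) k) := fun k =>
          (congrFun ht k).symm
        calc ∑ k, x i k * (m (a i) k - m (b i) k)
            = t * ∑ k, x i k * (p (a i) k - p (b i) k) := by
              rw [Finset.mul_sum]
              exact Finset.sum_congr rfl fun k _ => by rw [h3]; ring
          _ = 0 := by rw [h2]; simp
      have := Submodule.finrank_mono hle
      omega
    · have hlt : LinearMap.range cst < dirMotionSpace d ends p := by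
        refine lt_of_le_of_ne ?_ ?_
        · rintro _ ⟨f, rfl⟩
          refine (Submodule.mem_iInf _).2 fun e => ?_
          rw [Submodule.mem_comap]
          simp [cst]
        · intro heq
          apply hpc
          rw [heq]
          refine (Submodule.mem_iInf _).2 fun e => ?_
          rw [Submodule.mem_comap]
          exact Submodule.mem_span_singleton_self _
      have := Submodule.finrank_lt_finrank_of_lt hlt
      omega

theorem collinear_exists {V E : Type} [Fintype V] [DecidableEq V]
    (d : ℕ) (hd : 2 ≤ d) (ends : E → V × V) (hloop : ∀ e : E, (ends e).1 ≠ (ends e).2)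
    (hV : 3 ≤ Fintype.card V) :
    ∃ p : V → (Fin d → ℝ), Function.Injective p ∧
      Module.finrank ℝ ↥(dirMotionSpace d ends p) ≠ d + 1 := by
  classical
  let i0 : Fin d := ⟨0, by omega⟩
  let ι : V → ℝ := fun v => ((Fintype.equivFin V v : ℕ) : ℝ)
  have hι : Function.Injective ι := by
    intro u v h
    simpa [ι, Fin.val_inj] using h
  refine ⟨fun v => Pi.single i0 (ι v), fun u v h => hι (Pi.single_injective _ h), ?_⟩
  let Φ : ((V → ℝ) × ({k : Fin d // k ≠ i0} → ℝ)) →ₗ[ℝ] (V → Fin d → ℝ) :=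
    { toFun := fun q v k => if h : k = i0 then q.1 v else q.2 ⟨k, h⟩
      map_add' := by intro q r; ext v k; simp only [Pi.add_apply]; split_ifs <;> simp
      map_smul' := by intro q r; ext v k; simp only [Pi.smul_apply]; split_ifs <;> simp }
  have hinj : Function.Injective Φ := by
    have : Nonempty V := Fintype.card_pos_iff.1 (by omega)
    obtain ⟨v0⟩ := this
    rintro ⟨f, g⟩ ⟨f', g'⟩ h
    refine Prod.ext ?_ ?_
    · ext v
      simpa [Φ] using congrFun (congrFun h v) i0
    · ext ⟨k, hk⟩
      simpa [Φ, hk] using congrFun (congrFun h v0) k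
  have hle : LinearMap.range Φ ≤ dirMotionSpace d ends (fun v => Pi.single i0 (ι v)) := by
    rintro _ ⟨⟨f, g⟩, rfl⟩
    refine (Submodule.mem_iInf _).2 fun e => ?_
    rw [Submodule.mem_comap, Submodule.mem_span_singleton]
    have hne : ι (ends e).1 - ι (ends e).2 ≠ 0 := sub_ne_zero.2 fun h => hloop e (hι h)
    refine ⟨(f (ends e).1 - f (ends e).2) / (ι (ends e).1 - ι (ends e).2), ?_⟩
    ext k
    by_cases hk : k = i0
    · subst hk
      simp [Φ]
      field_simp
    · simp [Φ, hk]
  have h1 := Submodule.finrank_mono hle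
  rw [LinearMap.finrank_range_of_inj hinj, Module.finrank_prod,
    Module.finrank_fintype_fun_eq_card, Module.finrank_fintype_fun_eq_card] at h1
  have h2 : Fintype.card {k : Fin d // k ≠ i0} = d - 1 := by
    rw [Fintype.card_subtype_compl]; simp
  omega

end helpers

theorem statement_8
    (d : ℕ) (hd : 2 ≤ d)
    (V E : Type) [Fintype V] [Fintype E] [DecidableEq V] [DecidableEq E]
    (ends : E → V × V) (hloop : ∀ e : E, (ends e).1 ≠ (ends e).2) :
    ∃ p : V → (Fin d → ℝ),
      Function.Injective p ∧
      (Module.finrank ℝ ↥(dirMotionSpace d ends p) = d + 1 ↔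
        ∃ c : E → ℕ,
          (∀ e : E, c e ≤ d - 1) ∧
          (∑ e : E, (c e : ℤ)) = d * Fintype.card V - (d + 1) ∧
          (∀ F : Finset E, F.Nonempty →
            (∑ e ∈ F, (c e : ℤ)) ≤ d * (VF ends F).card - (d + 1))) := by
  by_cases h2 : ∃ c : E → ℕ,
          (∀ e : E, c e ≤ d - 1) ∧
          (∑ e : E, (c e : ℤ)) = d * Fintype.card V - (d + 1) ∧
          (∀ F : Finset E, F.Nonempty →
            (∑ e ∈ F, (c e : ℤ)) ≤ d * (VF ends F).card - (d + 1))
  · have h2' := h2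
    obtain ⟨c, _, hs, hF⟩ := h2'
    obtain ⟨p, hp, hr⟩ := main_exists d hd ends c hs hF
    exact ⟨p, hp, iff_of_true hr h2⟩
  · suffices h : ∃ p : V → (Fin d → ℝ), Function.Injective p ∧
        Module.finrank ℝ ↥(dirMotionSpace d ends p) ≠ d + 1 by
      obtain ⟨p, hp, hr⟩ := h
      exact ⟨p, hp, iff_of_false hr h2⟩
    by_cases hV : 3 ≤ Fintype.card V
    · exact collinear_exists d hd ends hloop hV
    have htop : Module.finrank ℝ (V → Fin d → ℝ) = Fintype.card V * d := by
      simp [Module.finrank_pi_fintype]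
    let p : V → Fin d → ℝ := fun v _ => ((Fintype.equivFin V v : ℕ) : ℝ)
    have hp : Function.Injective p := by
      intro u v h
      have := congrFun h ⟨0, by omega⟩
      simpa [p, Fin.val_inj] using this
    refine ⟨p, hp, ?_⟩
    by_cases hV2 : Fintype.card V = 2
    · have hE : IsEmpty E := by
        by_contra hne
        rw [not_isEmpty_iff] at hne
        obtain ⟨e0⟩ := hne
        apply h2
        refine ⟨fun e => if e = e0 then d - 1 else 0, fun e => ?_, ?_, ?_⟩
        · dsimp only; split_ifs <;> omega
        · rw [← Nat.cast_sum, hV2]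
          simp only [Finset.sum_ite_eq', Finset.mem_univ, if_true]
          push_cast [Nat.cast_sub (show 1 ≤ d by omega)]
          ring
        · intro F hF
          have hc : 2 ≤ (VF ends F).card := by
            obtain ⟨e, he⟩ := hF
            rw [← Finset.card_pair (hloop e)]
            refine Finset.card_le_card ?_
            intro w hw
            simp only [Finset.mem_insert, Finset.mem_singleton] at hw
            rcases hw with rfl | rfl
            · exact Finset.mem_union_left _ (Finset.mem_image.2 ⟨e, he, rfl⟩)
            · exact Finset.mem_union_right _ (Finset.mem_image.2 ⟨e, he, rfl⟩)
          have h3 := Nat.mul_le_mul_left d hc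
          have h4 : ∑ e ∈ F, (if e = e0 then d - 1 else 0) ≤ d - 1 := by
            rw [Finset.sum_ite_eq']; split_ifs <;> omega
          rw [← Nat.cast_sum]
          have h5 : (∑ e ∈ F, (if e = e0 then d - 1 else 0)) + (d + 1) ≤
            d * (VF ends F).card := by omega
          have h6 : ((∑ e ∈ F, (if e = e0 then d - 1 else 0) : ℕ) : ℤ) + (d + 1) ≤
            d * (VF ends F).card := by exact_mod_cast h5
          linarith
      have : dirMotionSpace d ends p = ⊤ := by
        rw [dirMotionSpace, iInf_of_empty]
      rw [this, finrank_top, htop, hV2]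
      omega
    · have h1 := Submodule.finrank_le (dirMotionSpace d ends p)
      rw [htop] at h1
      have : Fintype.card V * d ≤ 1 * d := Nat.mul_le_mul_right d (by omega)
      omega
end

section
/- Let U be a finite-dimensional real vector space, E a finite set, and for each e∈E let A_e be a linear subspace of U and x_e∈A_e a nonzero vector. Assume the representative points are in generic position: for every S⊆E and every e∈S, if x_e lies in the span of {x_{e'} : e'∈S, e'≠e}, then A_e is contained in the span of {x_{e'} : e'∈S, e'≠e}. Then dim span{x_e : e∈E} = min over all subsets F⊆E of (|E∖F| + dim Σ_{e∈F} A_e). (Lovász's theorem on the maximal matroid of a family of flats.) -/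
/- STATEMENT 9 (Lovász): if representative points `x_e ∈ A_e` are in generic position, then
`dim span{x_e} = min_{F ⊆ E} (|E∖F| + dim Σ_{e∈F} A_e)`. -/

set_option synthInstance.maxHeartbeats 1000000
set_option maxHeartbeats 1000000

theorem statement_9
    (U : Type) [AddCommGroup U] [Module ℝ U] [FiniteDimensional ℝ U]
    (E : Type) [Fintype E] [DecidableEq E]
    (A : E → Submodule ℝ U) (x : E → U)
    (hmem : ∀ e : E, x e ∈ A e) (hne : ∀ e : E, x e ≠ 0)
    (hgen : ∀ S : Finset E, ∀ e ∈ S,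
      x e ∈ Submodule.span ℝ (x '' ((S.erase e : Finset E) : Set E)) →
      A e ≤ Submodule.span ℝ (x '' ((S.erase e : Finset E) : Set E))) :
    IsLeast
      {n : ℕ | ∃ F : Finset E,
        n = (Finset.univ \ F).card + Module.finrank ℝ ↥(⨆ e ∈ F, A e)}
      (Module.finrank ℝ ↥(Submodule.span ℝ (Set.range x))) := by
  classical
  have hlow : ∀ F : Finset E, Module.finrank ℝ ↥(Submodule.span ℝ (Set.range x)) ≤
      (Finset.univ \ F).card + Module.finrank ℝ ↥(⨆ e ∈ F, A e) := by
    intro F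
    have h1 : Submodule.span ℝ (Set.range x) ≤
        Submodule.span ℝ (((Finset.univ \ F).image x : Finset U) : Set U) ⊔ ⨆ e ∈ F, A e := by
      rw [Submodule.span_le]
      rintro _ ⟨e, rfl⟩
      by_cases he : e ∈ F
      · exact Submodule.mem_sup_right
          ((le_iSup₂ (f := fun e (_ : e ∈ F) => A e) e he) (hmem e))
      · refine Submodule.mem_sup_left (Submodule.subset_span ?_)
        exact Finset.mem_coe.2 (Finset.mem_image_of_mem x (by simp [he]))
    have h2 := Submodule.finrank_mono h1
    have h3 := Submodule.finrank_add_le_finrank_add_finrank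
      (Submodule.span ℝ (((Finset.univ \ F).image x : Finset U) : Set U)) (⨆ e ∈ F, A e)
    have h4 := finrank_span_finset_le_card (R := ℝ) ((Finset.univ \ F).image x)
    have h5 : ((Finset.univ \ F).image x).card ≤ (Finset.univ \ F).card := Finset.card_image_le
    rw [Set.finrank] at h4
    omega
  refine ⟨?_, ?_⟩
  · let P : Finset E → Prop := fun F => (Finset.univ \ F).card +
      Module.finrank ℝ ↥(Submodule.span ℝ (x '' (F : Set E))) ≤
      Module.finrank ℝ ↥(Submodule.span ℝ (Set.range x))
    have hP : P Finset.univ := by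
      simp only [P]
      rw [Finset.coe_univ, Set.image_univ, Finset.sdiff_self, Finset.card_empty, zero_add]
    obtain ⟨F, hF⟩ := exists_minimal_of_wellFoundedLT P ⟨_, hP⟩
    have hFP : P F := hF.prop
    have key : ∀ e ∈ F, x e ∈ Submodule.span ℝ (x '' ((F.erase e : Finset E) : Set E)) := by
      intro e he
      by_contra hn
      have hlt : Submodule.span ℝ (x '' ((F.erase e : Finset E) : Set E)) <
          Submodule.span ℝ (x '' (F : Set E)) := by
        refine lt_of_le_of_ne (Submodule.span_mono (Set.image_mono ?_)) ?_
        · exact_mod_cast Finset.erase_subset e F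
        · intro h
          rw [h] at hn
          exact hn (Submodule.subset_span ⟨e, he, rfl⟩)
      have h1 := Submodule.finrank_lt_finrank_of_lt hlt
      have h2 : P (F.erase e) := by
        have h3 := Finset.card_sdiff_add_card_eq_card (Finset.subset_univ F)
        have h4 := Finset.card_sdiff_add_card_eq_card (Finset.subset_univ (F.erase e))
        have h5 := Finset.card_erase_add_one he
        simp only [P] at hFP ⊢
        omega
      have h6 := hF.le_of_le h2 (Finset.erase_subset e F) he
      simp at h6
    have hle : (⨆ e ∈ F, A e) ≤ Submodule.span ℝ (x '' (F : Set E)) := by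
      refine iSup₂_le fun e he => (hgen F e he (key e he)).trans
        (Submodule.span_mono (Set.image_mono ?_))
      exact_mod_cast Finset.erase_subset e F
    have h7 := Submodule.finrank_mono hle
    have h8 := hlow F
    refine ⟨F, ?_⟩
    simp only [P] at hFP
    omega
  · rintro n ⟨F, rfl⟩
    exact hlow F
end
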